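/- Let F be a field of characteristic p > 0, V a 3-dimensional F-vector space, and G ⊆ SL(V) a finite subgroup with V = Fv ⊕ W a direct sum of G-submodules, dim_F W = 2. Let m denote the unique homogeneous maximal ideal of S(W)^{T(G)} (which, by Nakajima's theorem, is a polynomial ring F[a₁,a₂] on two homogeneous generators). Since T(G) is normal in G, every g ∈ G stabilizes S(W)^{T(G)}, m, and m², and hence induces an F-linear map on the 2-dimensional space m/m². Then the following are equivalent: (1) S(V)^G is Gorenstein; (2) for every g ∈ G, det(g|_W) = det(g|_{m/m²}). -/

import Mathlib

noncomputable section
open CategoryTheory Matrix MvPolynomial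

universe u

/-- A module `M` over `R` has finite injective dimension iff the Ext functors
`Ext^i(-, M)` vanish for all sufficiently large `i`. -/
def HasFiniteInjectiveDimension (R : Type u) [CommRing R] (M : ModuleCat.{u} R) : Prop :=
  ∃ n : ℕ, ∀ (N : ModuleCat.{u} R) (i : ℕ), n < i →
    Subsingleton (((Ext R (ModuleCat.{u} R) i).obj (Opposite.op N)).obj M)

/-- A commutative ring is Gorenstein if it is Noetherian and its localization at every
prime ideal has finite injective dimension over itself. -/
def IsGorensteinRing (R : Type u) [CommRing R] : Prop :=
  IsNoetherianRing R ∧ ∀ (P : Ideal R) [P.IsPrime],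
    HasFiniteInjectiveDimension (Localization.AtPrime P)
      (ModuleCat.of (Localization.AtPrime P) (Localization.AtPrime P))

/-- The substitution action of a matrix on polynomials: `X i ↦ ∑ j, M i j • X j`. -/
def polyAct {F : Type u} [CommSemiring F] {m : ℕ} (M : Matrix (Fin m) (Fin m) F) :
    MvPolynomial (Fin m) F →ₐ[F] MvPolynomial (Fin m) F :=
  MvPolynomial.aeval fun i => ∑ j, M i j • MvPolynomial.X j

/-- The subalgebra of polynomials invariant under a set of matrices. -/
def invariantAlg {F : Type u} [CommSemiring F] {m : ℕ} (S : Set (Matrix (Fin m) (Fin m) F)) :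
    Subalgebra F (MvPolynomial (Fin m) F) where
  carrier := {f | ∀ M ∈ S, polyAct M f = f}
  mul_mem' := fun hf hg => fun M hM => by rw [_root_.map_mul, hf M hM, hg M hM]
  add_mem' := fun hf hg => fun M hM => by rw [_root_.map_add, hf M hM, hg M hM]
  algebraMap_mem' := fun r => fun M hM => (polyAct M).commutes r

/-- The invariant ring `S(V)^G` for a subgroup `G` of `SL(m, F)`, where `S(V)` is realised
as the polynomial ring `F[X 0, …, X (m-1)]`. -/
def invariantRing {F : Type u} [Field F] {m : ℕ}
    (G : Subgroup (Matrix.SpecialLinearGroup (Fin m) F)) :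
    Subalgebra F (MvPolynomial (Fin m) F) :=
  invariantAlg {M | ∃ g ∈ G, (g : Matrix (Fin m) (Fin m) F) = M}

/-- A matrix `M` is a transvection if `rank (M - 1) = 1` and `(M - 1)² = 0`. -/
def IsTransvectionMat {F : Type u} [Field F] {m : ℕ} (M : Matrix (Fin m) (Fin m) F) : Prop :=
  (M - 1).rank = 1 ∧ (M - 1) * (M - 1) = 0

/-- `T(G)`: the subgroup generated by all transvections contained in `G`. -/
def transSubgroup {F : Type u} [Field F] {m : ℕ}
    (G : Subgroup (Matrix.SpecialLinearGroup (Fin m) F)) :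
    Subgroup (Matrix.SpecialLinearGroup (Fin m) F) :=
  Subgroup.closure {g | g ∈ G ∧ IsTransvectionMat (g : Matrix (Fin m) (Fin m) F)}

/-- The matrix of the restriction `g|W` of `g` to the coordinate plane
`W = span {e 1, e 2}` (with respect to the standard basis `{e 1, e 2}` of `W`). -/
def subW {F : Type u} [Field F] (g : Matrix.SpecialLinearGroup (Fin 3) F) :
    Matrix (Fin 2) (Fin 2) F :=
  Matrix.submatrix (g : Matrix (Fin 3) (Fin 3) F) Fin.succ Fin.succ

theorem subsingleton_ext_iff (R : Type u) [CommRing R] (N M : ModuleCat.{u} R) (n : ℕ) :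
    Subsingleton (((Ext R (ModuleCat.{u} R) (n + 1)).obj (Opposite.op N)).obj M) ↔
      Subsingleton (Abelian.Ext N M (n + 1)) := by
  let P := projectiveResolution N
  rw [← ModuleCat.isZero_iff_subsingleton, (P.isoExt (R := R) (n + 1) M).isZero_iff,
    ← HomologicalComplex.exactAt_iff_isZero_homology,
    HomologicalComplex.exactAt_iff' _ n (n + 1) (n + 2) (by simp) (by simp),
    ShortComplex.moduleCat_exact_iff]
  constructor
  · intro h
    refine subsingleton_of_forall_eq 0 fun α => ?_
    obtain ⟨f, hf, rfl⟩ := P.extMk_surjective α (n + 2) rfl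
    rw [P.extMk_eq_zero_iff _ _ _ _ n rfl]
    obtain ⟨g, hg⟩ := h f hf
    exact ⟨g, hg⟩
  · intro h f hf
    have := (P.extMk_eq_zero_iff f (n + 2) rfl hf n rfl).1 (Subsingleton.elim _ _)
    exact this

theorem hasFiniteInjectiveDimension_iff (R : Type u) [CommRing R] (M : ModuleCat.{u} R) :
    HasFiniteInjectiveDimension R M ↔ ∃ n, HasInjectiveDimensionLE M n := by
  constructor
  · rintro ⟨n, hn⟩
    refine ⟨n, ?_⟩
    apply hasInjectiveDimensionLT_of_enoughProjectives M (n + 1)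
    exact fun N => (subsingleton_ext_iff R N M n).1 (hn N (n + 1) n.lt_succ_self)
  · rintro ⟨n, hn⟩
    refine ⟨n, fun N i hi => ?_⟩
    obtain ⟨i, rfl⟩ : ∃ j, i = j + 1 := ⟨i - 1, by omega⟩
    exact (subsingleton_ext_iff R N M i).2 (HasInjectiveDimensionLT.subsingleton M (n + 1) _ hi N)

theorem hasInjectiveDimensionLE_coextendScalars {A R : Type u} [CommRing A] [CommRing R]
    (f : A →+* R)
    [Module.Projective A ((ModuleCat.restrictScalars.{u} f).obj (ModuleCat.of R R))]
    (n : ℕ) (M : ModuleCat.{u} A) [HasInjectiveDimensionLE M n] :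
    HasInjectiveDimensionLE ((ModuleCat.coextendScalars.{u, u, u} f).obj M) n := by
  have hinj : (ModuleCat.coextendScalars.{u, u, u} f).PreservesInjectiveObjects := by
    refine Functor.preservesInjectiveObjects_of_adjunction_of_preservesMonomorphisms
      (ModuleCat.restrictCoextendScalarsAdj.{u, u, u} f)
  induction n generalizing M with
  | zero =>
    have injle : HasInjectiveDimensionLE M 0 := ‹_›
    simp only [HasInjectiveDimensionLE, zero_add, ← injective_iff_hasInjectiveDimensionLT_one]
      at injle ⊢
    exact Functor.injective_obj _ _
  | succ n ih =>
    have ei : EnoughInjectives (ModuleCat.{u} A) := inferInstance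
    rcases ei.1 M with ⟨I, inj, i, mono_i⟩
    let T := ShortComplex.mk i (Limits.cokernel.π i) (Limits.cokernel.condition i)
    have hT : T.ShortExact := { exact := ShortComplex.exact_cokernel i }
    have hTi : Function.Injective (ConcreteCategory.hom T.f) := (ModuleCat.mono_iff_injective _).1 hT.mono_f
    have hTs : Function.Surjective (ConcreteCategory.hom T.g) := (ModuleCat.epi_iff_surjective _).1 hT.epi_g
    have hTe : Function.Exact (ConcreteCategory.hom T.f) (ConcreteCategory.hom T.g) :=
      (ShortComplex.ShortExact.moduleCat_exact_iff_function_exact _).mp hT.1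
    let F := ModuleCat.coextendScalars.{u, u, u} f
    let TS : ShortComplex (ModuleCat.{u} R) := ShortComplex.mk (F.map T.f) (F.map T.g) (by
      ext g x
      change T.g (T.f (g x)) = 0
      exact hTe.apply_apply_eq_zero _)
    have hTS : TS.ShortExact := by
      refine { exact := ?_, mono_f := ?_, epi_g := ?_ }
      · refine (ShortComplex.ShortExact.moduleCat_exact_iff_function_exact _).mpr fun y => ⟨fun hy => ?_, ?_⟩
        · have h1 : ∀ r, ∃ m, T.f m = ModuleCat.CoextendScalars.equiv f _ y r := fun r => (hTe _).1 (by
            have := congrArg (fun z => ModuleCat.CoextendScalars.equiv f _ z r) hy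
            exact this)
          choose m hm using h1
          refine ⟨(ModuleCat.CoextendScalars.equiv f _).symm
            { toFun := m, map_add' := fun a b => hTi ?_, map_smul' := fun a b => hTi ?_ }, ?_⟩
          · rw [map_add, hm, hm, hm]; exact map_add (ModuleCat.CoextendScalars.equiv f _ y) _ _
          · rw [hm, RingHom.id_apply]
            refine (LinearMap.map_smul (ModuleCat.CoextendScalars.equiv f _ y) _ _).trans ?_
            rw [← hm]
            exact (LinearMap.map_smul T.f.hom a (m b)).symm
          · apply ModuleCat.CoextendScalars.ext
            ext r
            exact hm r
        · rintro ⟨x, rfl⟩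
          apply ModuleCat.CoextendScalars.ext
          ext r
          exact hTe.apply_apply_eq_zero _
      · refine (ModuleCat.mono_iff_injective _).2 fun x y hxy => ?_
        apply ModuleCat.CoextendScalars.ext
        ext r
        apply hTi
        have := congrArg (fun z => ModuleCat.CoextendScalars.equiv f _ z r) hxy
        exact this
      · refine (ModuleCat.epi_iff_surjective _).2 fun y => ?_
        obtain ⟨h, hh⟩ := Module.projective_lifting_property T.g.hom
          (ModuleCat.CoextendScalars.equiv f _ y) hTs
        refine ⟨(ModuleCat.CoextendScalars.equiv f _).symm h, ?_⟩
        apply ModuleCat.CoextendScalars.ext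
        ext r
        exact LinearMap.congr_fun hh r
    have h3 := (hT.hasInjectiveDimensionLT_X₃_iff n ‹_›).mpr ‹_›
    have h2 : Injective TS.X₂ := Functor.injective_obj F T.X₂
    exact (hTS.hasInjectiveDimensionLT_X₃_iff n ‹_›).mp (ih T.X₃)

theorem hasInjectiveDimensionLE_of_dual_equiv {A R : Type u} [CommRing A] [CommRing R]
    [Algebra A R] [Module.Projective A R] (n : ℕ)
    [HasInjectiveDimensionLE (ModuleCat.of A A) n]
    (e : R → (R →ₗ[A] A)) (he : Function.Bijective e) (hadd : ∀ x y, e (x + y) = e x + e y)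
    (hmul : ∀ r x y, e (r * x) y = e x (y * r)) :
    HasInjectiveDimensionLE (ModuleCat.of R R) n := by
  let e₁ : ((ModuleCat.restrictScalars.{u} (algebraMap A R)).obj (ModuleCat.of R R)) ≃ₗ[A] R :=
    { toFun := fun x => x
      invFun := fun x => x
      left_inv := fun _ => rfl
      right_inv := fun _ => rfl
      map_add' := fun _ _ => rfl
      map_smul' := fun a x => (Algebra.smul_def (A := R) a x).symm }
  have : Module.Projective A
      ((ModuleCat.restrictScalars.{u} (algebraMap A R)).obj (ModuleCat.of R R)) :=
    Module.Projective.of_equiv e₁.symm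
  have h := hasInjectiveDimensionLE_coextendScalars (algebraMap A R) n (ModuleCat.of A A)
  let e₂ : R → (ModuleCat.coextendScalars.{u, u, u} (algebraMap A R)).obj (ModuleCat.of A A) :=
    fun r => (ModuleCat.CoextendScalars.equiv (algebraMap A R) _).symm ((e r).comp e₁.toLinearMap)
  let e₃ : R →ₗ[R] (ModuleCat.coextendScalars.{u, u, u} (algebraMap A R)).obj (ModuleCat.of A A) :=
    { toFun := e₂
      map_add' := fun x y => by
        apply ModuleCat.CoextendScalars.ext
        ext r
        exact LinearMap.congr_fun (hadd x y) r
      map_smul' := fun x y => by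
        apply ModuleCat.CoextendScalars.ext
        ext r
        exact hmul x y r }
  have hb : Function.Bijective e₃ := by
    constructor
    · intro x y hxy
      apply he.1
      ext r
      exact congrArg (fun z => ModuleCat.CoextendScalars.equiv (algebraMap A R) _ z r) hxy
    · intro y
      obtain ⟨x, hx⟩ := he.2 ((ModuleCat.CoextendScalars.equiv (algebraMap A R) _ y).comp
        e₁.symm.toLinearMap)
      refine ⟨x, ?_⟩
      apply ModuleCat.CoextendScalars.ext
      ext r
      exact LinearMap.congr_fun hx r
  exact (ModuleCat.hasInjectiveDimensionLE_iff_of_linearEquiv (LinearEquiv.ofBijective e₃ hb) n).2 h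

theorem isGorensteinRing_of_hasInjectiveDimensionLE (R : Type u) [CommRing R] [IsNoetherianRing R]
    (n : ℕ) [HasInjectiveDimensionLE (ModuleCat.of R R) n] : IsGorensteinRing R := by
  refine ⟨inferInstance, fun P _ => ?_⟩
  rw [hasFiniteInjectiveDimension_iff]
  refine ⟨n, ?_⟩
  have h := ModuleCat.localizedModule_hasInjectiveDimensionLE n P.primeCompl (ModuleCat.of R R)
  refine (ModuleCat.hasInjectiveDimensionLE_iff_of_linearEquiv ?_ n).1 h
  have e : LocalizedModule P.primeCompl R ≃ₗ[R] Localization.AtPrime P :=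
    IsLocalizedModule.iso P.primeCompl (Algebra.linearMap R (Localization.AtPrime P))
  exact (Shrink.linearEquiv (Localization.AtPrime P) (LocalizedModule P.primeCompl R)).trans
    (e.extendScalarsOfIsLocalization P.primeCompl (Localization.AtPrime P))

section
attribute [local instance] RingHomInvPair.of_ringEquiv

theorem IsGorensteinRing.of_ringEquiv {R R' : Type u} [CommRing R] [CommRing R'] (e : R ≃+* R')
    (h : IsGorensteinRing R) : IsGorensteinRing R' := by
  have := h.1
  refine ⟨isNoetherianRing_of_ringEquiv R e, fun P _ => ?_⟩
  obtain ⟨n, hn⟩ := (hasFiniteInjectiveDimension_iff _ _).1 (h.2 (P.comap e))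
  rw [hasFiniteInjectiveDimension_iff]
  refine ⟨n, ?_⟩
  let E : Localization.AtPrime (P.comap e) ≃+* Localization.AtPrime P :=
    IsLocalization.ringEquivOfRingEquiv (M := (P.comap e).primeCompl) (T := P.primeCompl)
      _ _ e (by
        ext x
        simp only [Submonoid.mem_map, Ideal.mem_primeCompl_iff, Ideal.mem_comap]
        exact ⟨fun ⟨y, hy, hx⟩ => by rw [← hx]; exact hy,
          fun hx => ⟨e.symm x, by simpa using hx, e.apply_symm_apply x⟩⟩)
  let E' : ModuleCat.of (Localization.AtPrime (P.comap e)) (Localization.AtPrime (P.comap e))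
      ≃ₛₗ[RingHomClass.toRingHom E]
      ModuleCat.of (Localization.AtPrime P) (Localization.AtPrime P) :=
    { toFun := E
      invFun := E.symm
      left_inv := E.left_inv
      right_inv := E.right_inv
      map_add' := map_add E
      map_smul' := fun a b => map_mul E a b }
  exact (ModuleCat.hasInjectiveDimensionLE_iff_of_semiLinearEquiv E E' n).1 hn
end

open TensorProduct in
theorem hasProjectiveDimensionLE_baseChange_polynomial {A : Type u} [CommRing A] (n : ℕ)
    (N : ModuleCat.{u} A) [HasProjectiveDimensionLE N n] :
    HasProjectiveDimensionLE (ModuleCat.of (Polynomial A) (Polynomial A ⊗[A] N)) n := by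
  induction n generalizing N with
  | zero =>
    have h : HasProjectiveDimensionLE N 0 := ‹_›
    simp only [HasProjectiveDimensionLE, zero_add, ← projective_iff_hasProjectiveDimensionLT_one]
      at h ⊢
    rw [← IsProjective.iff_projective] at h ⊢
    infer_instance
  | succ n ih =>
    have ep : EnoughProjectives (ModuleCat.{u} A) := inferInstance
    let i := Projective.π N
    have proj : Projective (Projective.over N) := inferInstance
    let T := ShortComplex.mk (Limits.kernel.ι i) i (Limits.kernel.condition i)
    have hT : T.ShortExact := { exact := ShortComplex.exact_kernel i }
    have hTi : Function.Injective T.f.hom := (ModuleCat.mono_iff_injective _).1 hT.mono_f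
    have hTs : Function.Surjective T.g.hom := (ModuleCat.epi_iff_surjective _).1 hT.epi_g
    have hTe : Function.Exact T.f.hom T.g.hom :=
      (ShortComplex.ShortExact.moduleCat_exact_iff_function_exact _).mp hT.1
    let TS := ModuleCat.shortComplexOfCompEqZero (LinearMap.baseChange (Polynomial A) T.f.hom)
      (LinearMap.baseChange (Polynomial A) T.g.hom) (by
        rw [← LinearMap.baseChange_comp, hTe.linearMap_comp_eq_zero, LinearMap.baseChange_zero])
    have hTS : TS.ShortExact := by
      refine ModuleCat.shortComplex_shortExact TS ?_ ?_ ?_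
      · exact Module.Flat.lTensor_exact (Polynomial A) hTe
      · exact Module.Flat.lTensor_preserves_injective_linearMap (M := Polynomial A) _ hTi
      · exact LinearMap.lTensor_surjective (Polynomial A) hTs
    have h1 := (hT.hasProjectiveDimensionLT_X₃_iff n proj).mp ‹_›
    have h2 : Projective TS.X₂ := by
      have : Module.Projective A T.X₂ := (IsProjective.iff_projective T.X₂).2 proj
      exact (IsProjective.iff_projective (R := Polynomial A) (Polynomial A ⊗[A] T.X₂)).1 inferInstance
    exact (hTS.hasProjectiveDimensionLT_X₃_iff n h2).mpr (ih T.X₁)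

section
open TensorProduct
variable {A : Type u} [CommRing A] (N : Type u) [AddCommGroup N] [Module A N]
  [Module (Polynomial A) N] [IsScalarTower A (Polynomial A) N]

/-- The multiplication map `A[X] ⊗ N → N`. -/
def polynomialTensorEval : Polynomial A ⊗[A] N →ₗ[Polynomial A] N :=
  LinearMap.liftBaseChange (Polynomial A) (LinearMap.id : N →ₗ[A] N)

/-- The endomorphism `X ⊗ 1 - 1 ⊗ X` of `A[X] ⊗ N`. -/
def polynomialTensorDiff : Polynomial A ⊗[A] N →ₗ[Polynomial A] Polynomial A ⊗[A] N :=
  LinearMap.lsmul (Polynomial A) _ (Polynomial.X : Polynomial A) -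
    LinearMap.baseChange (Polynomial A)
      ((LinearMap.lsmul (Polynomial A) N (Polynomial.X : Polynomial A)).restrictScalars A)

theorem polynomialTensorEval_tmul (p : Polynomial A) (n : N) :
    polynomialTensorEval N (p ⊗ₜ n) = p • n := by
  simp [polynomialTensorEval]

theorem polynomialTensorDiff_tmul (p : Polynomial A) (n : N) :
    polynomialTensorDiff N (p ⊗ₜ n) =
      (Polynomial.X * p) ⊗ₜ n - p ⊗ₜ ((Polynomial.X : Polynomial A) • n) := by
  simp [polynomialTensorDiff, smul_tmul']

theorem polynomialTensor_surjective : Function.Surjective (polynomialTensorEval (A := A) N) :=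
  fun n => ⟨1 ⊗ₜ n, by simp [polynomialTensorEval_tmul]⟩

theorem polynomialTensor_comp :
    (polynomialTensorEval (A := A) N).comp (polynomialTensorDiff N) = 0 := by
  ext n
  simp [polynomialTensorEval_tmul, polynomialTensorDiff_tmul]

theorem polynomialTensor_exists_sub (t : Polynomial A ⊗[A] N) :
    ∃ n : N, ∃ q, t = polynomialTensorDiff N q + 1 ⊗ₜ n := by
  induction t with
  | zero => exact ⟨0, 0, by simp⟩
  | add x y hx hy =>
    obtain ⟨n, q, rfl⟩ := hx
    obtain ⟨m, r, rfl⟩ := hy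
    exact ⟨n + m, q + r, by rw [map_add, tmul_add]; abel⟩
  | tmul p n =>
    induction p using Polynomial.induction_on generalizing n with
    | C a => exact ⟨a • n, 0, by
        rw [map_zero, zero_add, tmul_smul, smul_tmul', Polynomial.smul_eq_C_mul, mul_one]⟩
    | add p q hp hq =>
      obtain ⟨n₁, q₁, h₁⟩ := hp n
      obtain ⟨n₂, q₂, h₂⟩ := hq n
      exact ⟨n₁ + n₂, q₁ + q₂, by rw [add_tmul, h₁, h₂, map_add, tmul_add]; abel⟩
    | monomial k a ih =>
      obtain ⟨m, q, h⟩ := ih ((Polynomial.X : Polynomial A) • n)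
      refine ⟨m, q + (Polynomial.C a * Polynomial.X ^ k) ⊗ₜ n, ?_⟩
      rw [map_add, add_right_comm, ← h, polynomialTensorDiff_tmul, pow_succ]
      rw [add_sub_cancel]
      congr 1
      ring

theorem polynomialTensor_exact :
    Function.Exact (polynomialTensorDiff (A := A) N) (polynomialTensorEval N) := by
  intro t
  constructor
  · intro ht
    obtain ⟨n, q, rfl⟩ := polynomialTensor_exists_sub N t
    have := LinearMap.congr_fun (polynomialTensor_comp (A := A) N) q
    simp only [LinearMap.comp_apply, LinearMap.zero_apply] at this
    rw [map_add, this, zero_add, polynomialTensorEval_tmul, one_smul] at ht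
    exact ⟨q, by simp [ht]⟩
  · rintro ⟨q, rfl⟩
    exact LinearMap.congr_fun (polynomialTensor_comp (A := A) N) q

theorem polynomialTensorDiff_injective :
    Function.Injective (polynomialTensorDiff (A := A) N) := by
  let c : ℕ → Polynomial A ⊗[A] N →ₗ[A] N := fun i =>
    (TensorProduct.lid A N).toLinearMap.comp (LinearMap.rTensor N (Polynomial.lcoeff A i))
  have hc (i p) (n : N) : c i (p ⊗ₜ n) = p.coeff i • n := by simp [c]
  have hcd (i t) : c (i + 1) (polynomialTensorDiff N t) =
      c i t - (Polynomial.X : Polynomial A) • c (i + 1) t := by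
    induction t with
    | zero => simp
    | add x y hx hy => simp only [map_add, hx, hy, smul_add]; abel
    | tmul p n =>
      rw [polynomialTensorDiff_tmul, map_sub, hc, hc, hc, hc, Polynomial.coeff_X_mul,
        ← smul_algebra_smul_comm]
  have hc0 (t) : ∃ d, ∀ i, d ≤ i → c i t = 0 := by
    induction t with
    | zero => exact ⟨0, by simp⟩
    | add x y hx hy =>
      obtain ⟨d, hd⟩ := hx
      obtain ⟨e, he⟩ := hy
      exact ⟨max d e, fun i hi => by
        rw [map_add, hd i (le_trans (le_max_left _ _) hi), he i (le_trans (le_max_right _ _) hi),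
          add_zero]⟩
    | tmul p n =>
      exact ⟨p.natDegree + 1, fun i hi => by
        rw [hc, Polynomial.coeff_eq_zero_of_natDegree_lt (by omega), zero_smul]⟩
  have hsum (t) (s : Finset ℕ) (hs : ∀ i ∉ s, c i t = 0) :
      t = ∑ i ∈ s, (Polynomial.X ^ i : Polynomial A) ⊗ₜ c i t := by
    have key : ∀ t, ∃ s₀ : Finset ℕ, ∀ s, s₀ ⊆ s →
        t = ∑ i ∈ s, (Polynomial.X ^ i : Polynomial A) ⊗ₜ c i t := by
      intro t
      induction t with
      | zero => exact ⟨∅, by simp⟩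
      | add x y hx hy =>
        obtain ⟨d, hd⟩ := hx
        obtain ⟨e, he⟩ := hy
        refine ⟨d ∪ e, fun s hs => ?_⟩
        conv_lhs => rw [hd s (Finset.union_subset_left hs), he s (Finset.union_subset_right hs)]
        simp [tmul_add, Finset.sum_add_distrib]
      | tmul p n =>
        refine ⟨p.support, fun s hs => ?_⟩
        simp only [hc]
        conv_lhs => rw [p.as_sum_support_C_mul_X_pow, sum_tmul]
        rw [Finset.sum_subset hs]
        · refine Finset.sum_congr rfl fun i _ => ?_
          rw [tmul_smul, smul_tmul', Polynomial.smul_eq_C_mul]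
        · intro i _ hi
          rw [Polynomial.notMem_support_iff.1 hi]
          simp
    obtain ⟨s₀, h⟩ := key t
    conv_lhs => rw [h (s₀ ∪ s) Finset.subset_union_left]
    symm
    refine Finset.sum_subset Finset.subset_union_right fun i _ hi => ?_
    rw [hs i hi, tmul_zero]
  rw [injective_iff_map_eq_zero]
  intro t ht
  obtain ⟨d, hd⟩ := hc0 t
  have hz : ∀ k i, d ≤ i + k → c i t = 0 := by
    intro k
    induction k with
    | zero => exact fun i hi => hd i hi
    | succ k ih =>
      intro i hi
      have h1 := hcd i t
      rw [ht, map_zero, ih (i + 1) (by omega), smul_zero, sub_zero] at h1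
      exact h1.symm
  rw [hsum t ∅ fun i _ => hz d i (by omega)]
  simp

end

theorem hasProjectiveDimensionLE_polynomial {A : Type u} [CommRing A] (n : ℕ)
    (h : ∀ N : ModuleCat.{u} A, HasProjectiveDimensionLE N n)
    (N : ModuleCat.{u} (Polynomial A)) : HasProjectiveDimensionLE N (n + 1) := by
  let _ : Module A N := Module.compHom N (Polynomial.C : A →+* Polynomial A)
  have : IsScalarTower A (Polynomial A) N := ⟨fun a p x => by
    rw [Polynomial.smul_eq_C_mul, mul_smul]; rfl⟩
  have h1 := h (ModuleCat.of A N)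
  have h2 := hasProjectiveDimensionLE_baseChange_polynomial n (ModuleCat.of A N)
  let S := ModuleCat.shortComplexOfCompEqZero _ _ (polynomialTensor_comp (A := A) N)
  have hS : S.ShortExact := ModuleCat.shortComplex_shortExact S (polynomialTensor_exact N)
    (polynomialTensorDiff_injective N) (polynomialTensor_surjective N)
  have h3 : HasProjectiveDimensionLE S.X₃ (n + 1) := by
    have h2' : HasProjectiveDimensionLT S.X₁ (n + 1) := h2
    have h2'' : HasProjectiveDimensionLT S.X₂ (n + 1) := h2
    exact hS.hasProjectiveDimensionLT_X₃ (n + 1) h2'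
      (hasProjectiveDimensionLT_of_ge _ (n + 1) (n + 1 + 1) (by omega))
  exact h3

theorem hasInjectiveDimensionLE_of_forall_hasProjectiveDimensionLE {A : Type u} [CommRing A]
    (n : ℕ) (h : ∀ N : ModuleCat.{u} A, HasProjectiveDimensionLE N n) (M : ModuleCat.{u} A) :
    HasInjectiveDimensionLE M n := by
  apply hasInjectiveDimensionLT_of_enoughProjectives M (n + 1)
  intro N
  exact HasProjectiveDimensionLT.subsingleton N (n + 1) (n + 1) le_rfl M

theorem hasInjectiveDimensionLE_polynomial₃ (F : Type u) [Field F] :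
    HasInjectiveDimensionLE (ModuleCat.of (Polynomial (Polynomial (Polynomial F)))
      (Polynomial (Polynomial (Polynomial F)))) 3 := by
  refine hasInjectiveDimensionLE_of_forall_hasProjectiveDimensionLE
    (A := Polynomial (Polynomial (Polynomial F))) 3 ?_ (ModuleCat.of _ _)
  refine hasProjectiveDimensionLE_polynomial 2 ?_
  refine hasProjectiveDimensionLE_polynomial 1 ?_
  refine hasProjectiveDimensionLE_polynomial 0 fun N => ?_
  simp only [HasProjectiveDimensionLE, zero_add, ← projective_iff_hasProjectiveDimensionLT_one]
  rw [← IsProjective.iff_projective]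
  exact Module.Projective.of_basis (Module.Basis.ofVectorSpace F N)

section
variable {R : Type u} [CommRing R]

theorem subsingleton_ext_of_shortExact {S : ShortComplex (ModuleCat.{u} R)} (hS : S.ShortExact)
    (Y : ModuleCat.{u} R) (n : ℕ) (h₁ : Subsingleton (Abelian.Ext S.X₁ Y n))
    (h₃ : Subsingleton (Abelian.Ext S.X₃ Y n)) : Subsingleton (Abelian.Ext S.X₂ Y n) := by
  refine subsingleton_of_forall_eq 0 fun α => ?_
  obtain ⟨β, rfl⟩ := Abelian.Ext.contravariant_sequence_exact₂ hS Y α (Subsingleton.elim _ _)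
  rw [Subsingleton.elim β 0, Abelian.Ext.comp_zero]

theorem subsingleton_ext_of_shortExact' {S : ShortComplex (ModuleCat.{u} R)} (hS : S.ShortExact)
    (Y : ModuleCat.{u} R) (n : ℕ) (h₂ : Subsingleton (Abelian.Ext S.X₂ Y n))
    (h₃ : Subsingleton (Abelian.Ext S.X₃ Y (n + 1))) : Subsingleton (Abelian.Ext S.X₁ Y n) := by
  refine subsingleton_of_forall_eq 0 fun α => ?_
  obtain ⟨β, rfl⟩ := Abelian.Ext.contravariant_sequence_exact₁ hS Y α (add_comm 1 n)
    (Subsingleton.elim _ _)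
  rw [Subsingleton.elim β 0, Abelian.Ext.comp_zero]

theorem exists_comp_extClass {S : ShortComplex (ModuleCat.{u} R)} (hS : S.ShortExact)
    (x : R) (hx : ∃ e : S.X₁ ≅ S.X₂, S.f = x • e.hom) (N : ModuleCat.{u} R)
    (hN : ∀ n : N, x • n = 0) (i : ℕ) (β : Abelian.Ext N S.X₁ (i + 1)) :
    ∃ γ : Abelian.Ext N S.X₃ i, γ.comp hS.extClass rfl = β := by
  obtain ⟨e, hx⟩ := hx
  refine Abelian.Ext.covariant_sequence_exact₁ N hS β ?_ rfl
  have hN' : x • 𝟙 N = 0 := by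
    ext n
    exact hN n
  have hz : ∀ β : Abelian.Ext N S.X₂ (i + 1), x • β = 0 := fun β => by
    have h : x • β = (Abelian.Ext.mk₀ (x • 𝟙 N)).comp β (zero_add _) := by
      simp [Abelian.Ext.mk₀_smul]
    rw [h, hN']
    simp
  rw [hx, Abelian.Ext.mk₀_smul, Abelian.Ext.comp_smul, hz]

theorem comp_extClass_injective {S : ShortComplex (ModuleCat.{u} R)} (hS : S.ShortExact)
    (N : ModuleCat.{u} R) (i : ℕ) (h : Subsingleton (Abelian.Ext N S.X₂ i))
    {γ γ' : Abelian.Ext N S.X₃ i} (hγ : γ.comp hS.extClass rfl = γ'.comp hS.extClass rfl) :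
    γ = γ' := by
  have hz : (γ + -γ').comp hS.extClass rfl = 0 := by
    rw [Abelian.Ext.add_comp, Abelian.Ext.neg_comp, hγ, add_neg_cancel]
  obtain ⟨α, hα⟩ := Abelian.Ext.covariant_sequence_exact₃ N hS _ rfl hz
  rw [Subsingleton.elim α 0, Abelian.Ext.zero_comp] at hα
  exact add_neg_eq_zero.1 hα.symm

theorem subsingleton_hom_of_mono_smul {M N : ModuleCat.{u} R} (f : M ⟶ M) [Mono f] (x : R)
    (hf : f = x • 𝟙 M) (hN : ∀ n : N, x • n = 0) : Subsingleton (Abelian.Ext N M 0) := by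
  refine subsingleton_of_forall_eq 0 fun α => ?_
  obtain ⟨g, rfl⟩ := Abelian.Ext.homEquiv₀.symm.surjective α
  have : g ≫ f = 0 := by
    rw [hf]
    ext n
    change x • g.hom n = 0
    rw [← map_smul, hN, map_zero]
  have h0 : g = 0 := by
    rw [← cancel_mono f, this, Limits.zero_comp]
  rw [h0, Abelian.Ext.homEquiv₀_symm_apply, Abelian.Ext.mk₀_zero]

/-- The complex `R/(I : x) → R/I → R/(I + (x))`. -/
def quotShortComplex (I I' : Ideal R) (x : R) (h : ∀ a, a ∈ I' ↔ x * a ∈ I) :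
    ShortComplex (ModuleCat.{u} R) :=
  ModuleCat.shortComplexOfCompEqZero
    (Submodule.mapQ I' I (LinearMap.lsmul R R x) fun a ha => (h a).1 ha)
    (Submodule.mapQ I (I ⊔ Ideal.span {x}) LinearMap.id fun _ ha => Ideal.mem_sup_left ha)
    (by
      ext
      exact (Submodule.Quotient.mk_eq_zero _).2 <| Ideal.mem_sup_right (Ideal.mul_mem_right _ _ (Ideal.mem_span_singleton_self x)))

theorem quotShortComplex_shortExact (I I' : Ideal R) (x : R) (h : ∀ a, a ∈ I' ↔ x * a ∈ I) :
    (quotShortComplex I I' x h).ShortExact := by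
  refine ModuleCat.shortComplex_shortExact _ ?_ ?_ ?_
  · intro y
    obtain ⟨a, rfl⟩ := Submodule.Quotient.mk_surjective _ y
    constructor
    · intro ha
      have ha' : a ∈ I ⊔ Ideal.span {x} := (Submodule.Quotient.mk_eq_zero _).1 ha
      obtain ⟨b, hb, c, hc, rfl⟩ := Submodule.mem_sup.1 ha'
      obtain ⟨d, rfl⟩ := Ideal.mem_span_singleton'.1 hc
      refine ⟨Submodule.Quotient.mk d, ?_⟩
      refine (Submodule.Quotient.eq I).2 ?_
      have : x * d - (b + d * x) = -b := by ring
      simpa [this] using hb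
    · rintro ⟨z, hz⟩
      obtain ⟨d, rfl⟩ := Submodule.Quotient.mk_surjective _ z
      have hz' : x * d - a ∈ I := (Submodule.Quotient.eq I).1 hz
      refine (Submodule.Quotient.mk_eq_zero _).2 ?_
      have : a = -(x * d - a) + d * x := by ring
      change a ∈ _
      rw [this]
      exact add_mem (Ideal.mem_sup_left (neg_mem hz'))
        (Ideal.mem_sup_right (Ideal.mul_mem_left _ _ (Ideal.mem_span_singleton_self x)))
  · intro y z hyz
    obtain ⟨a, rfl⟩ := Submodule.Quotient.mk_surjective _ y
    obtain ⟨b, rfl⟩ := Submodule.Quotient.mk_surjective _ z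
    refine (Submodule.Quotient.eq I').2 ((h _).2 ?_)
    rw [mul_sub]
    exact (Submodule.Quotient.eq I).1 hyz
  · intro y
    obtain ⟨a, rfl⟩ := Submodule.Quotient.mk_surjective _ y
    exact ⟨Submodule.Quotient.mk a, rfl⟩

/-- An element is regular modulo an ideal. -/
def IsRegularMod (I : Ideal R) (x : R) : Prop := ∀ a, a ∈ I ↔ x * a ∈ I

theorem quotShortComplex_f (I : Ideal R) (x : R) (h : IsRegularMod I x) :
    (quotShortComplex I I x h).f = x • 𝟙 (ModuleCat.of R (R ⧸ I)) := by
  ext y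
  rfl

theorem subsingleton_ext_quot_succ (I : Ideal R) (x : R) (h : IsRegularMod I x) (j : ℕ)
    (N : ModuleCat.{u} R) (hN : ∀ n : N, x • n = 0)
    (hj : ∀ i < j, Subsingleton (Abelian.Ext N (ModuleCat.of R (R ⧸ (I ⊔ Ideal.span {x}))) i)) :
    ∀ i < j + 1, Subsingleton (Abelian.Ext N (ModuleCat.of R (R ⧸ I)) i) := by
  have hS := quotShortComplex_shortExact I I x h
  intro i hi
  rcases i with _ | i
  · exact @subsingleton_hom_of_mono_smul R _ (ModuleCat.of R (R ⧸ I)) N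
      (quotShortComplex I I x h).f hS.mono_f x (quotShortComplex_f I x h) hN
  · refine subsingleton_of_forall_eq 0 fun β => ?_
    obtain ⟨γ, rfl⟩ := exists_comp_extClass hS x ⟨Iso.refl _, quotShortComplex_f I x h⟩ N hN i β
    have : Subsingleton (Abelian.Ext N (quotShortComplex I I x h).X₃ i) := hj i (by omega)
    rw [Subsingleton.elim γ 0, Abelian.Ext.zero_comp]
    rfl
end

section
variable {R : Type u} [CommRing R]

theorem mem_maximal_iff_of_socle {𝔪 J : Ideal R} [𝔪.IsMaximal] {s : R} (hs : s ∉ J)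
    (h : ∀ a ∈ 𝔪, s * a ∈ J) (a : R) : a ∈ 𝔪 ↔ s * a ∈ J := by
  refine ⟨h a, fun ha => by_contra fun hm => hs ?_⟩
  obtain ⟨b, hb⟩ := Ideal.IsMaximal.exists_inv ‹𝔪.IsMaximal› hm
  obtain ⟨i, hi, hb⟩ := hb
  have : s = b * (s * a) + s * i := by linear_combination -s * hb
  rw [this]
  exact add_mem (Ideal.mul_mem_left _ _ ha) (h i hi)

theorem exists_socle_of_pow_le {𝔪 J : Ideal R} (K : ℕ) (hK : 𝔪 ^ K ≤ J) (hJ : J ≠ ⊤) :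
    ∃ s ∉ J, ∀ a ∈ 𝔪, s * a ∈ J := by
  classical
  have hex : ∃ k, 𝔪 ^ k ≤ J := ⟨K, hK⟩
  obtain ⟨k, hk⟩ : ∃ k, Nat.find hex = k + 1 := by
    refine Nat.exists_eq_succ_of_ne_zero fun h0 => hJ ?_
    have := Nat.find_spec hex
    rw [h0, pow_zero, Ideal.one_eq_top] at this
    exact top_le_iff.1 this
  have hlt : ¬ 𝔪 ^ k ≤ J := Nat.find_min hex (by omega)
  obtain ⟨s, hs, hsJ⟩ := SetLike.not_le_iff_exists.1 hlt
  refine ⟨s, hsJ, fun a ha => ?_⟩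
  have := Nat.find_spec hex
  rw [hk, pow_succ] at this
  exact this (Ideal.mul_mem_mul hs ha)

theorem subsingleton_ext_of_forall_quot [IsNoetherianRing R] (𝔪 : Ideal R) [𝔪.IsMaximal]
    (Y : ModuleCat.{u} R) (i : ℕ) (hi : 0 < i)
    (h𝔪 : Subsingleton (Abelian.Ext (ModuleCat.of R (R ⧸ 𝔪)) Y i)) (K : ℕ) (J : Ideal R)
    (hJ : 𝔪 ^ K ≤ J) : Subsingleton (Abelian.Ext (ModuleCat.of R (R ⧸ J)) Y i) := by
  induction J using WellFoundedGT.induction with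
  | ind J ih =>
    by_cases hT : J = ⊤
    · subst hT
      have : Subsingleton (R ⧸ (⊤ : Ideal R)) := Ideal.Quotient.subsingleton_iff.2 rfl
      have : Projective (ModuleCat.of R (R ⧸ (⊤ : Ideal R))) :=
        (IsProjective.iff_projective (R ⧸ (⊤ : Ideal R))).1 inferInstance
      exact HasProjectiveDimensionLT.subsingleton _ 1 i hi Y
    · obtain ⟨s, hs, hsa⟩ := exists_socle_of_pow_le K hJ hT
      refine subsingleton_ext_of_shortExact (quotShortComplex_shortExact J 𝔪 s
        (mem_maximal_iff_of_socle hs hsa)) Y i h𝔪 (ih _ ?_ ?_)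
      · refine lt_of_le_of_ne le_sup_left fun h => hs ?_
        rw [h]
        exact Ideal.mem_sup_right (Ideal.mem_span_singleton_self s)
      · exact hJ.trans le_sup_left

theorem subsingleton_ext_of_regular [IsNoetherianRing R] (𝔪 : Ideal R) [𝔪.IsMaximal]
    (Y : ModuleCat.{u} R) (n d : ℕ) [HasInjectiveDimensionLE Y n] (I : Ideal R)
    [HasProjectiveDimensionLE (ModuleCat.of R (R ⧸ I)) d]
    (K : ℕ) (hK : 𝔪 ^ K ≤ I) (hI : I ≠ ⊤) :
    ∀ i > d, ∀ J : Ideal R, I ≤ J →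
      Subsingleton (Abelian.Ext (ModuleCat.of R (R ⧸ J)) Y i) := by
  obtain ⟨s, hs, hsa⟩ := exists_socle_of_pow_le K hK hI
  suffices ∀ k i, d < i → n < i + k → ∀ J : Ideal R, I ≤ J →
      Subsingleton (Abelian.Ext (ModuleCat.of R (R ⧸ J)) Y i) from
    fun i hi => this (n + 1) i hi (by omega)
  intro k
  induction k with
  | zero => exact fun i _ hi J _ => HasInjectiveDimensionLT.subsingleton Y (n + 1) i (by omega) _
  | succ k ih =>
    intro i hi hik J hJ
    refine subsingleton_ext_of_forall_quot 𝔪 Y i (by omega) ?_ K J (hK.trans hJ)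
    refine subsingleton_ext_of_shortExact' (quotShortComplex_shortExact I 𝔪 s
      (mem_maximal_iff_of_socle hs hsa)) Y i ?_ ?_
    · exact HasProjectiveDimensionLT.subsingleton (ModuleCat.of R (R ⧸ I)) (d + 1) i (by omega) Y
    · exact ih (i + 1) (by omega) (by omega) _ le_sup_left

theorem hasProjectiveDimensionLE_quot_succ (I : Ideal R) (x : R) (h : IsRegularMod I x) (d : ℕ)
    [hd : HasProjectiveDimensionLE (ModuleCat.of R (R ⧸ I)) d] :
    HasProjectiveDimensionLE (ModuleCat.of R (R ⧸ (I ⊔ Ideal.span {x}))) (d + 1) :=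
  (quotShortComplex_shortExact I I x h).hasProjectiveDimensionLT_X₃ (d + 1) hd
    (hasProjectiveDimensionLT_of_ge (ModuleCat.of R (R ⧸ I)) (d + 1) _ (by omega))

theorem comp_comp_comp_comp {M₀ M₁ M₂ M₃ M₄ M₅ : ModuleCat.{u} R} (a : Abelian.Ext M₀ M₁ 0)
    (b : Abelian.Ext M₁ M₂ 0) (c : Abelian.Ext M₂ M₃ 1) (d : Abelian.Ext M₃ M₄ 1)
    (e : Abelian.Ext M₄ M₅ 1) :
    (((a.comp b (zero_add 0)).comp c rfl).comp d rfl).comp e rfl =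
      a.comp (((b.comp c (zero_add 1)).comp d rfl).comp e rfl) (zero_add 3) := by
  rw [Abelian.Ext.comp_assoc a b c (zero_add 0) (zero_add 1) (by omega),
    Abelian.Ext.comp_assoc a (b.comp c (zero_add 1)) d (zero_add 1) rfl (by omega),
    Abelian.Ext.comp_assoc a ((b.comp c (zero_add 1)).comp d rfl) e (zero_add 2) rfl (by omega)]

theorem exists_sub_mul_mem_of_socle [IsNoetherianRing R] (𝔪 : Ideal R) [𝔪.IsMaximal] (n : ℕ)
    [HasInjectiveDimensionLE (ModuleCat.of R R) n] {I₀ I₁ I₂ I₃ : Ideal R} {x₁ x₂ x₃ : R}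
    (hI₀ : I₀ = ⊥)
    (hI₁ : I₁ = I₀ ⊔ Ideal.span {x₁}) (hI₂ : I₂ = I₁ ⊔ Ideal.span {x₂})
    (hI₃ : I₃ = I₂ ⊔ Ideal.span {x₃}) (h₁ : IsRegularMod I₀ x₁) (h₂ : IsRegularMod I₁ x₂)
    (h₃ : IsRegularMod I₂ x₃) (K : ℕ) (hK : 𝔪 ^ K ≤ I₃) (s t : R) (hs : s ∉ I₃)
    (hsa : ∀ a ∈ 𝔪, s * a ∈ I₃) (hta : ∀ a ∈ 𝔪, t * a ∈ I₃) : ∃ r, t - r * s ∈ I₃ := by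
  have e₀ : (R ⧸ I₀) ≃ₗ[R] R := hI₀ ▸ Submodule.quotEquivOfEqBot ⊥ rfl
  have hinj : HasInjectiveDimensionLE (ModuleCat.of R (R ⧸ I₀)) n :=
    (ModuleCat.hasInjectiveDimensionLE_iff_of_linearEquiv (M := ModuleCat.of R (R ⧸ I₀))
      (N := ModuleCat.of R R) e₀ n).2 inferInstance
  have : Module.Projective R (R ⧸ I₀) := Module.Projective.of_equiv e₀.symm
  have : Projective (ModuleCat.of R (R ⧸ I₀)) := (IsProjective.iff_projective (R ⧸ I₀)).1 this
  have p₀ : HasProjectiveDimensionLE (ModuleCat.of R (R ⧸ I₀)) 0 := inferInstance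
  have p₁ : HasProjectiveDimensionLE (ModuleCat.of R (R ⧸ I₁)) 1 :=
    hI₁ ▸ hasProjectiveDimensionLE_quot_succ I₀ x₁ h₁ 0
  have p₂ : HasProjectiveDimensionLE (ModuleCat.of R (R ⧸ I₂)) 2 :=
    hI₂ ▸ hasProjectiveDimensionLE_quot_succ I₁ x₂ h₂ 1
  have p₃ : HasProjectiveDimensionLE (ModuleCat.of R (R ⧸ I₃)) 3 :=
    hI₃ ▸ hasProjectiveDimensionLE_quot_succ I₂ x₃ h₃ 2
  have hne : I₃ ≠ ⊤ := fun h => hs (h ▸ Submodule.mem_top)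
  have hv := subsingleton_ext_of_regular 𝔪 (ModuleCat.of R (R ⧸ I₀)) n 3 I₃ K hK hne 4 (by omega)
    (I₃ ⊔ Ideal.span {s}) le_sup_left
  have hle : I₁ ≤ I₃ := by rw [hI₃, hI₂]; exact le_sup_left.trans le_sup_left
  have hm₁ : x₁ ∈ I₃ := hle (hI₁ ▸ Ideal.mem_sup_right (Ideal.mem_span_singleton_self x₁))
  have hm₂ : x₂ ∈ I₃ := by
    rw [hI₃, hI₂]
    exact Ideal.mem_sup_left (Ideal.mem_sup_right (Ideal.mem_span_singleton_self x₂))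
  have hm₃ : x₃ ∈ I₃ := hI₃ ▸ Ideal.mem_sup_right (Ideal.mem_span_singleton_self x₃)
  have kill : ∀ J : Ideal R, ∀ x ∈ J, ∀ y : ModuleCat.of R (R ⧸ J), x • y = 0 := by
    intro J x hx y
    obtain ⟨a, rfl⟩ := Submodule.Quotient.mk_surjective _ y
    exact (Submodule.Quotient.mk_eq_zero _).2 (Ideal.mul_mem_right a J hx)
  have h𝔪 := mem_maximal_iff_of_socle hs hsa
  have hle𝔪 : I₃ ≤ 𝔪 := fun a ha => (h𝔪 a).2 (Ideal.mul_mem_left _ _ ha)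
  have hS := quotShortComplex_shortExact I₃ 𝔪 s h𝔪
  subst hI₃ hI₂ hI₁
  have hS₁ := quotShortComplex_shortExact I₀ I₀ x₁ h₁
  have hS₂ := quotShortComplex_shortExact _ _ x₂ h₂
  have hS₃ := quotShortComplex_shortExact _ _ x₃ h₃
  set N := ModuleCat.of R (R ⧸ 𝔪) with hN
  set L := ModuleCat.of R (R ⧸ (I₀ ⊔ Ideal.span {x₁} ⊔ Ideal.span {x₂} ⊔ Ideal.span {x₃})) with hL
  let φ : N ⟶ L := ModuleCat.ofHom (Submodule.mapQ 𝔪 _ (LinearMap.lsmul R R t) fun a ha => hta a ha)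
  have v₂ := subsingleton_ext_quot_succ _ x₃ h₃ 0 N (kill _ _ (hle𝔪 hm₃)) (by omega)
  have v₁ := subsingleton_ext_quot_succ _ x₂ h₂ 1 N (kill _ _ (hle𝔪 hm₂)) v₂
  have v₀ := subsingleton_ext_quot_succ _ x₁ h₁ 2 N (kill _ _ (hle𝔪 hm₁)) v₁
  let α : Abelian.Ext N L 0 := Abelian.Ext.mk₀ φ
  let β : Abelian.Ext N (ModuleCat.of R (R ⧸ I₀)) 3 :=
    ((α.comp hS₃.extClass rfl).comp hS₂.extClass rfl).comp hS₁.extClass rfl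
  let f : N ⟶ L := (quotShortComplex _ 𝔪 s h𝔪).f
  obtain ⟨β', hβ'⟩ : ∃ β' : Abelian.Ext L (ModuleCat.of R (R ⧸ I₀)) 3,
      (Abelian.Ext.mk₀ f).comp β' (zero_add 3) = β :=
    Abelian.Ext.contravariant_sequence_exact₁ hS _ β rfl (hv.elim _ _)
  obtain ⟨β'', rfl⟩ := exists_comp_extClass hS₁ x₁ ⟨Iso.refl _, quotShortComplex_f _ _ h₁⟩ L
    (kill _ _ hm₁) 2 β'
  obtain ⟨β''', rfl⟩ := exists_comp_extClass hS₂ x₂ ⟨Iso.refl _, quotShortComplex_f _ _ h₂⟩ L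
    (kill _ _ hm₂) 1 β''
  obtain ⟨γ, rfl⟩ := exists_comp_extClass hS₃ x₃ ⟨Iso.refl _, quotShortComplex_f _ _ h₃⟩ L
    (kill _ _ hm₃) 0 β'''
  obtain ⟨ψ, rfl⟩ : ∃ ψ : L ⟶ L, Abelian.Ext.mk₀ ψ = γ :=
    Abelian.Ext.homEquiv₀.symm.surjective γ
  have hz : Abelian.Ext.mk₀ (f ≫ ψ) = α := by
    refine comp_extClass_injective hS₃ N 0 (v₂ 0 (by omega)) ?_
    refine comp_extClass_injective hS₂ N 1 (v₁ 1 (by omega)) ?_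
    refine comp_extClass_injective hS₁ N 2 (v₀ 2 (by omega)) ?_
    refine Eq.trans ?_ hβ'
    rw [← Abelian.Ext.mk₀_comp_mk₀]
    exact comp_comp_comp_comp _ _ _ _ _
  have hψ : f ≫ ψ = φ :=
    Abelian.Ext.homEquiv₀.symm.injective hz
  obtain ⟨r, hr⟩ := Submodule.Quotient.mk_surjective _ (ψ.hom (Submodule.Quotient.mk 1))
  refine ⟨r, (Submodule.Quotient.eq _).1 ?_⟩
  have h1 : ψ.hom (Submodule.Quotient.mk (s * 1)) = Submodule.Quotient.mk (t * 1) :=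
    congrArg (fun g : N ⟶ L => g.hom (Submodule.Quotient.mk 1)) hψ
  have h2 : ψ.hom (Submodule.Quotient.mk (s * 1)) = s • ψ.hom (Submodule.Quotient.mk 1) := by
    rw [← map_smul]
    rfl
  rw [mul_one t] at h1
  rw [← h1, h2, ← hr, mul_comm]
  rfl
end

section
variable {R : Type u} [CommRing R]

theorem IsRegularMod.map_localization (M : Submonoid R) (S : Type u) [CommRing S] [Algebra R S]
    [IsLocalization M S] {I : Ideal R} {x : R} (h : IsRegularMod I x) :
    IsRegularMod (I.map (algebraMap R S)) (algebraMap R S x) := by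
  intro a
  refine ⟨fun ha => Ideal.mul_mem_left _ _ ha, fun ha => ?_⟩
  obtain ⟨b, u, rfl⟩ := IsLocalization.exists_mk'_eq M a
  rw [IsLocalization.mul_mk'_eq_mk'_of_mul] at ha
  rw [IsLocalization.mk'_mem_map_algebraMap_iff] at ha ⊢
  obtain ⟨v, hv, hb⟩ := ha
  exact ⟨v, hv, (h _).2 (by rwa [mul_left_comm])⟩

theorem exists_sub_mul_mem_of_isGorensteinRing (hR : IsGorensteinRing R) (𝔪 : Ideal R)
    [𝔪.IsMaximal] {I₁ I₂ I₃ : Ideal R} {x₁ x₂ x₃ : R}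
    (hI₁ : I₁ = ⊥ ⊔ Ideal.span {x₁}) (hI₂ : I₂ = I₁ ⊔ Ideal.span {x₂})
    (hI₃ : I₃ = I₂ ⊔ Ideal.span {x₃}) (h₁ : IsRegularMod ⊥ x₁) (h₂ : IsRegularMod I₁ x₂)
    (h₃ : IsRegularMod I₂ x₃) (K : ℕ) (hK : 𝔪 ^ K ≤ I₃) (s t : R) (hs : s ∉ I₃)
    (hsa : ∀ a ∈ 𝔪, s * a ∈ I₃) (hta : ∀ a ∈ 𝔪, t * a ∈ I₃) : ∃ r, t - r * s ∈ I₃ := by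
  obtain ⟨hN, hG⟩ := hR
  obtain ⟨n, hn⟩ := (hasFiniteInjectiveDimension_iff _ _).1 (hG 𝔪)
  set S := Localization.AtPrime 𝔪
  have : IsNoetherianRing S := IsLocalization.isNoetherianRing 𝔪.primeCompl S hN
  set f := algebraMap R S
  have hmul : ∀ s, (∀ a ∈ 𝔪, s * a ∈ I₃) →
      ∀ a ∈ IsLocalRing.maximalIdeal S, f s * a ∈ I₃.map f := by
    intro s hs a ha
    rw [← Localization.AtPrime.map_eq_maximalIdeal] at ha
    have hle : Ideal.map f 𝔪 ≤ Submodule.comap (LinearMap.mulLeft S (f s)) (I₃.map f) := by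
      refine Ideal.map_le_iff_le_comap.2 fun b hb => ?_
      change f s * f b ∈ I₃.map f
      rw [← map_mul]
      exact Ideal.mem_map_of_mem f (hs b hb)
    exact hle ha
  have key : ∃ r, f t - r * f s ∈ I₃.map f := by
    refine exists_sub_mul_mem_of_socle (IsLocalRing.maximalIdeal S) n (I₀ := Ideal.map f ⊥)
      (I₁ := I₁.map f) (I₂ := I₂.map f) (x₁ := f x₁) (x₂ := f x₂) (x₃ := f x₃) Ideal.map_bot
      ?_ ?_ ?_ (h₁.map_localization 𝔪.primeCompl S) (h₂.map_localization 𝔪.primeCompl S)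
      (h₃.map_localization 𝔪.primeCompl S) K ?_ _ _ ?_ ?_ ?_
    · rw [hI₁, Ideal.map_sup, Ideal.map_span, Set.image_singleton]
    · rw [hI₂, Ideal.map_sup, Ideal.map_span, Set.image_singleton]
    · rw [hI₃, Ideal.map_sup, Ideal.map_span, Set.image_singleton]
    · rw [← Localization.AtPrime.map_eq_maximalIdeal, ← Ideal.map_pow]
      exact Ideal.map_mono hK
    · rw [IsLocalization.algebraMap_mem_map_algebraMap_iff 𝔪.primeCompl S]
      rintro ⟨v, hv, hvs⟩
      exact hv ((mem_maximal_iff_of_socle hs hsa v).2 (by rwa [mul_comm]))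
    · exact hmul s hsa
    · exact hmul t hta
  obtain ⟨r, hr⟩ := key
  obtain ⟨b, u, rfl⟩ := IsLocalization.exists_mk'_eq 𝔪.primeCompl r
  have h1 : f (u * t - b * s) ∈ I₃.map f := by
    have : f (u * t - b * s) = f u * (f t - IsLocalization.mk' S b u * f s) := by
      rw [map_sub, map_mul, map_mul, mul_sub, ← mul_assoc (f u), IsLocalization.mk'_spec']
    rw [this]
    exact Ideal.mul_mem_left _ _ hr
  rw [IsLocalization.algebraMap_mem_map_algebraMap_iff 𝔪.primeCompl S] at h1
  obtain ⟨v, hv, h1⟩ := h1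
  obtain ⟨w, i, hi, hw⟩ := Ideal.IsMaximal.exists_inv ‹𝔪.IsMaximal› (𝔪.primeCompl.mul_mem hv u.2)
  refine ⟨w * v * b, ?_⟩
  have : t - w * v * b * s = w * (v * (u * t - b * s)) + t * i := by
    linear_combination -t * hw
  rw [this]
  exact add_mem (Ideal.mul_mem_left _ _ h1) (hta i hi)
end

section
variable {B : Type u} [CommRing B] [IsDomain B] [DecompositionMonoid B]

theorem IsRelPrime.exists_of_mul_eq_mul {x y a b : B} (hxy : IsRelPrime x y) (hx : x ≠ 0)
    (h : x * a = y * b) : ∃ t, a = y * t ∧ b = x * t := by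
  obtain ⟨t, rfl⟩ := hxy.dvd_of_dvd_mul_left (Dvd.intro _ h)
  exact ⟨t, mul_left_cancel₀ hx (by rw [h]; ring), rfl⟩

theorem exists_eq_det_of_mul_mem {x y f g m₁₁ m₁₂ m₂₁ m₂₂ u α β γ δ : B}
    (hxy : IsRelPrime x y) (hx : x ≠ 0) (hfg : IsRelPrime f g) (hf₀ : f ≠ 0)
    (hf : f = m₁₁ * x + m₁₂ * y) (hg : g = m₂₁ * x + m₂₂ * y)
    (hux : u * x = α * f + β * g) (huy : u * y = γ * f + δ * g) :
    ∃ t p q, u = t * (m₁₁ * m₂₂ - m₁₂ * m₂₁) + p * f + q * g := by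
  obtain ⟨t, h₁, h₂⟩ := hfg.exists_of_mul_eq_mul hf₀
    (show f * (y * α - x * γ) = g * (x * δ - y * β) by linear_combination x * huy - y * hux)
  obtain ⟨p, h₃, h₄⟩ := hxy.exists_of_mul_eq_mul hx
    (show x * (γ + t * m₂₁) = y * (α - t * m₂₂) by rw [hg] at h₁; linear_combination -h₁)
  obtain ⟨q, h₅, h₆⟩ := hxy.exists_of_mul_eq_mul hx
    (show x * (δ - t * m₁₁) = y * (β + t * m₁₂) by rw [hf] at h₂; linear_combination h₂)
  refine ⟨t, p, q, mul_right_cancel₀ hx ?_⟩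
  linear_combination hux + f * h₄ + g * h₆ + t * m₂₂ * hf - t * m₁₂ * hg

theorem exists_det_eq_of_eq {x y f g m₁₁ m₁₂ m₂₁ m₂₂ n₁₁ n₁₂ n₂₁ n₂₂ : B}
    (hxy : IsRelPrime x y) (hx : x ≠ 0)
    (hf : f = m₁₁ * x + m₁₂ * y) (hg : g = m₂₁ * x + m₂₂ * y)
    (hf' : f = n₁₁ * x + n₁₂ * y) (hg' : g = n₂₁ * x + n₂₂ * y) :
    ∃ p q, n₁₁ * n₂₂ - n₁₂ * n₂₁ = m₁₁ * m₂₂ - m₁₂ * m₂₁ + p * f + q * g := by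
  obtain ⟨t, h₁, h₂⟩ := hxy.exists_of_mul_eq_mul hx
    (show x * (m₁₁ - n₁₁) = y * (n₁₂ - m₁₂) by linear_combination hf' - hf)
  obtain ⟨s, h₃, h₄⟩ := hxy.exists_of_mul_eq_mul hx
    (show x * (m₂₁ - n₂₁) = y * (n₂₂ - m₂₂) by linear_combination hg' - hg)
  refine ⟨s, -t, ?_⟩
  obtain rfl := sub_eq_iff_eq_add.1 h₂
  obtain rfl := sub_eq_iff_eq_add.1 h₄
  obtain rfl : n₁₁ = m₁₁ - y * t := by linear_combination -h₁
  obtain rfl : n₂₁ = m₂₁ - y * s := by linear_combination -h₃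
  rw [hf, hg]
  ring

omit [IsDomain B] in
theorem isRegularMod_span_of_isRelPrime {f g : B} (h : IsRelPrime f g) :
    IsRegularMod (⊥ ⊔ Ideal.span {f}) g := by
  intro a
  rw [bot_sup_eq, Ideal.mem_span_singleton, Ideal.mem_span_singleton]
  exact ⟨fun h => h.mul_left _, fun h' => h.dvd_of_dvd_mul_left h'⟩

omit [DecompositionMonoid B] in
theorem isRegularMod_bot {f : B} (h : f ≠ 0) : IsRegularMod ⊥ f := by
  intro a
  simp [h]
end

section
variable {B : Type u} [CommRing B]

theorem IsRegularMod.pow {I : Ideal B} {x : B} (h : IsRegularMod I x) (n : ℕ) :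
    IsRegularMod I (x ^ n) := by
  induction n with
  | zero => intro a; simp
  | succ n ih => intro a; rw [pow_succ, mul_assoc, ← ih, ← h]

theorem isRegularMod_of_retraction [IsDomain B] {f g x : B} (hx : x ≠ 0) (π : B →+* B)
    (hf : π f = f) (hg : π g = g) (hπx : π x = 0) (hπ : ∀ b, x ∣ b - π b) :
    IsRegularMod (⊥ ⊔ Ideal.span {f} ⊔ Ideal.span {g}) x := by
  intro a
  refine ⟨fun h => Ideal.mul_mem_left _ _ h, fun h => ?_⟩
  rw [bot_sup_eq, ← Ideal.span_insert, Ideal.mem_span_pair] at h ⊢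
  obtain ⟨u, v, h⟩ := h
  have h' := congrArg π h
  simp only [map_add, map_mul, hf, hg, hπx, zero_mul] at h'
  obtain ⟨u', hu⟩ := hπ u
  obtain ⟨v', hv⟩ := hπ v
  exact ⟨u', v', mul_left_cancel₀ hx (by linear_combination h - h' - f * hu - g * hv)⟩
end

section
variable {F : Type u} [Field F]

/-- The retraction of `F[X₀, X₁, X₂]` onto `F[X₁, X₂]` sending `X₀` to zero. -/
def killZero : MvPolynomial (Fin 3) F →ₐ[F] MvPolynomial (Fin 3) F :=
  aeval ![0, X 1, X 2]

theorem X_zero_dvd_sub_killZero (b : MvPolynomial (Fin 3) F) : X 0 ∣ b - killZero b := by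
  induction b using MvPolynomial.induction_on with
  | C a => simp [killZero]
  | add p q hp hq =>
    rw [map_add, add_sub_add_comm]
    exact dvd_add hp hq
  | mul_X p i hp =>
    rw [map_mul]
    have hX : (X 0 : MvPolynomial (Fin 3) F) ∣ X i - killZero (X i) := by
      fin_cases i <;> simp [killZero]
    have : p * X i - killZero p * killZero (X i) =
      (p - killZero p) * X i + killZero p * (X i - killZero (X i)) := by ring
    rw [this]
    exact dvd_add (hp.mul_right _) (hX.mul_left _)

theorem isRelPrime_X {i j : Fin 3} (h : i ≠ j) :
    IsRelPrime (X i : MvPolynomial (Fin 3) F) (X j) := by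
  rw [(X_prime (i := i)).irreducible.isRelPrime_iff_not_dvd, X_dvd_X]
  simp [h]

variable (F) in
/-- A homogeneous system of parameters `f, g, X₀ ^ (N + 1)` of `F[X₀, X₁, X₂]`, where
`f = u X₁` and `g = v X₁ + w X₂`. -/
structure ParamSystem where
  f : MvPolynomial (Fin 3) F
  g : MvPolynomial (Fin 3) F
  u : MvPolynomial (Fin 3) F
  v : MvPolynomial (Fin 3) F
  w : MvPolynomial (Fin 3) F
  N : ℕ
  df : ℕ
  dg : ℕ
  hf : f = u * X 1
  hg : g = v * X 1 + w * X 2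
  hu_hom : u.IsHomogeneous df
  hv_hom : v.IsHomogeneous dg
  hw_hom : w.IsHomogeneous dg
  killZero_u : killZero u = u
  killZero_v : killZero v = v
  killZero_w : killZero w = w
  relPrime : IsRelPrime f g
  f_ne : f ≠ 0
  exists_pow_le : ∃ K, idealOfVars (Fin 3) F ^ K ≤ ⊥ ⊔ Ideal.span {f} ⊔ Ideal.span {g} ⊔
    Ideal.span {X 0 ^ (N + 1)}

namespace ParamSystem

variable (P : ParamSystem F)

/-- The ideal `(f, g)`. -/
def I₂ : Ideal (MvPolynomial (Fin 3) F) := ⊥ ⊔ Ideal.span {P.f} ⊔ Ideal.span {P.g}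

/-- The ideal `(f, g, X₀ ^ (N + 1))`. -/
def I : Ideal (MvPolynomial (Fin 3) F) := P.I₂ ⊔ Ideal.span {X 0 ^ (P.N + 1)}

theorem mem_I₂ {b : MvPolynomial (Fin 3) F} : b ∈ P.I₂ ↔ ∃ p q, p * P.f + q * P.g = b := by
  rw [I₂, bot_sup_eq, ← Ideal.span_insert, Ideal.mem_span_pair]

theorem mem_I {b : MvPolynomial (Fin 3) F} :
    b ∈ P.I ↔ ∃ p q r, p * P.f + q * P.g + r * X 0 ^ (P.N + 1) = b := by
  rw [I, Submodule.mem_sup]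
  simp only [mem_I₂, Ideal.mem_span_singleton']
  constructor
  · rintro ⟨_, ⟨p, q, rfl⟩, _, ⟨r, rfl⟩, rfl⟩
    exact ⟨p, q, r, rfl⟩
  · rintro ⟨p, q, r, rfl⟩
    exact ⟨_, ⟨p, q, rfl⟩, _, ⟨r, rfl⟩, rfl⟩

theorem f_mem : P.f ∈ P.I := P.mem_I.2 ⟨1, 0, 0, by ring⟩
theorem g_mem : P.g ∈ P.I := P.mem_I.2 ⟨0, 1, 0, by ring⟩
theorem X_pow_mem : X 0 ^ (P.N + 1) ∈ P.I := P.mem_I.2 ⟨0, 0, 1, by ring⟩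

theorem killZero_f : killZero P.f = P.f := by
  rw [P.hf, map_mul, P.killZero_u]
  simp [killZero]

theorem killZero_g : killZero P.g = P.g := by
  rw [P.hg, map_add, map_mul, map_mul, P.killZero_v, P.killZero_w]
  simp [killZero]

theorem f_hom : P.f.IsHomogeneous (P.df + 1) := by
  rw [P.hf]; exact P.hu_hom.mul (isHomogeneous_X _ _)

theorem g_hom : P.g.IsHomogeneous (P.dg + 1) := by
  rw [P.hg]; exact (P.hv_hom.mul (isHomogeneous_X _ _)).add (P.hw_hom.mul (isHomogeneous_X _ _))

theorem regular_f : IsRegularMod ⊥ P.f := isRegularMod_bot P.f_ne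

theorem regular_g : IsRegularMod (⊥ ⊔ Ideal.span {P.f}) P.g :=
  isRegularMod_span_of_isRelPrime P.relPrime

theorem regular_X : IsRegularMod P.I₂ (X 0) :=
  isRegularMod_of_retraction (X_ne_zero 0) (killZero : _ →ₐ[F] _).toRingHom P.killZero_f
    P.killZero_g (by simp [killZero]) X_zero_dvd_sub_killZero

theorem killZero_mem_I₂ {b : MvPolynomial (Fin 3) F} (h : b ∈ P.I₂) : killZero b ∈ P.I₂ := by
  obtain ⟨p, q, rfl⟩ := P.mem_I₂.1 h
  refine P.mem_I₂.2 ⟨killZero p, killZero q, ?_⟩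
  simp only [map_add, map_mul, P.killZero_f, P.killZero_g]

theorem component_mem_I {b : MvPolynomial (Fin 3) F} (h : b ∈ P.I) (d : ℕ) :
    homogeneousComponent d b ∈ P.I := by
  let _ := MvPolynomial.gradedAlgebra (σ := Fin 3) (R := F)
  have hI : P.I = Ideal.span {P.f, P.g, X 0 ^ (P.N + 1)} := by
    rw [I, I₂, bot_sup_eq, ← Ideal.span_union, ← Ideal.span_union]
    congr 1
    ext
    simp only [Set.union_singleton, Set.mem_insert_iff, Set.mem_singleton_iff]
    tauto
  have hhom : P.I.IsHomogeneous (homogeneousSubmodule (Fin 3) F) := by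
    rw [hI]
    refine Ideal.homogeneous_span _ _ ?_
    rintro x (rfl | rfl | rfl)
    · exact ⟨_, P.f_hom⟩
    · exact ⟨_, P.g_hom⟩
    · exact ⟨_, isHomogeneous_X_pow _ _⟩
  exact homogeneousComponent_mem_of_mem hhom h d

/-- The socle generator. -/
def s : MvPolynomial (Fin 3) F := X 0 ^ P.N * (P.u * P.w)

/-- The socle degree. -/
def D : ℕ := P.N + (P.df + P.dg)

theorem s_hom : P.s.IsHomogeneous P.D :=
  (isHomogeneous_X_pow _ _).mul (P.hu_hom.mul P.hw_hom)

theorem mul_uw_mem : ∀ i, i ≠ 0 → X i * (P.u * P.w) ∈ P.I₂ := by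
  intro i hi
  rw [mem_I₂]
  fin_cases i
  · exact absurd rfl hi
  · exact ⟨P.w, 0, by simp [P.hf]; ring⟩
  · exact ⟨-P.v, P.u, by simp [P.hf, P.hg]; ring⟩

theorem I₂_le : P.I₂ ≤ P.I := le_sup_left

theorem X_mul_s_mem (i : Fin 3) : X i * P.s ∈ P.I := by
  by_cases hi : i = 0
  · subst hi
    exact P.mem_I.2 ⟨0, 0, P.u * P.w, by rw [s]; ring⟩
  · rw [s, mul_left_comm]
    exact Ideal.mul_mem_left _ _ (P.I₂_le (P.mul_uw_mem i hi))

theorem mul_s_mem {a : MvPolynomial (Fin 3) F} (ha : a ∈ idealOfVars (Fin 3) F) :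
    P.s * a ∈ P.I := by
  rw [mul_comm]
  have hle : idealOfVars (Fin 3) F ≤ P.I.colon {P.s} := by
    rw [idealOfVars, Ideal.span_le]
    rintro _ ⟨i, rfl⟩
    rw [SetLike.mem_coe, Submodule.mem_colon_singleton]
    exact P.X_mul_s_mem i
  exact Submodule.mem_colon_singleton.1 (hle ha)

end ParamSystem
end

section
variable {F : Type u} [Field F]

theorem X_mem_idealOfVars (i : Fin 3) : (X i : MvPolynomial (Fin 3) F) ∈ idealOfVars (Fin 3) F :=
  Ideal.subset_span ⟨i, rfl⟩

theorem mem_idealOfVars_iff (b : MvPolynomial (Fin 3) F) :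
    b ∈ idealOfVars (Fin 3) F ↔ constantCoeff b = 0 := by
  rw [← pow_one (idealOfVars (Fin 3) F), mem_pow_idealOfVars_iff']
  constructor
  · intro h
    exact h 0 (by simp)
  · intro h x hx
    have : x = 0 := by
      rw [← Finsupp.degree_eq_zero_iff]
      omega
    rw [this]
    exact h

theorem constantCoeff_eq_zero_of_isHomogeneous {b : MvPolynomial (Fin 3) F} {d : ℕ}
    (hb : b.IsHomogeneous d) (hd : d ≠ 0) : constantCoeff b = 0 :=
  hb.coeff_eq_zero (by simpa using hd.symm)

namespace ParamSystem

variable (P : ParamSystem F)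

theorem I_ne_top : P.I ≠ ⊤ := by
  intro h
  have h1 : (1 : MvPolynomial (Fin 3) F) ∈ P.I := h ▸ Submodule.mem_top
  obtain ⟨p, q, r, h⟩ := P.mem_I.1 h1
  have := congrArg constantCoeff h
  simp [constantCoeff_eq_zero_of_isHomogeneous P.f_hom (by omega),
    constantCoeff_eq_zero_of_isHomogeneous P.g_hom (by omega)] at this

theorem exists_sub_C_mul_s_mem {b : MvPolynomial (Fin 3) F} (hb : ∀ i, X i * b ∈ P.I) :
    ∃ c : F, b - C c * P.s ∈ P.I := by
  obtain ⟨y, hy, z, hz, hyz⟩ := Submodule.mem_sup.1 (hb 0)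
  obtain ⟨r, rfl⟩ := Ideal.mem_span_singleton'.1 hz
  have h₁ : b - r * X 0 ^ P.N ∈ P.I₂ := by
    rw [P.regular_X]
    convert hy using 1
    linear_combination -hyz
  obtain ⟨c, hc⟩ := X_zero_dvd_sub_killZero r
  have hkk : killZero (killZero r) = killZero r := by
    have := congrArg killZero hc
    rw [map_sub, map_mul] at this
    simp only [killZero, aeval_X, Matrix.cons_val_zero, zero_mul] at this
    exact (sub_eq_zero.1 this).symm
  set w' := killZero r with hw'
  have h₂ : b - w' * X 0 ^ P.N ∈ P.I := by
    have : b - w' * X 0 ^ P.N = b - r * X 0 ^ P.N + c * X 0 ^ (P.N + 1) := by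
      linear_combination X 0 ^ P.N * hc
    rw [this]
    exact add_mem (P.I₂_le h₁) (Ideal.mul_mem_left _ _ P.X_pow_mem)
  have h₃ : ∀ i : Fin 3, i ≠ 0 → w' * X i ∈ P.I₂ := by
    intro i hi
    have hm : X i * (w' * X 0 ^ P.N) ∈ P.I := by
      have := sub_mem (hb i) (Ideal.mul_mem_left _ (X i) h₂)
      convert this using 1
      ring
    obtain ⟨y, hy, z, hz, hyz⟩ := Submodule.mem_sup.1 hm
    obtain ⟨r', rfl⟩ := Ideal.mem_span_singleton'.1 hz
    have h₄ : X i * w' - r' * X 0 ∈ P.I₂ := by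
      rw [P.regular_X.pow P.N]
      convert hy using 1
      linear_combination -hyz
    have h₅ := P.killZero_mem_I₂ h₄
    rw [map_sub, map_mul, map_mul, hkk] at h₅
    have hXi : killZero (X i : MvPolynomial (Fin 3) F) = X i := by
      fin_cases i
      · exact absurd rfl hi
      · simp [killZero]
      · simp [killZero]
    rw [hXi] at h₅
    simpa [killZero, mul_comm] using h₅
  obtain ⟨α, β, h₆⟩ := P.mem_I₂.1 (h₃ 1 (by simp))
  obtain ⟨γ, δ, h₇⟩ := P.mem_I₂.1 (h₃ 2 (by simp))
  obtain ⟨t, p, q, h₈⟩ := exists_eq_det_of_mul_mem (isRelPrime_X (F := F) (i := 1) (j := 2)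
    (by simp)) (X_ne_zero 1) P.relPrime P.f_ne (m₁₁ := P.u) (m₁₂ := 0)
    (by rw [P.hf]; ring) P.hg h₆.symm h₇.symm
  refine ⟨constantCoeff t, ?_⟩
  have h₉ : P.s * (t - C (constantCoeff t)) ∈ P.I :=
    P.mul_s_mem ((mem_idealOfVars_iff _).2 (by simp))
  have : b - C (constantCoeff t) * P.s = (b - w' * X 0 ^ P.N) + P.s * (t - C (constantCoeff t))
      + (X 0 ^ P.N * p * P.f + X 0 ^ P.N * q * P.g) := by
    rw [h₈, s]
    ring
  rw [this]
  exact add_mem (add_mem h₂ h₉)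
    (add_mem (Ideal.mul_mem_left _ _ P.f_mem) (Ideal.mul_mem_left _ _ P.g_mem))

theorem exists_pow_le_I : ∃ K, idealOfVars (Fin 3) F ^ K ≤ P.I := P.exists_pow_le

theorem s_notMem : P.s ∉ P.I := by
  intro hs
  obtain ⟨K, hK⟩ := P.exists_pow_le_I
  obtain ⟨t, ht, hta⟩ := exists_socle_of_pow_le K hK P.I_ne_top
  obtain ⟨c, hc⟩ := P.exists_sub_C_mul_s_mem (b := t) fun i => by
    rw [mul_comm]; exact hta _ (X_mem_idealOfVars i)
  refine ht ?_
  rw [← sub_add_cancel t (C c * P.s)]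
  exact add_mem hc (Ideal.mul_mem_left _ _ hs)

theorem mem_I_of_X_mul_mem {b : MvPolynomial (Fin 3) F} {d : ℕ} (hb : b.IsHomogeneous d)
    (hd : d ≠ P.D) (h : ∀ i, X i * b ∈ P.I) : b ∈ P.I := by
  obtain ⟨c, hc⟩ := P.exists_sub_C_mul_s_mem h
  have := P.component_mem_I hc d
  rwa [map_sub, homogeneousComponent_C_mul, homogeneousComponent_of_mem P.s_hom,
    homogeneousComponent_of_mem hb, if_pos rfl, if_neg hd, mul_zero, sub_zero] at this

theorem mem_I_of_isHomogeneous {b : MvPolynomial (Fin 3) F} {d : ℕ} (hb : b.IsHomogeneous d)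
    (hd : P.D < d) : b ∈ P.I := by
  obtain ⟨K, hK⟩ := P.exists_pow_le_I
  obtain ⟨n, hn⟩ : ∃ n, K ≤ d + n := ⟨K, by omega⟩
  induction n generalizing b d with
  | zero =>
    refine hK ((mem_pow_idealOfVars_iff _ _).2 fun x hx => ?_)
    have := hb.degree_eq_sum_deg_support hx
    rw [Finsupp.degree_apply]
    omega
  | succ n ih =>
    refine P.mem_I_of_X_mul_mem hb (by omega) fun i => ?_
    exact ih ((isHomogeneous_X F i).mul hb) (by omega) (by omega)

theorem exists_sub_C_mul_s_mem_of_isHomogeneous {b : MvPolynomial (Fin 3) F}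
    (hb : b.IsHomogeneous P.D) : ∃ c : F, b - C c * P.s ∈ P.I :=
  P.exists_sub_C_mul_s_mem fun i =>
    P.mem_I_of_isHomogeneous ((isHomogeneous_X F i).mul hb) (by omega)

theorem exists_functional : ∃ l : MvPolynomial (Fin 3) F →ₗ[F] F,
    (∀ b ∈ P.I, l b = 0) ∧ l P.s = 1 := by
  obtain ⟨l, h₁, h₂⟩ := Submodule.exists_le_ker_of_notMem (p := P.I.restrictScalars F)
    (v := P.s) P.s_notMem
  refine ⟨(l P.s)⁻¹ • l, fun b hb => ?_, ?_⟩
  · have : l b = 0 := h₂ hb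
    simp [this]
  · simpa using inv_mul_cancel₀ h₁

/-- The functional extracting the coefficient of the socle generator. -/
def functional : MvPolynomial (Fin 3) F →ₗ[F] F :=
  P.exists_functional.choose ∘ₗ homogeneousComponent P.D

theorem functional_of_mem {b : MvPolynomial (Fin 3) F} (hb : b ∈ P.I) : P.functional b = 0 :=
  P.exists_functional.choose_spec.1 _ (P.component_mem_I hb _)

theorem functional_s : P.functional P.s = 1 := by
  rw [functional, LinearMap.comp_apply, homogeneousComponent_of_mem P.s_hom, if_pos rfl]
  exact P.exists_functional.choose_spec.2

theorem functional_of_isHomogeneous {b : MvPolynomial (Fin 3) F} {d : ℕ} (hb : b.IsHomogeneous d)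
    (hd : d ≠ P.D) : P.functional b = 0 := by
  rw [functional, LinearMap.comp_apply, homogeneousComponent_of_mem hb, if_neg hd.symm, map_zero]

theorem functional_C_mul (c : F) (b : MvPolynomial (Fin 3) F) :
    P.functional (C c * b) = c * P.functional b := by
  rw [← smul_eq_C_mul, map_smul, smul_eq_mul]

theorem functional_component (b : MvPolynomial (Fin 3) F) :
    P.functional (homogeneousComponent P.D b) = P.functional b := by
  rw [functional, LinearMap.comp_apply, LinearMap.comp_apply,
    homogeneousComponent_of_mem (homogeneousComponent_mem _ _), if_pos rfl]

theorem component_sub_mem (b : MvPolynomial (Fin 3) F) :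
    homogeneousComponent P.D b - C (P.functional b) * P.s ∈ P.I := by
  obtain ⟨c, hc⟩ := P.exists_sub_C_mul_s_mem_of_isHomogeneous
    (homogeneousComponent_isHomogeneous P.D b)
  have := P.functional_of_mem hc
  rw [map_sub, functional_C_mul, functional_s, mul_one, functional_component, sub_eq_zero] at this
  rwa [this]

theorem mem_I_of_functional_eq_zero {z : MvPolynomial (Fin 3) F}
    (hz : ∀ b, P.functional (z * b) = 0) : z ∈ P.I := by
  by_contra hzI
  obtain ⟨K, hK⟩ := P.exists_pow_le_I
  let J : Ideal (MvPolynomial (Fin 3) F) := P.I.colon {z}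
  have hJ : ∀ y, y ∈ J ↔ z * y ∈ P.I := fun y => by
    rw [Submodule.mem_colon_singleton, smul_eq_mul, mul_comm]
  obtain ⟨y, hy, hya⟩ := exists_socle_of_pow_le (J := J) K
    (fun x hx => (hJ x).2 (Ideal.mul_mem_left _ _ (hK hx)))
    (fun h => hzI (by simpa using (hJ 1).1 (h ▸ Submodule.mem_top)))
  rw [hJ] at hy
  obtain ⟨c, hc⟩ := P.exists_sub_C_mul_s_mem (b := z * y) fun i => by
    have := (hJ _).1 (hya _ (X_mem_idealOfVars i))
    convert this using 1
    ring
  have := P.functional_of_mem hc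
  rw [map_sub, functional_C_mul, functional_s, hz, mul_one, zero_sub, neg_eq_zero] at this
  rw [this, C_0, zero_mul, sub_zero] at hc
  exact hy hc

end ParamSystem
end

section

theorem exists_eq_mul_of_nondegenerate {F Q : Type*} [Field F] [CommRing Q] [Algebra F Q]
    (I : Ideal Q) [Module.Finite F (Q ⧸ I)] (l : Q →ₗ[F] F) (hl : ∀ b ∈ I, l b = 0)
    (hnd : ∀ z, (∀ b, l (z * b) = 0) → z ∈ I) (μ : Q →ₗ[F] F) (hμ : ∀ b ∈ I, μ b = 0) :
    ∃ q, ∀ b, μ b = l (q * b) := by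
  let K : Submodule F Q := I.restrictScalars F
  have : Module.Finite F (Q ⧸ K) :=
    Module.Finite.equiv (Submodule.Quotient.restrictScalarsEquiv F I).symm
  let β : Q →ₗ[F] Module.Dual F Q := (LinearMap.mul F Q).compr₂ l
  have hβ : ∀ z b, β z b = l (z * b) := fun z b => rfl
  have hβK : ∀ z, β z ∈ K.dualAnnihilator := fun z =>
    (Submodule.mem_dualAnnihilator _).2 fun b hb => hl _ (I.mul_mem_left _ hb)
  have hker : LinearMap.ker β = K := by
    ext z
    refine ⟨fun hz => hnd z fun b => LinearMap.congr_fun (LinearMap.mem_ker.1 hz) b, fun hz => ?_⟩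
    rw [LinearMap.mem_ker]
    ext b
    exact hl _ (I.mul_mem_right _ hz)
  have : Module.Finite F K.dualAnnihilator := Module.Finite.equiv K.dualQuotEquivDualAnnihilator
  have hrange : LinearMap.range β = K.dualAnnihilator := by
    refine Submodule.eq_of_le_of_finrank_eq ?_ ?_
    · rintro _ ⟨z, rfl⟩
      exact hβK z
    · rw [← β.quotKerEquivRange.finrank_eq, hker, ← K.dualQuotEquivDualAnnihilator.finrank_eq,
        Subspace.dual_finrank_eq]
  obtain ⟨q, hq⟩ := hrange.symm ▸ (Submodule.mem_dualAnnihilator μ).2 hμ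
  exact ⟨q, fun b => (LinearMap.congr_fun hq b).symm⟩

variable {F : Type u} [Field F]

namespace ParamSystem

variable (P : ParamSystem F)

instance finite_quotient : Module.Finite F (MvPolynomial (Fin 3) F ⧸ P.I) := by
  refine Module.Finite.of_surjective (((Ideal.Quotient.mkₐ F P.I).toLinearMap) ∘ₗ
    (restrictTotalDegree (Fin 3) F P.D).subtype) fun z => ?_
  obtain ⟨b, rfl⟩ := Ideal.Quotient.mk_surjective z
  induction b using MvPolynomial.induction_on' with
  | monomial n a =>
    by_cases hn : P.D < n.degree
    · refine ⟨0, ?_⟩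
      rw [map_zero, eq_comm, Ideal.Quotient.eq_zero_iff_mem]
      exact P.mem_I_of_isHomogeneous (isHomogeneous_monomial a rfl) hn
    · refine ⟨⟨monomial n a, ?_⟩, rfl⟩
      rw [mem_restrictTotalDegree]
      exact (isHomogeneous_monomial a rfl).totalDegree_le.trans (not_lt.1 hn)
  | add p q hp hq =>
    obtain ⟨x, hx⟩ := hp
    obtain ⟨y, hy⟩ := hq
    exact ⟨x + y, by rw [map_add, map_add, hx, hy]⟩

end ParamSystem

variable (F) in
/-- A linear action on `F[X₀, X₁, X₂]` preserving the line of `X₀` and the plane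
of `X₁` and `X₂`. -/
structure PlaneAction (H : Type*) [Group H] [MulSemiringAction H (MvPolynomial (Fin 3) F)]
    [SMulCommClass H F (MvPolynomial (Fin 3) F)] where
  χ : H → F
  c : H → Matrix (Fin 2) (Fin 2) F
  smul_X_zero : ∀ h : H, h • (X 0 : MvPolynomial (Fin 3) F) = C (χ h) * X 0
  smul_X_one : ∀ h : H, h • (X 1 : MvPolynomial (Fin 3) F) = C (c h 0 0) * X 1 + C (c h 0 1) * X 2
  smul_X_two : ∀ h : H, h • (X 2 : MvPolynomial (Fin 3) F) = C (c h 1 0) * X 1 + C (c h 1 1) * X 2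

namespace PlaneAction

variable {H : Type*} [Group H] [MulSemiringAction H (MvPolynomial (Fin 3) F)]
    [SMulCommClass H F (MvPolynomial (Fin 3) F)]

theorem smul_C (h : H) (a : F) : h • (C a : MvPolynomial (Fin 3) F) = C a :=
  smul_algebraMap h a

variable (A : PlaneAction F H)
include A

theorem isHomogeneous_smul (h : H) {b : MvPolynomial (Fin 3) F} {d : ℕ} (hb : b.IsHomogeneous d) :
    (h • b).IsHomogeneous d := by
  have h₁ : MulSemiringAction.toAlgHom F _ h =
      (aeval fun i : Fin 3 => h • (X i : MvPolynomial (Fin 3) F)) := by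
    ext i : 1
    simp
  have h₂ : h • b = aeval (fun i : Fin 3 => h • (X i : MvPolynomial (Fin 3) F)) b := by
    rw [← h₁]
    rfl
  rw [h₂, ← one_mul d]
  refine hb.aeval _ fun i => ?_
  have hm : ∀ (a : F) (j : Fin 3), (C a * X j : MvPolynomial (Fin 3) F).IsHomogeneous 1 :=
    fun a j => by simpa using (isHomogeneous_C (Fin 3) a).mul (isHomogeneous_X F j)
  fin_cases i
  · simpa [A.smul_X_zero] using hm _ _
  · simpa [A.smul_X_one] using (hm _ _).add (hm _ _)
  · simpa [A.smul_X_two] using (hm _ _).add (hm _ _)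

theorem killZero_smul (h : H) (b : MvPolynomial (Fin 3) F) :
    killZero (h • b) = h • killZero b := by
  have h₁ : killZero.comp (MulSemiringAction.toAlgHom F _ h) =
      (MulSemiringAction.toAlgHom F (MvPolynomial (Fin 3) F) h).comp killZero := by
    ext i : 1
    fin_cases i <;> simp [killZero, A.smul_X_zero, A.smul_X_one, A.smul_X_two]
  exact AlgHom.congr_fun h₁ b

theorem component_smul (h : H) (d : ℕ) (b : MvPolynomial (Fin 3) F) :
    homogeneousComponent d (h • b) = h • homogeneousComponent d b := by
  conv_lhs => rw [← sum_homogeneousComponent b, Finset.smul_sum, map_sum]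
  simp_rw [homogeneousComponent_of_mem
    (A.isHomogeneous_smul h (homogeneousComponent_isHomogeneous _ b))]
  rw [Finset.sum_ite_eq]
  split_ifs with hd
  · rfl
  · rw [Finset.mem_range, not_lt] at hd
    rw [homogeneousComponent_eq_zero _ _ (by omega), smul_zero]

theorem constantCoeff_smul (h : H) (b : MvPolynomial (Fin 3) F) :
    constantCoeff (h • b) = constantCoeff b := by
  have := A.component_smul h 0 b
  rw [homogeneousComponent_zero, homogeneousComponent_zero, smul_C] at this
  exact C_injective _ _ this

theorem χ_mul (g h : H) : A.χ (g * h) = A.χ g * A.χ h := by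
  have := mul_smul g h (X 0 : MvPolynomial (Fin 3) F)
  rw [A.smul_X_zero, A.smul_X_zero, smul_mul', smul_C, A.smul_X_zero, ← mul_assoc, ← C_mul] at this
  rw [mul_comm (A.χ g)]
  exact C_injective _ _ (mul_right_cancel₀ (X_ne_zero 0) this)

theorem χ_one : A.χ 1 = 1 := by
  have := A.smul_X_zero 1
  rw [one_smul] at this
  refine C_injective (Fin 3) F (mul_right_cancel₀ (X_ne_zero 0) ?_)
  rw [← this, C_1, one_mul]

theorem χ_pow_card [Finite H] (h : H) : A.χ h ^ Nat.card H = 1 := by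
  let φ : H →* F := ⟨⟨A.χ, A.χ_one⟩, A.χ_mul⟩
  change φ h ^ _ = 1
  rw [← map_pow, pow_card_eq_one', map_one]

end PlaneAction

/-- A system of parameters invariant under an action. -/
structure InvariantParamSystem {H : Type*} [Group H] [MulSemiringAction H (MvPolynomial (Fin 3) F)]
    [SMulCommClass H F (MvPolynomial (Fin 3) F)] (A : PlaneAction F H) extends ParamSystem F where
  smul_f : ∀ h : H, h • f = f
  smul_g : ∀ h : H, h • g = g
  χ_pow : ∀ h : H, A.χ h ^ (N + 1) = 1

namespace InvariantParamSystem

variable {H : Type*} [Group H] [MulSemiringAction H (MvPolynomial (Fin 3) F)]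
    [SMulCommClass H F (MvPolynomial (Fin 3) F)] {A : PlaneAction F H}
    (P : InvariantParamSystem A)

theorem smul_X_pow (h : H) : h • (X 0 ^ (P.N + 1) : MvPolynomial (Fin 3) F) = X 0 ^ (P.N + 1) := by
  rw [smul_pow', A.smul_X_zero, mul_pow, ← C_pow, P.χ_pow, C_1, one_mul]

theorem smul_mem_I (h : H) {b : MvPolynomial (Fin 3) F} (hb : b ∈ P.I) : h • b ∈ P.I := by
  obtain ⟨p, q, r, rfl⟩ := P.mem_I.1 hb
  refine P.mem_I.2 ⟨h • p, h • q, h • r, ?_⟩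
  rw [smul_add, smul_add, smul_mul', smul_mul', smul_mul', P.smul_f, P.smul_g, P.smul_X_pow]

/-- The character of the action on the socle. -/
def κ (h : H) : F := P.functional (h • P.s)

theorem functional_smul (h : H) (b : MvPolynomial (Fin 3) F) :
    P.functional (h • b) = P.κ h * P.functional b := by
  have h₁ := P.functional_of_mem (P.smul_mem_I h (P.component_sub_mem b))
  rw [smul_sub, smul_mul', PlaneAction.smul_C, map_sub, P.functional_C_mul, sub_eq_zero,
    ← A.component_smul, P.functional_component] at h₁
  rw [h₁, mul_comm]
  rfl

theorem κ_mul (g h : H) : P.κ (g * h) = P.κ g * P.κ h := by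
  rw [κ, mul_smul, functional_smul]
  rfl

theorem κ_one : P.κ 1 = 1 := by
  rw [κ, one_smul, P.functional_s]

theorem κ_mul_eq_one (h : H) : P.κ h * (A.χ h * (A.c h).det) = 1 := by
  have hf : P.f = (h • P.u * C (A.c h 0 0)) * X 1 + (h • P.u * C (A.c h 0 1)) * X 2 := by
    rw [← P.smul_f h, P.hf, smul_mul', A.smul_X_one]
    ring
  have hg : P.g = (h • P.v * C (A.c h 0 0) + h • P.w * C (A.c h 1 0)) * X 1 +
      (h • P.v * C (A.c h 0 1) + h • P.w * C (A.c h 1 1)) * X 2 := by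
    rw [← P.smul_g h, P.hg, smul_add, smul_mul', smul_mul', A.smul_X_one, A.smul_X_two]
    ring
  obtain ⟨p, q, hpq⟩ := exists_det_eq_of_eq (isRelPrime_X (F := F) (i := 1) (j := 2)
    (by simp)) (X_ne_zero 1) (m₁₁ := P.u) (m₁₂ := 0) (by rw [P.hf]; ring) P.hg hf hg
  have hs : C (A.χ h * (A.c h).det) * h • P.s - P.s ∈ P.I := by
    refine P.mem_I.2 ⟨X 0 ^ P.N * p, X 0 ^ P.N * q, 0, ?_⟩
    have hχ : (C (A.χ h) * C (A.χ h) ^ P.N : MvPolynomial (Fin 3) F) = 1 := by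
      rw [← pow_succ', ← C_pow, P.χ_pow, C_1]
    rw [ParamSystem.s, smul_mul', smul_mul', smul_pow', A.smul_X_zero, Matrix.det_fin_two]
    simp only [C_mul, C_sub]
    linear_combination -(X 0 ^ P.N) * hpq - (X 0 ^ P.N) * (h • P.u * h • P.w *
      (C (A.c h 0 0) * C (A.c h 1 1) - C (A.c h 0 1) * C (A.c h 1 0))) * hχ
  have := P.functional_of_mem hs
  rw [map_sub, P.functional_C_mul, P.functional_s, sub_eq_zero] at this
  rw [mul_comm]
  exact this

end InvariantParamSystem

end

section
variable {F : Type u} [Field F]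

namespace PlaneAction

variable {H : Type*} [Group H] [MulSemiringAction H (MvPolynomial (Fin 3) F)]
    [SMulCommClass H F (MvPolynomial (Fin 3) F)] (A : PlaneAction F H)

section
variable [Fintype H]

omit [SMulCommClass H F (MvPolynomial (Fin 3) F)] in
theorem prod_smul_eq [DecidableEq H] (b : MvPolynomial (Fin 3) F) :
    ∏ h : H, h • b = (∏ h ∈ Finset.univ.erase (1 : H), h • b) * b := by
  rw [← Finset.prod_erase_mul _ _ (Finset.mem_univ (1 : H)), one_smul]

/-- A form in `X₁` and `X₂` without common zeros with the conjugates of `X₁`. -/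
def form : MvPolynomial (Fin 3) F :=
  (∏ h : H, (X 1 + C (A.c h 0 1 / A.c h 0 0) * X 2)) * X 1 + X 2 ^ Fintype.card H * X 2

theorem prod_linear_hom :
    (∏ h : H, (X 1 + C (A.c h 0 1 / A.c h 0 0) * X 2 : MvPolynomial (Fin 3) F)).IsHomogeneous
      (Fintype.card H) := by
  rw [Fintype.card_eq_sum_ones]
  refine IsHomogeneous.prod _ _ _ fun h _ => ?_
  refine (isHomogeneous_X F 1).add ?_
  simpa using (isHomogeneous_C (Fin 3) _).mul (isHomogeneous_X F 2)

theorem form_hom : A.form.IsHomogeneous (Fintype.card H + 1) :=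
  (A.prod_linear_hom.mul (isHomogeneous_X F 1)).add
    ((isHomogeneous_X_pow _ _).mul (isHomogeneous_X F 2))

theorem killZero_form : killZero A.form = A.form := by
  rw [form]
  simp only [map_add, map_mul, map_prod, map_pow]
  simp [killZero]

omit [Fintype H] in
include A in
theorem smul_X_mem {𝔮 : Ideal (MvPolynomial (Fin 3) F)} (h₁ : X 1 ∈ 𝔮) (h₂ : X 2 ∈ 𝔮) (h : H)
    {i : Fin 3} (hi : i ≠ 0) : h • (X i : MvPolynomial (Fin 3) F) ∈ 𝔮 := by
  fin_cases i
  · exact absurd rfl hi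
  · exact A.smul_X_one h ▸ add_mem (𝔮.mul_mem_left _ h₁) (𝔮.mul_mem_left _ h₂)
  · exact A.smul_X_two h ▸ add_mem (𝔮.mul_mem_left _ h₁) (𝔮.mul_mem_left _ h₂)

theorem X_mem_of_form_mem (𝔮 : Ideal (MvPolynomial (Fin 3) F)) [𝔮.IsPrime] (h : H)
    (h₁ : h • (X 1 : MvPolynomial (Fin 3) F) ∈ 𝔮) (h₂ : A.form ∈ 𝔮) : X 1 ∈ 𝔮 ∧ X 2 ∈ 𝔮 := by
  rw [A.smul_X_one] at h₁
  have hunit : ∀ {a : F} {x : MvPolynomial (Fin 3) F}, a ≠ 0 → C a * x ∈ 𝔮 → x ∈ 𝔮 := by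
    intro a x ha hx
    have := 𝔮.mul_mem_left (C a⁻¹) hx
    rwa [← mul_assoc, ← C_mul, inv_mul_cancel₀ ha, C_1, one_mul] at this
  by_cases hα : A.c h 0 0 = 0
  · have hβ : A.c h 0 1 ≠ 0 := by
      intro hβ
      have := A.smul_X_one h
      rw [hα, hβ, C_0, zero_mul, zero_mul, add_zero, smul_eq_zero_iff_eq] at this
      exact X_ne_zero _ this
    rw [hα, C_0, zero_mul, zero_add] at h₁
    have hX₂ := hunit hβ h₁
    refine ⟨?_, hX₂⟩
    have := (𝔮.add_mem_iff_left (𝔮.mul_mem_left _ hX₂)).1 h₂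
    rcases Ideal.IsPrime.mem_or_mem ‹_› this with h₃ | h₃
    · obtain ⟨h', -, h₄⟩ := (Ideal.IsPrime.prod_mem_iff).1 h₃
      exact (𝔮.add_mem_iff_left (𝔮.mul_mem_left _ hX₂)).1 h₄
    · exact h₃
  · have h₃ : (X 1 + C (A.c h 0 1 / A.c h 0 0) * X 2 : MvPolynomial (Fin 3) F) ∈ 𝔮 := by
      refine hunit hα ?_
      rwa [mul_add, ← mul_assoc, ← C_mul, mul_div_cancel₀ _ hα]
    have h₄ : (∏ h : H, (X 1 + C (A.c h 0 1 / A.c h 0 0) * X 2 : MvPolynomial (Fin 3) F)) ∈ 𝔮 :=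
      Ideal.IsPrime.prod_mem_iff.2 ⟨h, Finset.mem_univ _, h₃⟩
    have h₅ := (𝔮.add_mem_iff_right (𝔮.mul_mem_right _ h₄)).1 h₂
    have hX₂ : X 2 ∈ 𝔮 := by
      rw [← pow_succ] at h₅
      exact Ideal.IsPrime.mem_of_pow_mem ‹_› _ h₅
    exact ⟨(𝔮.add_mem_iff_left (𝔮.mul_mem_left _ hX₂)).1 h₃, hX₂⟩

theorem X_mem_of_prod_mem (𝔮 : Ideal (MvPolynomial (Fin 3) F)) [𝔮.IsPrime]
    (h₁ : ∏ h : H, h • (X 1 : MvPolynomial (Fin 3) F) ∈ 𝔮) (h₂ : ∏ h : H, h • A.form ∈ 𝔮) :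
    X 1 ∈ 𝔮 ∧ X 2 ∈ 𝔮 := by
  obtain ⟨h, -, h₁⟩ := Ideal.IsPrime.prod_mem_iff.1 h₁
  obtain ⟨h', -, h₂⟩ := Ideal.IsPrime.prod_mem_iff.1 h₂
  let φ := MulSemiringAction.toRingHom H (MvPolynomial (Fin 3) F) h'
  have hφ : ∀ b, φ b = h' • b := fun b => rfl
  obtain ⟨h₃, h₄⟩ := A.X_mem_of_form_mem (𝔮.comap φ) (h'⁻¹ * h)
    (by rwa [Ideal.mem_comap, hφ, mul_smul, smul_inv_smul])
    (by rwa [Ideal.mem_comap, hφ])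
  have key : ∀ i : Fin 3, i ≠ 0 → (X i : MvPolynomial (Fin 3) F) ∈ 𝔮 := by
    intro i hi
    have := A.smul_X_mem h₃ h₄ h'⁻¹ hi
    rwa [Ideal.mem_comap, hφ, smul_inv_smul] at this
  exact ⟨key 1 (by simp), key 2 (by simp)⟩

omit [SMulCommClass H F (MvPolynomial (Fin 3) F)] in
theorem prod_smul_X_ne_zero : ∏ h : H, h • (X 1 : MvPolynomial (Fin 3) F) ≠ 0 :=
  Finset.prod_ne_zero_iff.2 fun h _ => by
    rw [Ne, smul_eq_zero_iff_eq]
    exact X_ne_zero _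

theorem isRelPrime_prod :
    IsRelPrime (∏ h : H, h • (X 1 : MvPolynomial (Fin 3) F)) (∏ h : H, h • A.form) := by
  intro d h₁ h₂
  by_contra hd
  have hd₀ : d ≠ 0 := by
    rintro rfl
    exact prod_smul_X_ne_zero (zero_dvd_iff.1 h₁)
  obtain ⟨π, hπ, hπd⟩ := WfDvdMonoid.exists_irreducible_factor hd hd₀
  have hp : (Ideal.span {π}).IsPrime := (Ideal.span_singleton_prime hπ.ne_zero).2 hπ.prime
  obtain ⟨h₃, h₄⟩ := A.X_mem_of_prod_mem (Ideal.span {π})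
    (Ideal.mem_span_singleton.2 (hπd.trans h₁)) (Ideal.mem_span_singleton.2 (hπd.trans h₂))
  rw [Ideal.mem_span_singleton] at h₃ h₄
  exact hπ.not_isUnit (isRelPrime_X (F := F) (i := 1) (j := 2) (by simp) h₃ h₄)

theorem exists_pow_le (n : ℕ) : ∃ K, idealOfVars (Fin 3) F ^ K ≤
    ⊥ ⊔ Ideal.span {∏ h : H, h • (X 1 : MvPolynomial (Fin 3) F)} ⊔
      Ideal.span {∏ h : H, h • A.form} ⊔ Ideal.span {X 0 ^ n} := by
  refine Ideal.exists_pow_le_of_le_radical_of_fg ?_ (idealOfVars_fg _ _)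
  rw [Ideal.radical_eq_sInf, le_sInf_iff]
  rintro 𝔮 ⟨h𝔮, hprime⟩
  simp only [sup_le_iff, Ideal.span_singleton_le_iff_mem] at h𝔮
  obtain ⟨h₁, h₂⟩ := A.X_mem_of_prod_mem 𝔮 h𝔮.1.1.2 h𝔮.1.2
  have h₀ := hprime.mem_of_pow_mem _ h𝔮.2
  rw [idealOfVars, Ideal.span_le]
  rintro _ ⟨i, rfl⟩
  fin_cases i
  exacts [h₀, h₁, h₂]

include A in
theorem exists_isHomogeneous_prod_erase [DecidableEq H] {b : MvPolynomial (Fin 3) F} {d : ℕ}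
    (hb : b.IsHomogeneous d) :
    ∃ n, (∏ h ∈ Finset.univ.erase (1 : H), h • b).IsHomogeneous n :=
  ⟨_, IsHomogeneous.prod _ _ _ fun h _ => A.isHomogeneous_smul h hb⟩

omit [Fintype H] in
include A in
theorem killZero_prod_smul {b : MvPolynomial (Fin 3) F} (hb : killZero b = b) (s : Finset H) :
    killZero (∏ h ∈ s, h • b) = ∏ h ∈ s, h • b := by
  simp_rw [map_prod, A.killZero_smul, hb]

end

theorem nonempty_invariantParamSystem [Finite H] : Nonempty (InvariantParamSystem A) := by
  classical
  have := Fintype.ofFinite H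
  have hX : killZero (X 1 : MvPolynomial (Fin 3) F) = X 1 := by simp [killZero]
  obtain ⟨df, hdf⟩ := A.exists_isHomogeneous_prod_erase (isHomogeneous_X F 1)
  obtain ⟨r, hr⟩ := A.exists_isHomogeneous_prod_erase A.form_hom
  have hcard : Nat.card H - 1 + 1 = Nat.card H := Nat.sub_add_cancel Nat.card_pos
  exact ⟨{
    f := ∏ h : H, h • (X 1 : MvPolynomial (Fin 3) F)
    g := ∏ h : H, h • A.form
    u := ∏ h ∈ Finset.univ.erase (1 : H), h • (X 1 : MvPolynomial (Fin 3) F)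
    v := (∏ h ∈ Finset.univ.erase (1 : H), h • A.form) *
      ∏ h : H, (X 1 + C (A.c h 0 1 / A.c h 0 0) * X 2)
    w := (∏ h ∈ Finset.univ.erase (1 : H), h • A.form) * X 2 ^ Fintype.card H
    N := Nat.card H - 1
    df := df
    dg := r + Fintype.card H
    hf := prod_smul_eq _
    hg := by rw [prod_smul_eq]; nth_rewrite 2 [form]; ring
    hu_hom := hdf
    hv_hom := hr.mul A.prod_linear_hom
    hw_hom := hr.mul (isHomogeneous_X_pow _ _)
    killZero_u := A.killZero_prod_smul hX _
    killZero_v := by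
      rw [map_mul, A.killZero_prod_smul A.killZero_form]
      congr 1
      simp only [map_add, map_mul, map_prod]
      simp [killZero]
    killZero_w := by
      rw [map_mul, A.killZero_prod_smul A.killZero_form]
      simp [killZero]
    relPrime := A.isRelPrime_prod
    f_ne := prod_smul_X_ne_zero
    exists_pow_le := A.exists_pow_le _
    smul_f := fun h => Finset.smul_prod_perm _ h
    smul_g := fun h => Finset.smul_prod_perm _ h
    χ_pow := fun h => by rw [hcard, A.χ_pow_card] }⟩

end PlaneAction

end

section
variable {F : Type u} [Field F] {H : Type*} [Group H]
    [MulSemiringAction H (MvPolynomial (Fin 3) F)] [SMulCommClass H F (MvPolynomial (Fin 3) F)]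

variable (F H) in
/-- The ring of invariants of `F[X₀, X₁, X₂]`. -/
abbrev PolyFix : Subalgebra F (MvPolynomial (Fin 3) F) :=
  FixedPoints.subalgebra F (MvPolynomial (Fin 3) F) H

theorem smul_coe_fix (h : H) (r : PolyFix F H) : h • (r : MvPolynomial (Fin 3) F) = r := r.2 h

section
variable [Fintype H]

/-- The average of `b` with respect to the weights `w`. -/
def twist (w : H → F) (b : MvPolynomial (Fin 3) F) : MvPolynomial (Fin 3) F :=
  C (Fintype.card H : F)⁻¹ * ∑ h : H, C (w h) * h • b

omit [SMulCommClass H F (MvPolynomial (Fin 3) F)] in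
theorem twist_add (w : H → F) (a b : MvPolynomial (Fin 3) F) :
    twist w (a + b) = twist w a + twist w b := by
  simp only [twist, smul_add, mul_add, Finset.sum_add_distrib]

omit [SMulCommClass H F (MvPolynomial (Fin 3) F)] in
theorem twist_mul_of_fixed (w : H → F) {a b : MvPolynomial (Fin 3) F} (hb : ∀ h : H, h • b = b) :
    twist w (a * b) = twist w a * b := by
  simp only [twist, smul_mul', hb, mul_assoc, Finset.sum_mul]

omit [SMulCommClass H F (MvPolynomial (Fin 3) F)] in
theorem twist_eq_self (hcard : (Fintype.card H : F) ≠ 0) (w : H → F) {b : MvPolynomial (Fin 3) F}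
    (hb : ∀ h : H, C (w h) * h • b = b) : twist w b = b := by
  simp only [twist, hb, Finset.sum_const, Finset.card_univ, nsmul_eq_mul]
  rw [← mul_assoc, ← map_natCast (C : F →+* MvPolynomial (Fin 3) F), ← C_mul,
    inv_mul_cancel₀ hcard, C_1, one_mul]

theorem smul_twist (w : H → F) (hw : ∀ g h, w (g * h) = w g * w h) (g : H)
    (b : MvPolynomial (Fin 3) F) : C (w g) * g • twist w b = twist w b := by
  simp only [twist, smul_mul', Finset.smul_sum, PlaneAction.smul_C]
  rw [mul_left_comm, Finset.mul_sum]
  congr 1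
  refine Fintype.sum_equiv (Equiv.mulLeft g) _ _ fun h => ?_
  rw [Equiv.coe_mulLeft, hw, C_mul, mul_smul, mul_assoc]

/-- The Reynolds operator. -/
def reynolds : MvPolynomial (Fin 3) F →ₗ[PolyFix F H] PolyFix F H where
  toFun b := ⟨twist (fun _ : H => (1 : F)) b, fun h => by
    simpa using smul_twist (fun _ : H => (1 : F)) (by simp) h b⟩
  map_add' a b := Subtype.ext (twist_add _ a b)
  map_smul' r b := by
    refine Subtype.ext ?_
    rw [Algebra.smul_def, mul_comm]
    exact (twist_mul_of_fixed _ (smul_coe_fix · r)).trans (mul_comm _ _)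

theorem coe_reynolds (b : MvPolynomial (Fin 3) F) :
    ((reynolds b : PolyFix F H) : MvPolynomial (Fin 3) F) = twist (fun _ : H => (1 : F)) b := rfl

theorem reynolds_coe (hcard : (Fintype.card H : F) ≠ 0) (r : PolyFix F H) :
    reynolds (r : MvPolynomial (Fin 3) F) = r :=
  Subtype.ext (twist_eq_self hcard _ fun h => by simp [smul_coe_fix])

theorem reynolds_mul (r : PolyFix F H) (b : MvPolynomial (Fin 3) F) :
    reynolds (b * (r : MvPolynomial (Fin 3) F)) = (reynolds b * r : PolyFix F H) := by
  have := (reynolds (F := F) (H := H)).map_smul r b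
  rwa [Algebra.smul_def, mul_comm, smul_eq_mul, mul_comm r] at this

theorem reynolds_smul (h : H) (b : MvPolynomial (Fin 3) F) :
    (reynolds (h • b) : PolyFix F H) = reynolds b := by
  refine Subtype.ext ?_
  rw [coe_reynolds, coe_reynolds, twist, twist]
  congr 1
  refine Fintype.sum_equiv (Equiv.mulRight h) _ _ fun g => ?_
  rw [Equiv.coe_mulRight, mul_smul]

end

/-- The ideal of invariants without constant term. -/
def fixMax : Ideal (PolyFix F H) :=
  RingHom.ker ((constantCoeff : MvPolynomial (Fin 3) F →+* F).comp (PolyFix F H).val.toRingHom)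

theorem mem_fixMax (r : PolyFix F H) :
    r ∈ fixMax ↔ constantCoeff (r : MvPolynomial (Fin 3) F) = 0 := Iff.rfl

instance fixMax_isMaximal : (fixMax : Ideal (PolyFix F H)).IsMaximal :=
  RingHom.ker_isMaximal_of_surjective _ fun a => ⟨algebraMap F _ a, by simp⟩

theorem coe_mem_pow_of_mem_fixMax_pow (K : ℕ) {r : PolyFix F H} (hr : r ∈ fixMax ^ K) :
    (r : MvPolynomial (Fin 3) F) ∈ idealOfVars (Fin 3) F ^ K := by
  have hle : fixMax ≤ (idealOfVars (Fin 3) F).comap (PolyFix F H).val.toRingHom := fun r hr =>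
    (mem_idealOfVars_iff _).2 ((mem_fixMax r).1 hr)
  have h₁ := Ideal.pow_right_mono hle K
  exact Ideal.le_comap_pow _ K (h₁ hr)

theorem sub_algebraMap_mem_fixMax (r : PolyFix F H) :
    r - algebraMap F (PolyFix F H) (constantCoeff (r : MvPolynomial (Fin 3) F)) ∈ fixMax := by
  rw [mem_fixMax]
  simp

instance finite_fix [Finite H] : Module.Finite (PolyFix F H) (MvPolynomial (Fin 3) F) := by
  have : Algebra.IsInvariant (PolyFix F H) (MvPolynomial (Fin 3) F) H := ⟨fun b hb => ⟨⟨b, hb⟩, rfl⟩⟩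
  have := Algebra.IsInvariant.isIntegral (PolyFix F H) (MvPolynomial (Fin 3) F) H
  have := Algebra.FiniteType.of_restrictScalars_finiteType F (PolyFix F H) (MvPolynomial (Fin 3) F)
  exact Algebra.IsIntegral.finite

instance isNoetherianRing_fix [Finite H] : IsNoetherianRing (PolyFix F H) := by
  have : Algebra.FiniteType F (PolyFix F H) := ⟨fg_of_fg_of_fg F (PolyFix F H) (MvPolynomial (Fin 3) F)
    Algebra.FiniteType.out Module.Finite.fg_top Subtype.val_injective⟩
  exact Algebra.FiniteType.isNoetherianRing F _

namespace InvariantParamSystem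

variable {A : PlaneAction F H} (P : InvariantParamSystem A)

/-- The invariant `f`. -/
def θ₁ : PolyFix F H := ⟨P.f, P.smul_f⟩
/-- The invariant `g`. -/
def θ₂ : PolyFix F H := ⟨P.g, P.smul_g⟩
/-- The invariant `X₀ ^ (N + 1)`. -/
def θ₃ : PolyFix F H := ⟨X 0 ^ (P.N + 1), P.smul_X_pow⟩

/-- The ideal generated by the three parameters. -/
def J : Ideal (PolyFix F H) :=
  ⊥ ⊔ Ideal.span {P.θ₁} ⊔ Ideal.span {P.θ₂} ⊔ Ideal.span {P.θ₃}

variable [Fintype H]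

theorem mem_bot_sup_iff (hcard : (Fintype.card H : F) ≠ 0) (a : PolyFix F H) :
    a ∈ ⊥ ⊔ Ideal.span {P.θ₁} ↔ (a : MvPolynomial (Fin 3) F) ∈ ⊥ ⊔ Ideal.span {P.f} := by
  simp only [bot_sup_eq, Ideal.mem_span_singleton']
  constructor
  · rintro ⟨p, rfl⟩
    exact ⟨p, rfl⟩
  · rintro ⟨p, hp⟩
    refine ⟨reynolds p, ?_⟩
    rw [← reynolds_mul, ← reynolds_coe hcard a, ← hp]
    rfl

theorem mem_sup_sup_iff (hcard : (Fintype.card H : F) ≠ 0) (a : PolyFix F H) :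
    a ∈ ⊥ ⊔ Ideal.span {P.θ₁} ⊔ Ideal.span {P.θ₂} ↔ (a : MvPolynomial (Fin 3) F) ∈ P.I₂ := by
  rw [P.mem_I₂, bot_sup_eq, ← Ideal.span_insert, Ideal.mem_span_pair]
  constructor
  · rintro ⟨p, q, rfl⟩
    exact ⟨p, q, rfl⟩
  · rintro ⟨p, q, hp⟩
    refine ⟨reynolds p, reynolds q, ?_⟩
    rw [← reynolds_mul, ← reynolds_mul, ← map_add, ← reynolds_coe hcard a, ← hp]
    rfl

theorem mem_J_iff (hcard : (Fintype.card H : F) ≠ 0) (a : PolyFix F H) :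
    a ∈ P.J ↔ (a : MvPolynomial (Fin 3) F) ∈ P.I := by
  rw [P.mem_I, J, bot_sup_eq, ← Ideal.span_insert, Submodule.mem_sup]
  simp only [Ideal.mem_span_pair, Ideal.mem_span_singleton']
  constructor
  · rintro ⟨_, ⟨p, q, rfl⟩, _, ⟨r, rfl⟩, rfl⟩
    exact ⟨p, q, r, rfl⟩
  · rintro ⟨p, q, r, hp⟩
    refine ⟨_, ⟨reynolds p, reynolds q, rfl⟩, _, ⟨reynolds r, rfl⟩, ?_⟩
    rw [← reynolds_mul, ← reynolds_mul, ← reynolds_mul, ← map_add, ← map_add,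
      ← reynolds_coe hcard a, ← hp]
    rfl

theorem exists_fixMax_pow_le (hcard : (Fintype.card H : F) ≠ 0) : ∃ K, fixMax ^ K ≤ P.J := by
  obtain ⟨K, hK⟩ := P.exists_pow_le_I
  exact ⟨K, fun r hr => (P.mem_J_iff hcard r).2 (hK (coe_mem_pow_of_mem_fixMax_pow K hr))⟩

theorem J_ne_top (hcard : (Fintype.card H : F) ≠ 0) : P.J ≠ ⊤ := by
  rw [Ne, Ideal.eq_top_iff_one, P.mem_J_iff hcard]
  exact fun h => P.I_ne_top ((Ideal.eq_top_iff_one _).2 h)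

omit [Fintype H] in
theorem J_le : P.J ≤ fixMax := by
  rw [J]
  simp only [sup_le_iff, bot_le, Ideal.span_singleton_le_iff_mem, mem_fixMax, true_and]
  exact ⟨⟨constantCoeff_eq_zero_of_isHomogeneous P.f_hom (by omega),
    constantCoeff_eq_zero_of_isHomogeneous P.g_hom (by omega)⟩, by simp [θ₃]⟩

theorem finite_quotient_J (hcard : (Fintype.card H : F) ≠ 0) :
    Module.Finite F (PolyFix F H ⧸ P.J) := by
  have hker : ∀ a ∈ P.J, ((Ideal.Quotient.mkₐ F P.I).comp (PolyFix F H).val) a = 0 := fun a ha =>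
    Ideal.Quotient.eq_zero_iff_mem.2 ((P.mem_J_iff hcard a).1 ha)
  refine Module.Finite.of_injective (Ideal.Quotient.liftₐ P.J _ hker).toLinearMap ?_
  refine (injective_iff_map_eq_zero (Ideal.Quotient.liftₐ P.J _ hker)).2 fun a ha => ?_
  obtain ⟨a, rfl⟩ := Ideal.Quotient.mk_surjective a
  exact Ideal.Quotient.eq_zero_iff_mem.2 ((P.mem_J_iff hcard a).2
    (Ideal.Quotient.eq_zero_iff_mem.1 ha))

/-- If the ring of invariants is Gorenstein, then its quotient by the parameters admits a
nondegenerate functional. -/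
theorem exists_nondegenerate_functional (hcard : (Fintype.card H : F) ≠ 0)
    (hR : IsGorensteinRing (PolyFix F H)) : ∃ l : PolyFix F H →ₗ[F] F, (∀ b ∈ P.J, l b = 0) ∧
      ∀ z, (∀ b, l (z * b) = 0) → z ∈ P.J := by
  obtain ⟨K, hK⟩ := P.exists_fixMax_pow_le hcard
  obtain ⟨s, hs, hsa⟩ := exists_socle_of_pow_le K hK (P.J_ne_top hcard)
  have hsoc : ∀ t, (∀ a ∈ fixMax, t * a ∈ P.J) → ∃ c : F, t - algebraMap F _ c * s ∈ P.J := by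
    intro t ht
    obtain ⟨r, hr⟩ := exists_sub_mul_mem_of_isGorensteinRing hR fixMax rfl rfl rfl
      (fun a => by
        have := P.regular_f a
        simp only [Submodule.mem_bot] at this ⊢
        rw [← Subtype.coe_inj, ← Subtype.coe_inj]
        exact this)
      (fun a => by
        rw [P.mem_bot_sup_iff hcard, P.mem_bot_sup_iff hcard]
        exact P.regular_g a)
      (fun a => by
        rw [P.mem_sup_sup_iff hcard, P.mem_sup_sup_iff hcard]
        exact P.regular_X.pow (P.N + 1) a) K hK s t hs hsa ht
    refine ⟨constantCoeff (r : MvPolynomial (Fin 3) F), ?_⟩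
    have := P.J.add_mem hr (hsa _ (sub_algebraMap_mem_fixMax r))
    convert this using 1
    ring
  obtain ⟨l, h₁, h₂⟩ := Submodule.exists_le_ker_of_notMem (p := P.J.restrictScalars F)
    (v := s) hs
  refine ⟨l, fun b hb => h₂ hb, fun z hz => ?_⟩
  by_contra hzJ
  let J' : Ideal (PolyFix F H) := P.J.colon {z}
  have hJ' : ∀ y, y ∈ J' ↔ z * y ∈ P.J := fun y => by
    rw [Submodule.mem_colon_singleton, smul_eq_mul, mul_comm]
  obtain ⟨y, hy, hya⟩ := exists_socle_of_pow_le (J := J') K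
    (fun x hx => (hJ' x).2 (Ideal.mul_mem_left _ _ (hK hx)))
    (fun h => hzJ (by simpa using (hJ' 1).1 (h ▸ Submodule.mem_top)))
  rw [hJ'] at hy
  obtain ⟨c, hc⟩ := hsoc (z * y) fun a ha => by
    rw [mul_assoc]
    exact (hJ' _).1 (hya _ ha)
  have : l (z * y - algebraMap F _ c * s) = 0 := h₂ hc
  rw [map_sub, hz, zero_sub, neg_eq_zero, ← Algebra.smul_def, map_smul, smul_eq_mul,
    mul_eq_zero, or_iff_left h₁] at this
  rw [this, map_zero, zero_mul, sub_zero] at hc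
  exact hy hc

end InvariantParamSystem

end

section
variable {F : Type u} [Field F]

theorem exists_prime_dvd_of_constantCoeff_eq_zero (f : MvPolynomial (Fin 3) F)
    (hf : constantCoeff f = 0) : ∃ π, Prime π ∧ constantCoeff π = 0 ∧ π ∣ f := by
  induction f using UniqueFactorizationMonoid.induction_on_prime with
  | h₁ => exact ⟨X 0, X_prime, by simp, dvd_zero _⟩
  | h₂ x hx => exact absurd hf (hx.map constantCoeff).ne_zero
  | h₃ a p ha hp ih =>
    rw [map_mul, mul_eq_zero] at hf
    rcases hf with hf | hf
    · exact ⟨p, hp, hf, dvd_mul_right _ _⟩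
    · obtain ⟨π, h₁, h₂, h₃⟩ := ih hf
      exact ⟨π, h₁, h₂, h₃.mul_left _⟩

variable {H : Type*} [Group H]
    [MulSemiringAction H (MvPolynomial (Fin 3) F)] [SMulCommClass H F (MvPolynomial (Fin 3) F)]

omit [SMulCommClass H F (MvPolynomial (Fin 3) F)] in
/-- If a weighted sum of the conjugates of any element is divisible by a prime `π`, then
two elements of the group become congruent modulo `π`. -/
theorem exists_ne_forall_dvd_of_dvd_sum [Fintype H] (π : MvPolynomial (Fin 3) F) (hπ : Prime π)
    (hπ₀ : constantCoeff π = 0) (w : H → F) (hw : w 1 ≠ 0)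
    (h : ∀ b, π ∣ ∑ h : H, C (w h) * h • b) :
    ∃ h₁ h₂ : H, h₁ ≠ h₂ ∧ ∀ b : MvPolynomial (Fin 3) F, π ∣ h₁ • b - h₂ • b := by
  have hprime : (Ideal.span {π}).IsPrime := (Ideal.span_singleton_prime hπ.ne_zero).2 hπ
  let mk := Ideal.Quotient.mk (Ideal.span {π})
  have hmk : ∀ b, mk b = 0 ↔ π ∣ b := fun b => by
    rw [Ideal.Quotient.eq_zero_iff_mem, Ideal.mem_span_singleton]
  let φ : H → (MvPolynomial (Fin 3) F →* MvPolynomial (Fin 3) F ⧸ Ideal.span {π}) := fun h =>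
    (mk.comp (MulSemiringAction.toRingHom H (MvPolynomial (Fin 3) F) h) : _ →+* _)
  by_contra! hne
  have hφ : Function.Injective φ := by
    intro h₁ h₂ h₁₂
    by_contra hh
    obtain ⟨b, hb⟩ := hne h₁ h₂ hh
    refine hb ((hmk _).1 ?_)
    rw [map_sub, sub_eq_zero]
    exact DFunLike.congr_fun h₁₂ b
  have hli := (linearIndependent_monoidHom (MvPolynomial (Fin 3) F)
    (MvPolynomial (Fin 3) F ⧸ Ideal.span {π})).comp φ hφ
  rw [Fintype.linearIndependent_iff] at hli
  have h₁ := hli (fun h => mk (C (w h))) (by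
    ext b
    rw [Finset.sum_apply, Pi.zero_apply, ← (hmk _).2 (h b), map_sum]
    simp only [Pi.smul_apply, smul_eq_mul, map_mul]
    rfl) 1
  rw [hmk] at h₁
  obtain ⟨c, hc⟩ := h₁
  have := congrArg constantCoeff hc
  rw [map_mul, hπ₀, zero_mul, constantCoeff_C] at this
  exact hw this

namespace InvariantParamSystem

variable {A : PlaneAction F H} (P : InvariantParamSystem A)

theorem κ_inv_mul (h : H) : P.κ h⁻¹ * P.κ h = 1 := by
  rw [← P.κ_mul, inv_mul_cancel, P.κ_one]

theorem κ_eq_one_of_isGorensteinRing [Fintype H] (hcard : (Fintype.card H : F) ≠ 0)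
    (hrefl : ∀ (h : H) (π : MvPolynomial (Fin 3) F), Prime π → (∀ b, π ∣ h • b - b) → h = 1)
    (hR : IsGorensteinRing (PolyFix F H)) (h : H) : P.κ h = 1 := by
  obtain ⟨l, hl, hnd⟩ := P.exists_nondegenerate_functional hcard hR
  have := P.finite_quotient_J hcard
  obtain ⟨q, hq⟩ := exists_eq_mul_of_nondegenerate P.I P.functional
    (fun b hb => P.functional_of_mem hb) (fun z hz => P.mem_I_of_functional_eq_zero hz)
    (l ∘ₗ (reynolds (F := F) (H := H)).restrictScalars F) fun b hb => by
      refine hl _ ((P.mem_J_iff hcard _).2 ?_)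
      change ((reynolds b : PolyFix F H) : MvPolynomial (Fin 3) F) ∈ P.I
      rw [coe_reynolds, twist]
      exact P.I.mul_mem_left _ (P.I.sum_mem fun h _ => P.I.mul_mem_left _ (P.smul_mem_I h hb))
  replace hq : ∀ b, l (reynolds b) = P.functional (q * b) := hq
  let w : H → F := fun h => P.κ h⁻¹
  have hw : ∀ g h, w (g * h) = w g * w h := fun g h => by
    simp only [w]
    rw [_root_.mul_inv_rev, P.κ_mul, mul_comm]
  set f₀ := twist w q with hf₀
  have hf₀l : ∀ b, l (reynolds b) = P.functional (f₀ * b) := by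
    intro b
    have h₁ : ∀ h : H, P.functional (C (w h) * h • q * b) = l (reynolds b) := by
      intro h
      have h₂ : C (w h) * h • q * b = C (w h) * h • (q * h⁻¹ • b) := by
        rw [smul_mul', smul_inv_smul, mul_assoc]
      rw [h₂, P.functional_C_mul, P.functional_smul, ← mul_assoc, P.κ_inv_mul, one_mul, ← hq,
        reynolds_smul]
    rw [hf₀, twist, mul_assoc, P.functional_C_mul, Finset.sum_mul, map_sum]
    simp only [h₁, Finset.sum_const, Finset.card_univ, nsmul_eq_mul]
    rw [← mul_assoc, inv_mul_cancel₀ hcard, one_mul]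
  -- the semi-invariants of weight `κ`
  let M : Submodule (PolyFix F H) (MvPolynomial (Fin 3) F) :=
    { carrier := {b | ∀ h : H, C (w h) * h • b = b}
      add_mem' := fun {a b} ha hb h => by rw [smul_add, mul_add, ha h, hb h]
      zero_mem' := fun h => by rw [smul_zero, mul_zero]
      smul_mem' := fun r b hb h => by
        rw [Algebra.smul_def, smul_mul']
        change C (w h) * (h • (r : MvPolynomial (Fin 3) F) * h • b) = _
        rw [smul_coe_fix, mul_left_comm, hb h]
        rfl }
  have hM : ∀ b, b ∈ M ↔ ∀ h : H, C (w h) * h • b = b := fun b => Iff.rfl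
  have htM : ∀ b, twist w b ∈ M := fun b => (hM _).2 fun h => smul_twist w hw h b
  have hMI : ∀ z ∈ M, z ∈ P.I → z ∈ P.J • M := by
    intro z hz hzI
    obtain ⟨a, b, c, h₁⟩ := P.mem_I.1 hzI
    rw [← twist_eq_self hcard w ((hM z).1 hz), ← h₁, twist_add, twist_add,
      twist_mul_of_fixed w P.smul_f, twist_mul_of_fixed w P.smul_g,
      twist_mul_of_fixed w P.smul_X_pow, mul_comm _ P.f, mul_comm _ P.g, mul_comm _ (X 0 ^ _)]
    refine add_mem (add_mem ?_ ?_) ?_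
    · exact Submodule.smul_mem_smul (r := P.θ₁) ((P.mem_J_iff hcard _).2 P.f_mem) (htM a)
    · exact Submodule.smul_mem_smul (r := P.θ₂) ((P.mem_J_iff hcard _).2 P.g_mem) (htM b)
    · exact Submodule.smul_mem_smul (r := P.θ₃) ((P.mem_J_iff hcard _).2 P.X_pow_mem) (htM c)
  have hle : M ≤ Submodule.span (PolyFix F H) {f₀} ⊔ P.J • M := by
    intro b hb
    obtain ⟨r, hr⟩ := exists_eq_mul_of_nondegenerate P.J l hl hnd
      (P.functional ∘ₗ LinearMap.mulLeft F b ∘ₗ (PolyFix F H).val.toLinearMap) fun x hx =>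
        P.functional_of_mem (P.I.mul_mem_left _ ((P.mem_J_iff hcard x).1 hx))
    replace hr : ∀ x : PolyFix F H, P.functional (b * x) = l (r * x) := hr
    have hz : b - r • f₀ ∈ M := M.sub_mem hb (M.smul_mem _ (htM q))
    have hzI : b - r • f₀ ∈ P.I := by
      refine P.mem_I_of_functional_eq_zero fun y => ?_
      have h₁ : ∀ h : H, P.functional ((b - r • f₀) * h • y) =
          P.functional ((b - r • f₀) * y) := by
        intro h
        have h₂ : (b - r • f₀) * h • y = C (w h) * h • ((b - r • f₀) * y) := by
          conv_lhs => rw [← (hM _).1 hz h]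
          rw [smul_mul', mul_assoc]
        rw [h₂, P.functional_C_mul, P.functional_smul, ← mul_assoc, P.κ_inv_mul, one_mul]
      have h₃ : P.functional ((b - r • f₀) * (reynolds y : PolyFix F H)) =
          P.functional ((b - r • f₀) * y) := by
        rw [coe_reynolds, twist, mul_left_comm, P.functional_C_mul, Finset.mul_sum, map_sum]
        simp only [C_1, one_mul, h₁, Finset.sum_const, Finset.card_univ, nsmul_eq_mul]
        rw [← mul_assoc, inv_mul_cancel₀ hcard, one_mul]
      rw [← h₃, sub_mul, map_sub, hr, sub_eq_zero]
      have h₄ : r • f₀ * (reynolds y : PolyFix F H) =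
          f₀ * ((r * reynolds y : PolyFix F H) : MvPolynomial (Fin 3) F) := by
        rw [Algebra.smul_def]
        change (r : MvPolynomial (Fin 3) F) * f₀ * _ = f₀ * (r * _)
        ring
      rw [h₄, ← hf₀l, reynolds_coe hcard]
    rw [← sub_add_cancel b (r • f₀), add_comm]
    exact Submodule.add_mem_sup (Submodule.smul_mem _ _ (Submodule.mem_span_singleton_self _))
      (hMI _ hz hzI)
  obtain ⟨r, hrJ, hrM⟩ := Submodule.exists_sub_one_mem_and_smul_le_of_fg_of_le_sup
    (IsNoetherian.noetherian M) le_rfl hle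
  have hr₁ : constantCoeff (r : MvPolynomial (Fin 3) F) = 1 := by
    have := (mem_fixMax _).1 (P.J_le hrJ)
    simpa [sub_eq_zero] using this
  by_cases hf : constantCoeff f₀ = 0
  · obtain ⟨π, hπ, hπ₀, hπf⟩ := exists_prime_dvd_of_constantCoeff_eq_zero f₀ hf
    obtain ⟨h₁, h₂, hne, hh⟩ := exists_ne_forall_dvd_of_dvd_sum π hπ hπ₀ w
      (by simp [w, P.κ_one]) fun b => by
        have h₃ : C (Fintype.card H : F) * twist w b = ∑ h : H, C (w h) * h • b := by
          rw [twist, ← mul_assoc, ← C_mul, mul_inv_cancel₀ hcard, C_1, one_mul]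
        rw [← h₃]
        refine Dvd.dvd.mul_left ?_ _
        have h₄ := hrM (Submodule.smul_mem_pointwise_smul _ r M (htM b))
        obtain ⟨r', hr'⟩ := Submodule.mem_span_singleton.1 h₄
        have h₅ : π ∣ (r : MvPolynomial (Fin 3) F) * twist w b := by
          change π ∣ r • twist w b
          rw [← hr', Algebra.smul_def]
          exact hπf.mul_left _
        refine (hπ.dvd_or_dvd h₅).resolve_left fun h₆ => ?_
        obtain ⟨c, hc⟩ := h₆
        rw [hc, map_mul, hπ₀, zero_mul] at hr₁
        exact zero_ne_one hr₁
    refine absurd (hrefl (h₂⁻¹ * h₁) (h₂⁻¹ • π)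
      ((MulEquiv.prime_iff (MulSemiringAction.toRingEquiv H (MvPolynomial (Fin 3) F) h₂⁻¹)).2 hπ)
      fun b => ?_) (fun h₃ => hne (inv_mul_eq_one.1 h₃).symm)
    have h₃ := map_dvd (MulSemiringAction.toRingEquiv H (MvPolynomial (Fin 3) F) h₂⁻¹) (hh b)
    simpa [smul_sub, mul_smul] using h₃
  · have h₁ := congrArg constantCoeff ((hM _).1 (htM q) h⁻¹)
    rw [map_mul, constantCoeff_C, A.constantCoeff_smul] at h₁
    have h₂ := mul_right_cancel₀ hf (h₁.trans (one_mul _).symm)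
    simpa [w] using h₂

end InvariantParamSystem

end

section
variable {F : Type u} [Field F]

theorem exists_homogeneousComponent_mul {f : MvPolynomial (Fin 3) F} {k : ℕ}
    (hf : f.IsHomogeneous k) (p : MvPolynomial (Fin 3) F) (d : ℕ) :
    ∃ p' : MvPolynomial (Fin 3) F, homogeneousComponent d (p * f) = p' * f ∧
      (p' = 0 ∨ k ≤ d ∧ p'.IsHomogeneous (d - k)) := by
  have key : ∀ j, homogeneousComponent d (homogeneousComponent j p * f) =
      if j + k = d then homogeneousComponent j p * f else 0 := fun j => by
    rw [homogeneousComponent_of_mem ((mem_homogeneousSubmodule _ _).2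
      ((homogeneousComponent_isHomogeneous j p).mul hf))]
    simp only [eq_comm]
  have h₁ : homogeneousComponent d (p * f) = ∑ j ∈ Finset.range (p.totalDegree + 1),
      if j + k = d then homogeneousComponent j p * f else 0 := by
    conv_lhs => rw [← sum_homogeneousComponent p, Finset.sum_mul, map_sum]
    simp only [key]
  by_cases hk : k ≤ d
  · refine ⟨∑ j ∈ Finset.range (p.totalDegree + 1),
      if j + k = d then homogeneousComponent j p else 0, ?_, .inr ⟨hk, ?_⟩⟩
    · rw [h₁, Finset.sum_mul]
      simp only [ite_mul, zero_mul]
    · refine IsHomogeneous.sum _ _ _ fun j _ => ?_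
      split_ifs with h
      · rw [← h, Nat.add_sub_cancel]
        exact homogeneousComponent_isHomogeneous j p
      · exact isHomogeneous_zero _ _ _
  · refine ⟨0, ?_, .inl rfl⟩
    rw [h₁, zero_mul]
    exact Finset.sum_eq_zero fun j _ => if_neg (by omega)

/-- If a family is linearly independent modulo `J + (x)` over `A`, and `x` is regular modulo
`J`, then it is linearly independent modulo `J` over `A[x]`. -/
theorem eq_zero_of_sum_mem_of_isRegularMod {A B ι : Type*} [CommRing A] [CommRing B] [Fintype ι]
    (φ : A →+* B) (e : ι → B) {J : Ideal B} {x : B} (hx : IsRegularMod J x)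
    (φ' : Polynomial A →+* B) (hφ : φ' = Polynomial.eval₂RingHom φ x)
    (h : ∀ c : ι → A, ∑ i, φ (c i) * e i ∈ J ⊔ Ideal.span {x} → c = 0)
    (c : ι → Polynomial A) (hc : ∑ i, φ' (c i) * e i ∈ J) : c = 0 := by
  subst hφ
  change ∑ i, Polynomial.eval₂ φ x (c i) * e i ∈ J at hc
  suffices ∀ (n : ℕ) (c : ι → Polynomial A), (∀ i, (c i).natDegree < n) →
      ∑ i, Polynomial.eval₂ φ x (c i) * e i ∈ J → c = 0 by
    refine this (Finset.univ.sup (fun i => (c i).natDegree) + 1) c (fun i => ?_) hc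
    exact Nat.lt_succ_of_le (Finset.le_sup (f := fun i => (c i).natDegree) (Finset.mem_univ i))
  intro n
  induction n with
  | zero =>
    intro c h₁ _
    funext i
    exact absurd (h₁ i) (by omega)
  | succ n ih =>
    intro c h₁ h₂
    have h₃ : ∑ i, Polynomial.eval₂ φ x (c i) * e i =
        x * (∑ i, Polynomial.eval₂ φ x (c i).divX * e i) + ∑ i, φ ((c i).coeff 0) * e i := by
      rw [Finset.mul_sum, ← Finset.sum_add_distrib]
      refine Finset.sum_congr rfl fun i _ => ?_
      conv_lhs => rw [← Polynomial.divX_mul_X_add (c i)]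
      rw [Polynomial.eval₂_add, Polynomial.eval₂_C, Polynomial.eval₂_mul_X]
      ring
    have h₄ := h (fun i => (c i).coeff 0) (by
      have h₅ := (J ⊔ Ideal.span {x}).sub_mem (Ideal.mem_sup_left h₂) (Ideal.mem_sup_right
        ((Ideal.mem_span_singleton.2 (dvd_mul_right x
          (∑ i, Polynomial.eval₂ φ x (c i).divX * e i)))))
      rwa [h₃, add_sub_cancel_left] at h₅)
    have h₅ : ∀ i, (c i).coeff 0 = 0 := congrFun h₄
    simp only [h₅, map_zero, zero_mul, Finset.sum_const_zero, add_zero] at h₃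
    rw [h₃] at h₂
    have hdiv : ∀ i, c i = (c i).divX * Polynomial.X := fun i => by
      conv_lhs => rw [← Polynomial.divX_mul_X_add (c i), h₅, Polynomial.C_0, add_zero]
    by_cases hn : n = 0
    · subst hn
      funext i
      rw [Polynomial.eq_C_of_natDegree_eq_zero (Nat.lt_one_iff.1 (h₁ i)), h₅, Polynomial.C_0]
      rfl
    · have h₆ := ih (fun i => (c i).divX) (fun i => by
        rw [Polynomial.natDegree_divX_eq_natDegree_tsub_one]
        have := h₁ i
        omega) ((hx _).2 h₂)
      funext i
      rw [hdiv i, congrFun h₆ i]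
      simp

namespace ParamSystem
variable (P : ParamSystem F)

theorem exists_homogeneous_basis : ∃ (n : ℕ) (e : Fin n → MvPolynomial (Fin 3) F) (δ : Fin n → ℕ),
    (∀ i, (e i).IsHomogeneous (δ i)) ∧ (∀ c : Fin n → F, ∑ i, C (c i) * e i ∈ P.I → c = 0) ∧
      ∀ b, ∃ c : Fin n → F, b - ∑ i, C (c i) * e i ∈ P.I := by
  let mk : MvPolynomial (Fin 3) F →ₗ[F] MvPolynomial (Fin 3) F ⧸ P.I :=
    (Ideal.Quotient.mkₐ F P.I).toLinearMap
  have hmk : ∀ b, mk b = 0 ↔ b ∈ P.I := fun b => Ideal.Quotient.eq_zero_iff_mem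
  obtain ⟨κ, a, ha, hspan, hli⟩ := exists_linearIndependent' F
    (fun m : Fin 3 →₀ ℕ => mk (monomial m 1))
  have : Finite κ := hli.finite
  obtain ⟨n, ⟨ε⟩⟩ := Finite.exists_equiv_fin κ
  replace ε := ε.symm
  have hmk' : ∀ c : Fin n → F, mk (∑ i, C (c i) * monomial (a (ε i)) 1) =
      ∑ i, c i • mk (monomial (a (ε i)) 1) := fun c => by
    rw [map_sum]
    exact Finset.sum_congr rfl fun i _ => by rw [← smul_eq_C_mul, map_smul]
  refine ⟨n, fun i => monomial (a (ε i)) 1, fun i => (a (ε i)).degree,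
    fun i => isHomogeneous_monomial _ rfl, fun c hc => ?_, fun b => ?_⟩
  · rw [← hmk, hmk'] at hc
    exact funext (Fintype.linearIndependent_iff.1 (hli.comp ε ε.injective) c hc)
  · have h₁ : mk b ∈ Submodule.span F (Set.range fun m : Fin 3 →₀ ℕ => mk (monomial m 1)) := by
      rw [b.as_sum, map_sum]
      refine Submodule.sum_mem _ fun m _ => ?_
      rw [← mul_one (coeff m b), ← smul_eq_mul, ← smul_monomial, map_smul]
      exact Submodule.smul_mem _ _ (Submodule.subset_span ⟨m, rfl⟩)
    rw [← hspan, ← ε.surjective.range_comp, Submodule.mem_span_range_iff_exists_fun] at h₁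
    obtain ⟨c, hc⟩ := h₁
    refine ⟨c, (hmk _).1 ?_⟩
    rw [map_sub, hmk', sub_eq_zero, ← hc]
    rfl

/-- The polynomial subring generated by the parameters. -/
def paramMap : Polynomial (Polynomial (Polynomial F)) →+* MvPolynomial (Fin 3) F :=
  Polynomial.eval₂RingHom (Polynomial.eval₂RingHom (Polynomial.eval₂RingHom C (X 0 ^ (P.N + 1)))
    P.g) P.f

/-- The constant term. -/
def augmentation : Polynomial (Polynomial (Polynomial F)) →+* F :=
  (Polynomial.constantCoeff.comp Polynomial.constantCoeff).comp Polynomial.constantCoeff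

/-- The constants. -/
def constants : F →+* Polynomial (Polynomial (Polynomial F)) :=
  (Polynomial.C.comp Polynomial.C).comp Polynomial.C

theorem augmentation_constants (a : F) : augmentation (constants a) = a := by
  simp [augmentation, constants]

theorem paramMap_constants (a : F) : P.paramMap (constants a) = C a := by
  simp [paramMap, constants]

theorem paramMap_X : P.paramMap Polynomial.X = P.f := by simp [paramMap]
theorem paramMap_C_X : P.paramMap (Polynomial.C Polynomial.X) = P.g := by simp [paramMap]
theorem paramMap_C_C_X :
    P.paramMap (Polynomial.C (Polynomial.C Polynomial.X)) = X 0 ^ (P.N + 1) := by simp [paramMap]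

theorem constantCoeff_paramMap (a : Polynomial (Polynomial (Polynomial F))) :
    constantCoeff (P.paramMap a) = augmentation a := by
  have : (constantCoeff : MvPolynomial (Fin 3) F →+* F).comp P.paramMap = augmentation := by
    refine Polynomial.ringHom_ext' (Polynomial.ringHom_ext' (Polynomial.ringHom_ext' ?_ ?_) ?_) ?_
    · ext; simp [paramMap, augmentation]
    · simp [paramMap, augmentation]
    · simpa [paramMap, augmentation] using
        constantCoeff_eq_zero_of_isHomogeneous P.g_hom (by omega)
    · simpa [paramMap, augmentation] using
        constantCoeff_eq_zero_of_isHomogeneous P.f_hom (by omega)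
  exact RingHom.congr_fun this a

theorem eq_zero_of_sum_paramMap_eq_zero {n : ℕ} {e : Fin n → MvPolynomial (Fin 3) F}
    (h : ∀ c : Fin n → F, ∑ i, C (c i) * e i ∈ P.I → c = 0)
    (c : Fin n → Polynomial (Polynomial (Polynomial F))) (hc : ∑ i, P.paramMap (c i) * e i = 0) :
    c = 0 := by
  have h₁ := eq_zero_of_sum_mem_of_isRegularMod C e (P.regular_X.pow (P.N + 1)) _ rfl h
  have h₂ := eq_zero_of_sum_mem_of_isRegularMod _ e P.regular_g _ rfl h₁
  have h₃ := eq_zero_of_sum_mem_of_isRegularMod _ e P.regular_f P.paramMap rfl h₂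
  exact h₃ c (by rw [hc]; exact Submodule.zero_mem _)

theorem paramMap_injective : Function.Injective P.paramMap := by
  refine (injective_iff_map_eq_zero _).2 fun a ha => ?_
  have := P.eq_zero_of_sum_paramMap_eq_zero (n := 1) (e := fun _ => 1) (fun c hc => by
    have h₁ : c 0 = 0 := by
      by_contra hne
      refine P.I_ne_top ((Ideal.eq_top_iff_one _).2 ?_)
      have h₂ := P.I.mul_mem_left (C (c 0)⁻¹) hc
      simpa [← C_mul, inv_mul_cancel₀ hne] using h₂
    funext i
    rw [Subsingleton.elim i 0, h₁]
    rfl) (fun _ => a) (by simpa using ha)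
  exact congrFun this 0

/-- Homogeneous elements are combinations of the basis with homogeneous coefficients. -/
theorem exists_sum_paramMap_eq_of_isHomogeneous {n : ℕ} {e : Fin n → MvPolynomial (Fin 3) F}
    {δ : Fin n → ℕ} (he : ∀ i, (e i).IsHomogeneous (δ i))
    (h : ∀ b, ∃ c : Fin n → F, b - ∑ i, C (c i) * e i ∈ P.I) (d : ℕ) :
    ∀ b : MvPolynomial (Fin 3) F, b.IsHomogeneous d →
      ∃ c : Fin n → Polynomial (Polynomial (Polynomial F)), b = ∑ i, P.paramMap (c i) * e i ∧
        ∀ i, (X 0 ^ δ i * P.paramMap (c i)).IsHomogeneous d := by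
  induction d using Nat.strong_induction_on with
  | h d ih =>
  intro b hb
  obtain ⟨c, hc⟩ := h b
  have hstep : ∀ (t : Polynomial (Polynomial (Polynomial F))) (k : ℕ), 0 < k →
      (P.paramMap t).IsHomogeneous k → ∀ p : MvPolynomial (Fin 3) F,
      ∃ c : Fin n → Polynomial (Polynomial (Polynomial F)),
        homogeneousComponent d (p * P.paramMap t) = ∑ i, P.paramMap (c i) * e i ∧
        ∀ i, (X 0 ^ δ i * P.paramMap (c i)).IsHomogeneous d := by
    intro t k hk ht p
    obtain ⟨p', h₁, h₂⟩ := exists_homogeneousComponent_mul ht p d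
    rcases h₂ with rfl | ⟨hkd, h₂⟩
    · exact ⟨0, by simp [h₁], fun i => by simpa using isHomogeneous_zero _ _ _⟩
    · obtain ⟨c', h₃, h₄⟩ := ih (d - k) (by omega) p' h₂
      refine ⟨fun i => c' i * t, ?_, fun i => ?_⟩
      · rw [h₁, h₃, Finset.sum_mul]
        refine Finset.sum_congr rfl fun i _ => ?_
        rw [map_mul]
        ring
      · have := (h₄ i).mul ht
        rw [map_mul, ← mul_assoc]
        rwa [Nat.sub_add_cancel hkd] at this
  obtain ⟨p, q, r, hpqr⟩ := P.mem_I.1 hc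
  obtain ⟨c₁, h₁, h₁'⟩ := hstep Polynomial.X (P.df + 1) (by omega)
    (by rw [P.paramMap_X]; exact P.f_hom) p
  obtain ⟨c₂, h₂, h₂'⟩ := hstep (Polynomial.C Polynomial.X) (P.dg + 1) (by omega)
    (by rw [P.paramMap_C_X]; exact P.g_hom) q
  obtain ⟨c₃, h₃, h₃'⟩ := hstep (Polynomial.C (Polynomial.C Polynomial.X)) (P.N + 1) (by omega)
    (by rw [P.paramMap_C_C_X]; exact isHomogeneous_X_pow _ _) r
  rw [P.paramMap_X] at h₁
  rw [P.paramMap_C_X] at h₂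
  rw [P.paramMap_C_C_X] at h₃
  refine ⟨fun i => c₁ i + c₂ i + c₃ i + constants (if δ i = d then c i else 0), ?_, fun i => ?_⟩
  · have h₄ := congrArg (homogeneousComponent d) hpqr
    rw [map_sub, homogeneousComponent_of_mem ((mem_homogeneousSubmodule _ _).2 hb), if_pos rfl,
      map_add, map_add, h₁, h₂, h₃, eq_sub_iff_add_eq] at h₄
    rw [← h₄, map_sum, ← Finset.sum_add_distrib, ← Finset.sum_add_distrib,
      ← Finset.sum_add_distrib]
    refine Finset.sum_congr rfl fun i _ => ?_
    rw [homogeneousComponent_C_mul, homogeneousComponent_of_mem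
      ((mem_homogeneousSubmodule _ _).2 (he i)), map_add, map_add, map_add, P.paramMap_constants]
    by_cases hd : δ i = d
    · rw [if_pos hd, if_pos hd.symm]
      ring
    · rw [if_neg hd, if_neg (Ne.symm hd), C_0]
      ring
  · rw [map_add, map_add, map_add, mul_add, mul_add, mul_add, P.paramMap_constants]
    refine (((h₁' i).add (h₂' i)).add (h₃' i)).add ?_
    split_ifs with hd
    · rw [hd]
      simpa using (isHomogeneous_X_pow (R := F) (0 : Fin 3) d).mul (isHomogeneous_C _ (c i))
    · simpa using isHomogeneous_zero _ _ _

end ParamSystem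
end

section

theorem bijective_of_isUnit_det_gram {A B : Type*} [CommRing A] [CommRing B] [Algebra A B] {n : ℕ}
    (b : Module.Basis (Fin n) A B) (Φ : B →ₗ[A] A)
    (h : IsUnit (Matrix.of fun i j => Φ (b i * b j)).det) :
    Function.Bijective fun z : B => Φ ∘ₗ LinearMap.mulLeft A z := by
  set G := Matrix.of fun i j => Φ (b i * b j) with hG
  have key : ∀ (a : Fin n → A) (j : Fin n), Φ ((∑ i, a i • b i) * b j) = (a ᵥ* G) j := by
    intro a j
    rw [Finset.sum_mul, map_sum, Matrix.vecMul, dotProduct]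
    exact Finset.sum_congr rfl fun i _ => by rw [smul_mul_assoc, map_smul, smul_eq_mul]; rfl
  constructor
  · intro z₁ z₂ h₁₂
    have h₁ : ∀ y, Φ ((z₁ - z₂) * y) = 0 := fun y => by
      have := LinearMap.congr_fun h₁₂ y
      simp only [LinearMap.comp_apply, LinearMap.mulLeft_apply] at this
      rw [sub_mul, map_sub, this, sub_self]
    have h₂ : (fun i => b.repr (z₁ - z₂) i) ᵥ* G = 0 := by
      funext j
      rw [← key, b.sum_repr, h₁]
      rfl
    have h₃ := congrArg (· ᵥ* G⁻¹) h₂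
    simp only [Matrix.vecMul_vecMul, Matrix.mul_nonsing_inv G h, Matrix.vecMul_one,
      Matrix.zero_vecMul] at h₃
    rw [← sub_eq_zero, ← b.sum_repr (z₁ - z₂)]
    exact Finset.sum_eq_zero fun i _ => by rw [congrFun h₃ i]; simp
  · intro ψ
    refine ⟨∑ i, ((fun j => ψ (b j)) ᵥ* G⁻¹) i • b i, b.ext fun j => ?_⟩
    rw [LinearMap.comp_apply, LinearMap.mulLeft_apply, key, Matrix.vecMul_vecMul,
      Matrix.nonsing_inv_mul G h, Matrix.vecMul_one]

theorem exists_addMonoidHom_of_basis {T B : Type*} [CommRing T] [CommRing B] {n : ℕ} (φ : T →+* B)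
    (e : Fin n → B) (hli : ∀ c : Fin n → T, ∑ i, φ (c i) * e i = 0 → c = 0)
    (hspan : ∀ b, ∃ c : Fin n → T, b = ∑ i, φ (c i) * e i) (γ : Fin n → T) :
    ∃ Φ : B →+ T, ∀ c : Fin n → T, Φ (∑ i, φ (c i) * e i) = ∑ i, c i * γ i := by
  let _ := φ.toAlgebra
  let bas : Module.Basis (Fin n) T B := Module.Basis.mk (v := e)
    (Fintype.linearIndependent_iff.2 fun c hc => congrFun (hli c hc))
    (fun b _ => by
      obtain ⟨c, rfl⟩ := hspan b
      exact Submodule.sum_mem _ fun i _ => Submodule.smul_mem _ (c i)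
        (Submodule.subset_span ⟨i, rfl⟩))
  refine ⟨(bas.constr T γ : B →ₗ[T] T).toAddMonoidHom, fun c => ?_⟩
  rw [map_sum]
  refine Finset.sum_congr rfl fun i _ => ?_
  have h₁ : φ (c i) * e i = c i • bas i := by
    rw [show bas i = e i from Module.Basis.mk_apply _ _ i]
    rfl
  rw [h₁, LinearMap.toAddMonoidHom_coe, map_smul, Module.Basis.constr_basis, smul_eq_mul]

/-- A retract `R` of a free `T`-algebra `B` with a perfect trace pairing factoring through the
retraction is Gorenstein as soon as `T` has finite injective dimension. -/
theorem isGorensteinRing_of_isUnit_det_gram {T R B : Type u} [CommRing T] [CommRing R]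
    [CommRing B] [IsNoetherianRing R] (d : ℕ) [HasInjectiveDimensionLE (ModuleCat.of T T) d]
    {n : ℕ} (φ : T →+* R) (j : R →+* B) (e : Fin n → B)
    (hli : ∀ c : Fin n → T, ∑ i, j (φ (c i)) * e i = 0 → c = 0)
    (hspan : ∀ b, ∃ c : Fin n → T, b = ∑ i, j (φ (c i)) * e i)
    (Φ₀ : B →+ T) (hΦ₀ : ∀ t b, Φ₀ (j (φ t) * b) = t * Φ₀ b)
    (ρ : B →+ R) (hρ : ∀ r b, ρ (j r * b) = r * ρ b) (hρj : ∀ r, ρ (j r) = r)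
    (hdet : IsUnit (Matrix.of fun i k => Φ₀ (j (ρ (e i * e k)))).det) : IsGorensteinRing R := by
  let _ := φ.toAlgebra
  let _ := j.toAlgebra
  let _ := (j.comp φ).toAlgebra
  let bas : Module.Basis (Fin n) T B := Module.Basis.mk (v := e)
    (Fintype.linearIndependent_iff.2 fun c hc => congrFun (hli c hc))
    (fun b _ => by
      obtain ⟨c, rfl⟩ := hspan b
      exact Submodule.sum_mem _ fun i _ => Submodule.smul_mem _ (c i)
        (Submodule.subset_span ⟨i, rfl⟩))
  have hbas : ∀ i, bas i = e i := fun i => Module.Basis.mk_apply _ _ i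
  let ρ' : B →ₗ[T] R := { ρ with map_smul' := fun t b => hρ (φ t) b }
  let ι : R →ₗ[T] B := { j with map_smul' := fun t r => j.map_mul (φ t) r }
  let Φ : B →ₗ[T] T := { Φ₀ with map_smul' := hΦ₀ } ∘ₗ ι ∘ₗ ρ'
  have hΦ : ∀ b, Φ b = Φ₀ (j (ρ b)) := fun b => rfl
  have hΦr : ∀ b r, Φ (b * j r) = Φ (j (ρ b) * j r) := fun b r => by
    rw [hΦ, hΦ, mul_comm, hρ, ← j.map_mul, hρj, mul_comm]
  have hbij := bijective_of_isUnit_det_gram bas Φ (by simpa only [hΦ, hbas] using hdet)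
  have : Module.Projective T R := by
    have : Module.Projective T B := Module.Projective.of_basis bas
    exact Module.Projective.of_split ι ρ' (LinearMap.ext hρj)
  have hfin := hasInjectiveDimensionLE_of_dual_equiv (A := T) (R := R) d
    (fun r => Φ ∘ₗ LinearMap.mulLeft T (j r) ∘ₗ ι) ⟨fun r₁ r₂ h₁₂ => ?_, fun ψ => ?_⟩
    (fun x y => ?_) (fun r x y => ?_)
  · exact isGorensteinRing_of_hasInjectiveDimensionLE _ d
  · have hj : j r₁ = j r₂ := hbij.1 (LinearMap.ext fun b => by
      have := LinearMap.congr_fun h₁₂ (ρ b)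
      change Φ (j r₁ * j (ρ b)) = Φ (j r₂ * j (ρ b)) at this
      change Φ (j r₁ * b) = Φ (j r₂ * b)
      rw [mul_comm, hΦr, mul_comm, this, mul_comm, ← hΦr, mul_comm])
    rw [← hρj r₁, hj, hρj]
  · obtain ⟨z, hz⟩ := hbij.2 (ψ ∘ₗ ρ')
    refine ⟨ρ z, LinearMap.ext fun s => ?_⟩
    have := LinearMap.congr_fun hz (j s)
    change Φ (z * j s) = ψ (ρ (j s)) at this
    change Φ (j (ρ z) * j s) = ψ s
    rw [← hΦr, this, hρj]
  · refine LinearMap.ext fun s => ?_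
    change Φ (j (x + y) * j s) = Φ (j x * j s) + Φ (j y * j s)
    rw [j.map_add, add_mul, map_add]
  · change Φ (j (r * x) * j y) = Φ (j x * j (y * r))
    congr 1
    rw [j.map_mul, j.map_mul]
    ring

variable {F : Type u} [Field F]

variable (F) in
/-- A polynomial ring in three variables, as an iterated polynomial ring. -/
def ParamRing := Polynomial (Polynomial (Polynomial F))

instance : CommRing (ParamRing F) := inferInstanceAs (CommRing (Polynomial (Polynomial (Polynomial F))))

instance : HasInjectiveDimensionLE (ModuleCat.of (ParamRing F) (ParamRing F)) 3 :=
  hasInjectiveDimensionLE_polynomial₃ F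

/-- The constant term. -/
def ParamRing.augmentation : ParamRing F →+* F := ParamSystem.augmentation

/-- The constants. -/
def ParamRing.constants : F →+* ParamRing F := ParamSystem.constants

theorem ParamRing.augmentation_constants (a : F) : augmentation (constants a) = a :=
  ParamSystem.augmentation_constants a

namespace ParamSystem
variable (P : ParamSystem F)

theorem paramMap_sub_mem (a : Polynomial (Polynomial (Polynomial F))) :
    P.paramMap a - C (augmentation a) ∈ P.I := by
  have : (Ideal.Quotient.mk P.I).comp P.paramMap =
      ((Ideal.Quotient.mk P.I).comp C).comp augmentation := by
    refine Polynomial.ringHom_ext' (Polynomial.ringHom_ext' (Polynomial.ringHom_ext' ?_ ?_) ?_) ?_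
    · ext; simp [paramMap, augmentation]
    · simpa [paramMap, augmentation] using Ideal.Quotient.eq_zero_iff_mem.2 P.X_pow_mem
    · simpa [paramMap, augmentation] using Ideal.Quotient.eq_zero_iff_mem.2 P.g_mem
    · simpa [paramMap, augmentation] using Ideal.Quotient.eq_zero_iff_mem.2 P.f_mem
  rw [← Ideal.Quotient.eq_zero_iff_mem, map_sub, sub_eq_zero]
  exact RingHom.congr_fun this a

theorem functional_paramMap_mul (a : Polynomial (Polynomial (Polynomial F)))
    (b : MvPolynomial (Fin 3) F) :
    P.functional (P.paramMap a * b) = augmentation a * P.functional b := by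
  rw [← P.functional_C_mul, ← sub_eq_zero, ← map_sub, ← sub_mul]
  exact P.functional_of_mem (P.I.mul_mem_right _ (P.paramMap_sub_mem a))

theorem eq_constants_of_isHomogeneous {δ : Polynomial (Polynomial (Polynomial F))} {k d : ℕ}
    (hδ : augmentation δ ≠ 0) (h : (X 0 ^ k * P.paramMap δ).IsHomogeneous d) :
    δ = constants (augmentation δ) := by
  have hkd : k = d := by
    have h₁ : coeff (Finsupp.single 0 k) (X 0 ^ k * P.paramMap δ) ≠ 0 := by
      have := coeff_monomial_mul 0 (Finsupp.single 0 k) 1 (P.paramMap δ)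
      rw [add_zero, one_mul] at this
      rw [X_pow_eq_monomial, this]
      rw [← constantCoeff_eq, P.constantCoeff_paramMap]
      exact hδ
    simpa [Finsupp.weight_single] using h h₁
  subst hkd
  have h₂ : (P.paramMap δ).IsHomogeneous 0 := by
    intro m hm
    have h₃ := @h (Finsupp.single 0 k + m) (by
      rwa [X_pow_eq_monomial, coeff_monomial_mul, one_mul])
    rw [map_add, Finsupp.weight_single] at h₃
    simpa using h₃
  apply P.paramMap_injective
  rw [paramMap_constants, ← P.constantCoeff_paramMap, constantCoeff_eq]
  exact totalDegree_eq_zero_iff_eq_C.1 (Nat.le_zero.1 h₂.totalDegree_le)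

/-- The inclusion of the polynomial subring generated by the parameters. -/
def paramHom : ParamRing F →+* MvPolynomial (Fin 3) F := P.paramMap

theorem paramHom_constants (a : F) : P.paramHom (ParamRing.constants a) = C a :=
  P.paramMap_constants a

theorem functional_paramHom_mul (a : ParamRing F) (b : MvPolynomial (Fin 3) F) :
    P.functional (P.paramHom a * b) = ParamRing.augmentation a * P.functional b :=
  P.functional_paramMap_mul a b

theorem eq_zero_of_sum_paramHom_eq_zero {n : ℕ} {e : Fin n → MvPolynomial (Fin 3) F}
    (h : ∀ c : Fin n → F, ∑ i, C (c i) * e i ∈ P.I → c = 0)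
    (c : Fin n → ParamRing F) (hc : ∑ i, P.paramHom (c i) * e i = 0) : c = 0 :=
  P.eq_zero_of_sum_paramMap_eq_zero h c hc

theorem exists_sum_paramHom_eq_of_isHomogeneous {n : ℕ} {e : Fin n → MvPolynomial (Fin 3) F}
    {δ : Fin n → ℕ} (he : ∀ i, (e i).IsHomogeneous (δ i))
    (h : ∀ b, ∃ c : Fin n → F, b - ∑ i, C (c i) * e i ∈ P.I) (d : ℕ)
    (b : MvPolynomial (Fin 3) F) (hb : b.IsHomogeneous d) :
      ∃ c : Fin n → ParamRing F, b = ∑ i, P.paramHom (c i) * e i ∧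
        ∀ i, (X 0 ^ δ i * P.paramHom (c i)).IsHomogeneous d :=
  P.exists_sum_paramMap_eq_of_isHomogeneous he h d b hb

theorem eq_constants_of_isHomogeneous_paramHom {δ : ParamRing F} {k d : ℕ}
    (hδ : ParamRing.augmentation δ ≠ 0) (h : (X 0 ^ k * P.paramHom δ).IsHomogeneous d) :
    δ = ParamRing.constants (ParamRing.augmentation δ) :=
  P.eq_constants_of_isHomogeneous hδ h

end ParamSystem

variable {H : Type*} [Group H]
    [MulSemiringAction H (MvPolynomial (Fin 3) F)] [SMulCommClass H F (MvPolynomial (Fin 3) F)]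

theorem PlaneAction.isHomogeneous_reynolds [Fintype H] (A : PlaneAction F H)
    {b : MvPolynomial (Fin 3) F} {d : ℕ} (hb : b.IsHomogeneous d) :
    ((reynolds b : PolyFix F H) : MvPolynomial (Fin 3) F).IsHomogeneous d := by
  rw [coe_reynolds, twist]
  have := (isHomogeneous_C (Fin 3) (Fintype.card H : F)⁻¹).mul
    (IsHomogeneous.sum Finset.univ (fun h : H => C (1 : F) * h • b) d fun h _ => by
      simpa using A.isHomogeneous_smul h hb)
  simpa using this

namespace InvariantParamSystem

variable {A : PlaneAction F H} (P : InvariantParamSystem A)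

/-- The polynomial subring of the ring of invariants generated by the parameters. -/
def paramMapFix : Polynomial (Polynomial (Polynomial F)) →+* PolyFix F H :=
  Polynomial.eval₂RingHom (Polynomial.eval₂RingHom (Polynomial.eval₂RingHom
    (algebraMap F (PolyFix F H)) P.θ₃) P.θ₂) P.θ₁

theorem coe_paramMapFix (a : Polynomial (Polynomial (Polynomial F))) :
    (P.paramMapFix a : MvPolynomial (Fin 3) F) = P.paramMap a := by
  have : (PolyFix F H).val.toRingHom.comp P.paramMapFix = P.paramMap := by
    refine Polynomial.ringHom_ext' (Polynomial.ringHom_ext' (Polynomial.ringHom_ext' ?_ ?_) ?_) ?_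
    · ext x m
      simp [paramMapFix, ParamSystem.paramMap]
    · simp [paramMapFix, ParamSystem.paramMap, θ₃]
    · simp [paramMapFix, ParamSystem.paramMap, θ₂]
    · simp [paramMapFix, ParamSystem.paramMap, θ₁]
  exact RingHom.congr_fun this a

/-- The polynomial subring of the ring of invariants generated by the parameters. -/
def paramHomFix : ParamRing F →+* PolyFix F H := P.paramMapFix

theorem coe_paramHomFix (a : ParamRing F) :
    (P.paramHomFix a : MvPolynomial (Fin 3) F) = P.paramHom a := P.coe_paramMapFix a

theorem functional_reynolds [Fintype H] (hcard : (Fintype.card H : F) ≠ 0) (hκ : ∀ h, P.κ h = 1)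
    (b : MvPolynomial (Fin 3) F) :
    P.functional (reynolds b : PolyFix F H) = P.functional b := by
  rw [coe_reynolds, twist, P.functional_C_mul, map_sum]
  simp only [C_1, one_mul, P.functional_smul, hκ, Finset.sum_const, Finset.card_univ, nsmul_eq_mul]
  rw [← mul_assoc, inv_mul_cancel₀ hcard, one_mul]

theorem isGorensteinRing_of_κ_eq_one [Fintype H] (hcard : (Fintype.card H : F) ≠ 0)
    (hκ : ∀ h, P.κ h = 1) : IsGorensteinRing (PolyFix F H) := by
  obtain ⟨n, e, δ, he, hind, hspan⟩ := P.exists_homogeneous_basis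
  have hli := P.eq_zero_of_sum_paramHom_eq_zero hind
  have hsum : ∀ b : MvPolynomial (Fin 3) F, ∃ c : Fin n → ParamRing F,
      b = ∑ i, P.paramHom (c i) * e i := by
    intro b
    choose c hc using fun d => P.exists_sum_paramHom_eq_of_isHomogeneous he hspan d _
      (homogeneousComponent_isHomogeneous d b)
    refine ⟨fun i => ∑ d ∈ Finset.range (b.totalDegree + 1), c d i, ?_⟩
    conv_lhs => rw [← sum_homogeneousComponent b]
    simp only [map_sum, Finset.sum_mul]
    rw [Finset.sum_comm]
    exact Finset.sum_congr rfl fun d _ => (hc d).1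
  obtain ⟨Φ₀, hΦ₀⟩ := exists_addMonoidHom_of_basis P.paramHom e hli hsum
    fun i => ParamRing.constants (P.functional (e i))
  have hΦ₀mul : ∀ t b, Φ₀ (P.paramHom t * b) = t * Φ₀ b := by
    intro t b
    obtain ⟨c, rfl⟩ := hsum b
    have h₁ : P.paramHom t * ∑ i, P.paramHom (c i) * e i = ∑ i, P.paramHom (t * c i) * e i := by
      rw [Finset.mul_sum]
      exact Finset.sum_congr rfl fun i _ => by rw [map_mul, mul_assoc]
    rw [h₁, hΦ₀ (fun i => t * c i), hΦ₀, Finset.mul_sum]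
    exact Finset.sum_congr rfl fun i _ => mul_assoc _ _ _
  have hΦ₀aug : ∀ b, ParamRing.augmentation (Φ₀ b) = P.functional b := by
    intro b
    obtain ⟨c, rfl⟩ := hsum b
    rw [hΦ₀, map_sum, map_sum]
    refine Finset.sum_congr rfl fun i _ => ?_
    rw [map_mul, ParamRing.augmentation_constants, P.functional_paramHom_mul]
  have hΦ₀hom : ∀ (d : ℕ) (b : MvPolynomial (Fin 3) F), b.IsHomogeneous d →
      (X 0 ^ P.D * P.paramHom (Φ₀ b)).IsHomogeneous d := by
    intro d b hb
    obtain ⟨c, rfl, hc⟩ := P.exists_sum_paramHom_eq_of_isHomogeneous he hspan d b hb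
    rw [hΦ₀, map_sum, Finset.mul_sum]
    refine IsHomogeneous.sum _ _ _ fun i _ => ?_
    rw [map_mul, P.paramHom_constants]
    by_cases hi : δ i = P.D
    · rw [← hi, ← mul_assoc]
      simpa using (hc i).mul (isHomogeneous_C _ (P.functional (e i)))
    · rw [P.functional_of_isHomogeneous (he i) hi, C_0, mul_zero, mul_zero]
      exact isHomogeneous_zero _ _ _
  have hdet : IsUnit (Matrix.of fun i k =>
      Φ₀ (reynolds (e i * e k) : PolyFix F H)).det := by
    set G := Matrix.of fun i k => Φ₀ (reynolds (e i * e k) : PolyFix F H) with hG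
    have hGaug : ParamRing.augmentation G.det ≠ 0 := by
      rw [RingHom.map_det]
      intro h₀
      obtain ⟨v, hv, hv₀⟩ := Matrix.exists_vecMul_eq_zero_iff.2 h₀
      refine hv (hind v (P.mem_I_of_functional_eq_zero fun b => ?_))
      obtain ⟨c, hc⟩ := hspan b
      have h₁ : P.functional ((∑ i, C (v i) * e i) * b) =
          P.functional ((∑ i, C (v i) * e i) * ∑ i, C (c i) * e i) := by
        rw [← sub_eq_zero, ← map_sub, ← mul_sub]
        exact P.functional_of_mem (P.I.mul_mem_left _ hc)
      rw [h₁, Finset.mul_sum, map_sum]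
      refine Finset.sum_eq_zero fun j _ => ?_
      rw [mul_left_comm, P.functional_C_mul, Finset.sum_mul, map_sum]
      have h₂ := congrFun hv₀ j
      rw [Matrix.vecMul, dotProduct, Pi.zero_apply] at h₂
      rw [mul_eq_zero]
      right
      rw [← h₂]
      refine Finset.sum_congr rfl fun i _ => ?_
      rw [mul_assoc, P.functional_C_mul]
      congr 1
      change _ = ParamRing.augmentation (Φ₀ (reynolds (e i * e j) : PolyFix F H))
      rw [hΦ₀aug, P.functional_reynolds hcard hκ]
    have hGhom : (X 0 ^ (P.D * n) * P.paramHom G.det).IsHomogeneous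
        (∑ i, δ i + ∑ i, δ i) := by
      have h₁ : X 0 ^ (P.D * n) * P.paramHom G.det =
          (Matrix.of fun i j => X 0 ^ P.D * P.paramHom (G i j)).det := by
        have h₂ : (Matrix.of fun i j => X 0 ^ P.D * P.paramHom (G i j)) =
            (X 0 ^ P.D : MvPolynomial (Fin 3) F) • P.paramHom.mapMatrix G := by
          ext i j
          simp
        rw [h₂, Matrix.det_smul, RingHom.map_det, pow_mul, Fintype.card_fin]
      rw [h₁, Matrix.det_apply]
      refine IsHomogeneous.sum _ _ _ fun σ _ => ?_
      have h₃ : (∏ i, (Matrix.of fun i j => X 0 ^ P.D * P.paramHom (G i j)) (σ i) i).IsHomogeneous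
          (∑ i, (δ (σ i) + δ i)) := IsHomogeneous.prod _ _ _ fun i _ =>
        hΦ₀hom _ _ (A.isHomogeneous_reynolds ((he _).mul (he _)))
      rw [Finset.sum_add_distrib, Equiv.sum_comp σ δ] at h₃
      rcases Int.units_eq_one_or (Equiv.Perm.sign σ) with hσ | hσ
      · rwa [hσ, one_smul]
      · rw [hσ, Units.neg_smul, one_smul]
        exact h₃.neg
    rw [P.eq_constants_of_isHomogeneous_paramHom hGaug hGhom]
    exact hGaug.isUnit.map ParamRing.constants
  have hj : ∀ t, (PolyFix F H).subtype (P.paramHomFix t) = P.paramHom t := P.coe_paramHomFix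
  exact isGorensteinRing_of_isUnit_det_gram 3 P.paramHomFix (PolyFix F H).subtype e
    (by simpa only [hj] using hli) (by simpa only [hj] using hsum) Φ₀
    (by simpa only [hj] using hΦ₀mul) (reynolds (F := F) (H := H)).toAddMonoidHom
    (fun r b => (reynolds (F := F) (H := H)).map_smul r b) (reynolds_coe hcard) hdet

end InvariantParamSystem

/-- Watanabe's theorem for a group acting on `F[X₀, X₁, X₂]` without reflections. -/
theorem PlaneAction.isGorensteinRing_iff [Fintype H] (A : PlaneAction F H)
    (hcard : (Fintype.card H : F) ≠ 0)
    (hrefl : ∀ (h : H) (π : MvPolynomial (Fin 3) F), Prime π → (∀ b, π ∣ h • b - b) → h = 1) :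
    IsGorensteinRing (PolyFix F H) ↔ ∀ h, A.χ h * (A.c h).det = 1 := by
  obtain ⟨P⟩ := nonempty_invariantParamSystem (A := A)
  constructor
  · intro hR h
    have := P.κ_mul_eq_one h
    rwa [P.κ_eq_one_of_isGorensteinRing hcard hrefl hR, one_mul] at this
  · intro h
    refine P.isGorensteinRing_of_κ_eq_one hcard fun g => ?_
    have := P.κ_mul_eq_one g
    rwa [h, mul_one] at this

end

section

variable {F : Type u} [Field F]

/-- A `3 × 3` matrix is a block matrix if it preserves the decomposition
`F³ = F e₀ ⊕ (F e₁ ⊕ F e₂)`. -/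
structure IsBlock (M : Matrix (Fin 3) (Fin 3) F) : Prop where
  zero_one : M 0 1 = 0
  zero_two : M 0 2 = 0
  one_zero : M 1 0 = 0
  two_zero : M 2 0 = 0

namespace IsBlock

theorem one : IsBlock (1 : Matrix (Fin 3) (Fin 3) F) := ⟨rfl, rfl, rfl, rfl⟩

variable {M N : Matrix (Fin 3) (Fin 3) F}

theorem sub (hM : IsBlock M) (hN : IsBlock N) : IsBlock (M - N) := by
  constructor <;> simp [hM.1, hM.2, hM.3, hM.4, hN.1, hN.2, hN.3, hN.4]

theorem mul (hM : IsBlock M) (hN : IsBlock N) : IsBlock (M * N) := by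
  constructor <;>
    simp [Matrix.mul_apply, Fin.sum_univ_three, hM.1, hM.2, hM.3, hM.4, hN.1, hN.2, hN.3, hN.4]

theorem submatrix_mul (hM : IsBlock M) :
    (M * N).submatrix Fin.succ Fin.succ =
      M.submatrix Fin.succ Fin.succ * N.submatrix (Fin.succ : Fin 2 → Fin 3) Fin.succ := by
  ext i j
  simp only [Matrix.submatrix_apply, Matrix.mul_apply, Fin.sum_univ_three, Fin.sum_univ_two]
  fin_cases i <;> simp [hM.3, hM.4]

theorem mul_apply_zero_zero (hM : IsBlock M) : (M * N) 0 0 = M 0 0 * N 0 0 := by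
  simp [Matrix.mul_apply, Fin.sum_univ_three, hM.1, hM.2]

theorem pow (hM : IsBlock M) (k : ℕ) : IsBlock (M ^ k) ∧ (M ^ k) 0 0 = M 0 0 ^ k ∧
    (M ^ k).submatrix Fin.succ Fin.succ =
      M.submatrix (Fin.succ : Fin 2 → Fin 3) Fin.succ ^ k := by
  induction k with
  | zero =>
    refine ⟨by simpa using one, by simp, ?_⟩
    rw [pow_zero, pow_zero, Matrix.submatrix_one _ (Fin.succ_injective _)]
  | succ k ih =>
    rw [pow_succ', pow_succ', pow_succ', hM.mul_apply_zero_zero, hM.submatrix_mul, ih.2.1, ih.2.2]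
    exact ⟨hM.mul ih.1, rfl, rfl⟩

theorem det (hM : IsBlock M) : M.det = M 0 0 * (M.submatrix Fin.succ Fin.succ).det := by
  rw [Matrix.det_fin_three, Matrix.det_fin_two]
  simp [hM.1, hM.2]
  ring

theorem mul_self_eq_zero (hM : IsBlock M) (h : IsNilpotent M) : M 0 0 = 0 ∧ M * M = 0 := by
  obtain ⟨k, hk⟩ := h
  obtain ⟨-, h₁, h₂⟩ := hM.pow k
  rw [hk] at h₁ h₂
  have h₃ : M 0 0 = 0 := eq_zero_of_pow_eq_zero h₁.symm
  have h₄ : IsNilpotent (M.submatrix (Fin.succ : Fin 2 → Fin 3) Fin.succ) := ⟨k, h₂.symm⟩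
  have h₅ := (Matrix.isNilpotent_trace_of_isNilpotent h₄).eq_zero
  have h₆ : (M.submatrix (Fin.succ : Fin 2 → Fin 3) Fin.succ).det = 0 :=
    eq_zero_of_pow_eq_zero (n := k) (by rw [← Matrix.det_pow, ← h₂]; simp)
  rw [Matrix.det_fin_two] at h₆
  rw [Matrix.trace_fin_two] at h₅
  simp only [Matrix.submatrix_apply, Fin.succ_zero_eq_one, Fin.succ_one_eq_two] at h₅ h₆
  refine ⟨h₃, ?_⟩
  ext i j
  fin_cases i <;> fin_cases j <;>
    simp [Matrix.mul_apply, Fin.sum_univ_three, hM.1, hM.2, hM.3, hM.4, h₃] <;>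
    grind

end IsBlock

theorem eq_zero_or_rank_eq_one {N : Matrix (Fin 3) (Fin 3) F} (h : N * N = 0) :
    N = 0 ∨ N.rank = 1 := by
  have h₁ := Matrix.rank_add_rank_le_card_of_mul_eq_zero h
  rw [Fintype.card_fin] at h₁
  by_cases h₂ : N.rank = 0
  · left
    rw [Matrix.rank, Submodule.finrank_eq_zero, LinearMap.range_eq_bot] at h₂
    ext i j
    simpa using congrFun (LinearMap.congr_fun h₂ (Pi.single j 1)) i
  · right; omega

theorem mem_transSubgroup_of_mul_self_eq_zero {G : Subgroup (Matrix.SpecialLinearGroup (Fin 3) F)}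
    {g : Matrix.SpecialLinearGroup (Fin 3) F} (hg : g ∈ G)
    (h : ((g : Matrix (Fin 3) (Fin 3) F) - 1) * ((g : Matrix (Fin 3) (Fin 3) F) - 1) = 0) :
    g ∈ transSubgroup G := by
  obtain h₁ | h₁ := eq_zero_or_rank_eq_one h
  · have : g = 1 := Subtype.ext (sub_eq_zero.1 h₁)
    rw [this]
    exact one_mem _
  · exact Subgroup.subset_closure ⟨hg, h₁, h⟩

theorem mem_transSubgroup_of_pow_eq_one {p : ℕ} [Fact p.Prime] [CharP F p]
    {G : Subgroup (Matrix.SpecialLinearGroup (Fin 3) F)}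
    {g : Matrix.SpecialLinearGroup (Fin 3) F} (hg : g ∈ G)
    (hb : IsBlock (g : Matrix (Fin 3) (Fin 3) F)) {k : ℕ} (h : g ^ p ^ k = 1) :
    g ∈ transSubgroup G := by
  have hC : CharP (Matrix (Fin 3) (Fin 3) F) p := Matrix.charP p
  refine mem_transSubgroup_of_mul_self_eq_zero hg
    ((hb.sub IsBlock.one).mul_self_eq_zero ⟨p ^ k, ?_⟩).2
  rw [sub_pow_char_pow_of_commute _ _ (Commute.one_right _), one_pow,
    ← Matrix.SpecialLinearGroup.coe_pow, h, Matrix.SpecialLinearGroup.coe_one, sub_self]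

theorem transSubgroup_le (G : Subgroup (Matrix.SpecialLinearGroup (Fin 3) F)) :
    transSubgroup G ≤ G := (Subgroup.closure_le _).2 fun _ h => h.1

theorem conj_mem_transSubgroup {G : Subgroup (Matrix.SpecialLinearGroup (Fin 3) F)}
    {g τ : Matrix.SpecialLinearGroup (Fin 3) F} (hg : g ∈ G) (hτ : τ ∈ transSubgroup G) :
    g * τ * g⁻¹ ∈ transSubgroup G := by
  induction hτ using Subgroup.closure_induction with
  | mem τ h =>
    refine Subgroup.subset_closure ⟨G.mul_mem (G.mul_mem hg h.1) (G.inv_mem hg), ?_⟩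
    have h₁ : (g : Matrix (Fin 3) (Fin 3) F) * (g⁻¹ : Matrix.SpecialLinearGroup (Fin 3) F) = 1 := by
      rw [← Matrix.SpecialLinearGroup.coe_mul, mul_inv_cancel, Matrix.SpecialLinearGroup.coe_one]
    have h₁' : ((g⁻¹ : Matrix.SpecialLinearGroup (Fin 3) F) : Matrix (Fin 3) (Fin 3) F) * g = 1 := by
      rw [← Matrix.SpecialLinearGroup.coe_mul, inv_mul_cancel, Matrix.SpecialLinearGroup.coe_one]
    have h₂ : ((g * τ * g⁻¹ : Matrix.SpecialLinearGroup (Fin 3) F) : Matrix (Fin 3) (Fin 3) F) - 1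
        = g * (τ - 1 : Matrix (Fin 3) (Fin 3) F) * (g⁻¹ : Matrix.SpecialLinearGroup (Fin 3) F) := by
      rw [Matrix.SpecialLinearGroup.coe_mul, Matrix.SpecialLinearGroup.coe_mul, mul_sub, sub_mul,
        mul_one, h₁]
    refine ⟨?_, ?_⟩
    · rw [h₂, Matrix.rank_mul_eq_left_of_isUnit_det, Matrix.rank_mul_eq_right_of_isUnit_det]
      · exact h.2.1
      · simp
      · simp [- Matrix.SpecialLinearGroup.coe_inv]
    · rw [h₂]
      have h₃ := h.2.2
      generalize (τ : Matrix (Fin 3) (Fin 3) F) - 1 = N at h₃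
      calc _ = (g : Matrix (Fin 3) (Fin 3) F) * (N * (((g⁻¹ : Matrix.SpecialLinearGroup (Fin 3) F) :
            Matrix (Fin 3) (Fin 3) F) * g) * N) *
            (g⁻¹ : Matrix.SpecialLinearGroup (Fin 3) F) := by simp only [Matrix.mul_assoc]
        _ = 0 := by rw [h₁', mul_one, h₃, mul_zero, zero_mul]
  | one => simp
  | mul a b _ _ ha hb =>
    have := mul_mem ha hb
    simpa [mul_assoc] using this
  | inv a _ ha =>
    have := inv_mem ha
    simpa [mul_assoc] using this

theorem transSubgroup_apply_zero_zero {G : Subgroup (Matrix.SpecialLinearGroup (Fin 3) F)}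
    (hG : ∀ g ∈ G, IsBlock (g : Matrix (Fin 3) (Fin 3) F))
    {τ : Matrix.SpecialLinearGroup (Fin 3) F} (hτ : τ ∈ transSubgroup G) :
    (τ : Matrix (Fin 3) (Fin 3) F) 0 0 = 1 := by
  induction hτ using Subgroup.closure_induction with
  | mem τ h =>
    have h₁ := (((hG τ h.1).sub IsBlock.one).mul_self_eq_zero ⟨2, by rw [pow_two]; exact h.2.2⟩).1
    rw [Matrix.sub_apply, Matrix.one_apply_eq, sub_eq_zero] at h₁
    exact h₁
  | one => simp
  | mul a b ha hb h₁ h₂ =>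
    rw [Matrix.SpecialLinearGroup.coe_mul, (hG a (transSubgroup_le G ha)).mul_apply_zero_zero,
      h₁, h₂, mul_one]
  | inv a ha h =>
    have h₁ := (hG a (transSubgroup_le G ha)).mul_apply_zero_zero
      (N := ((a⁻¹ : Matrix.SpecialLinearGroup (Fin 3) F) : Matrix (Fin 3) (Fin 3) F))
    rw [← Matrix.SpecialLinearGroup.coe_mul, mul_inv_cancel, Matrix.SpecialLinearGroup.coe_one, h,
      Matrix.one_apply_eq, one_mul] at h₁
    exact h₁.symm

end

section

variable {F : Type u} [Field F]

theorem polyAct_X {m : ℕ} (M : Matrix (Fin m) (Fin m) F) (i : Fin m) :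
    polyAct M (X i) = ∑ j, M i j • X j := by
  rw [polyAct, aeval_X]

theorem polyAct_mul {m : ℕ} (M N : Matrix (Fin m) (Fin m) F) (f : MvPolynomial (Fin m) F) :
    polyAct (N * M) f = polyAct M (polyAct N f) := by
  have h : polyAct (N * M) = (polyAct M).comp (polyAct N) := by
    refine MvPolynomial.algHom_ext fun i => ?_
    simp only [AlgHom.comp_apply, polyAct_X, map_sum, map_smul, Matrix.mul_apply, Finset.smul_sum,
      Finset.sum_smul, smul_smul]
    rw [Finset.sum_comm]
  exact AlgHom.congr_fun h f

theorem polyAct_one {m : ℕ} (f : MvPolynomial (Fin m) F) :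
    polyAct (1 : Matrix (Fin m) (Fin m) F) f = f := by
  have h : polyAct (1 : Matrix (Fin m) (Fin m) F) = AlgHom.id F _ := by
    refine MvPolynomial.algHom_ext fun i => ?_
    simp [polyAct_X, Matrix.one_apply]
  exact AlgHom.congr_fun h f

theorem polyAct_isHomogeneous {m : ℕ} (M : Matrix (Fin m) (Fin m) F) {f : MvPolynomial (Fin m) F}
    {n : ℕ} (hf : f.IsHomogeneous n) : (polyAct M f).IsHomogeneous n := by
  have := hf.aeval (fun i => ∑ j, M i j • (X j : MvPolynomial (Fin m) F)) (n := 1)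
    fun i => IsHomogeneous.sum _ _ _ fun j _ => by
      rw [MvPolynomial.smul_eq_C_mul]
      simpa using (isHomogeneous_C _ _).mul (isHomogeneous_X F j)
  rwa [one_mul] at this

theorem polyAct_inv_polyAct (g : Matrix.SpecialLinearGroup (Fin 3) F)
    (f : MvPolynomial (Fin 3) F) :
    polyAct ((g⁻¹ : Matrix.SpecialLinearGroup (Fin 3) F) : Matrix (Fin 3) (Fin 3) F)
      (polyAct (g : Matrix (Fin 3) (Fin 3) F) f) = f := by
  rw [← polyAct_mul, ← Matrix.SpecialLinearGroup.coe_mul, mul_inv_cancel,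
    Matrix.SpecialLinearGroup.coe_one, polyAct_one]

theorem polyAct_polyAct_inv (g : Matrix.SpecialLinearGroup (Fin 3) F)
    (f : MvPolynomial (Fin 3) F) :
    polyAct (g : Matrix (Fin 3) (Fin 3) F)
      (polyAct ((g⁻¹ : Matrix.SpecialLinearGroup (Fin 3) F) : Matrix (Fin 3) (Fin 3) F) f) = f := by
  rw [← polyAct_mul, ← Matrix.SpecialLinearGroup.coe_mul, inv_mul_cancel,
    Matrix.SpecialLinearGroup.coe_one, polyAct_one]

theorem mem_invariantRing {m : ℕ} {G : Subgroup (Matrix.SpecialLinearGroup (Fin m) F)}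
    {f : MvPolynomial (Fin m) F} :
    f ∈ invariantRing G ↔ ∀ g ∈ G, polyAct (g : Matrix (Fin m) (Fin m) F) f = f :=
  ⟨fun h g hg => h g ⟨g, hg, rfl⟩, fun h _ ⟨g, hg, hM⟩ => hM ▸ h g hg⟩

theorem IsBlock.killZero_polyAct {M : Matrix (Fin 3) (Fin 3) F} (hM : IsBlock M)
    (f : MvPolynomial (Fin 3) F) : killZero (polyAct M f) = polyAct M (killZero f) := by
  have h : killZero.comp (polyAct M) = (polyAct M).comp killZero := by
    refine MvPolynomial.algHom_ext fun i => ?_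
    fin_cases i <;>
      simp [killZero, polyAct_X, Fin.sum_univ_three, hM.1, hM.2, hM.3, hM.4]
  exact AlgHom.congr_fun h f

theorem IsBlock.polyAct_X_zero {M : Matrix (Fin 3) (Fin 3) F} (hM : IsBlock M) :
    polyAct M (X 0) = M 0 0 • X 0 := by
  simp [polyAct_X, Fin.sum_univ_three, hM.1, hM.2]

theorem killZero_mem_supported (f : MvPolynomial (Fin 3) F) :
    killZero f ∈ supported F ({1, 2} : Set (Fin 3)) := by
  induction f using MvPolynomial.induction_on with
  | C a =>
    rw [← MvPolynomial.algebraMap_eq, AlgHom.commutes]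
    exact Subalgebra.algebraMap_mem _ _
  | add p q hp hq => rw [map_add]; exact add_mem hp hq
  | mul_X p i hp =>
    rw [map_mul]
    refine mul_mem hp ?_
    fin_cases i <;> simp [killZero, X_mem_supported]

theorem killZero_eq_self {f : MvPolynomial (Fin 3) F}
    (hf : f ∈ supported F ({1, 2} : Set (Fin 3))) : killZero f = f := by
  have h : supported F ({1, 2} : Set (Fin 3)) ≤ AlgHom.equalizer killZero (AlgHom.id F _) := by
    refine Algebra.adjoin_le ?_
    rintro _ ⟨i, rfl | rfl, rfl⟩ <;> simp [killZero]
  exact h hf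

theorem killZero_induction {P : MvPolynomial (Fin 3) F → Prop} (zero : P 0)
    (step : ∀ f f', f = killZero f + X 0 * f' → P f' → P f) (f : MvPolynomial (Fin 3) F) : P f := by
  induction hn : degreeOf 0 f using Nat.strong_induction_on generalizing f with
  | _ n ih =>
    obtain ⟨f', hf'⟩ := X_zero_dvd_sub_killZero f
    refine step f f' (by rw [← hf']; ring) ?_
    by_cases h : f' = 0
    · rwa [h]
    · refine ih _ ?_ f' rfl
      have h₁ : degreeOf 0 (killZero f) = 0 := by
        by_contra h₀
        have := mem_supported.1 (killZero_mem_supported f) (mem_vars_iff_degreeOf_ne_zero.2 h₀)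
        simp at this
      have h₂ := degreeOf_sub_le 0 f (killZero f)
      rw [h₁, hf', mul_comm, (degreeOf_mul_X_eq_degreeOf_add_one_iff 0 f').2 h] at h₂
      simp at h₂
      omega

/-- Generators of the invariants of the subgroup generated by the transvections of a group of
block matrices: `X 0` together with algebraically independent homogeneous `a 1, a 2`
generating the invariants in `F[X₁, X₂]`. -/
structure TransInvariants (G : Subgroup (Matrix.SpecialLinearGroup (Fin 3) F)) where
  /-- the generators -/
  a : Fin 3 → MvPolynomial (Fin 3) F
  /-- their degrees -/
  d : Fin 3 → ℕ
  isBlock : ∀ g ∈ G, IsBlock (g : Matrix (Fin 3) (Fin 3) F)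
  a_zero : a 0 = X 0
  d_pos : ∀ i, 0 < d i
  hom : ∀ i, (a i).IsHomogeneous (d i)
  killZero_a_one : killZero (a 1) = a 1
  killZero_a_two : killZero (a 2) = a 2
  polyAct_a : ∀ τ ∈ transSubgroup G, ∀ i, polyAct (τ : Matrix (Fin 3) (Fin 3) F) (a i) = a i
  indep : ∀ q : MvPolynomial (Fin 2) F, aeval ![a 1, a 2] q = 0 → q = 0
  gen : ∀ f ∈ invariantRing (transSubgroup G), killZero f = f →
    ∃ q : MvPolynomial (Fin 2) F, aeval ![a 1, a 2] q = f

namespace TransInvariants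

variable {G : Subgroup (Matrix.SpecialLinearGroup (Fin 3) F)} (I : TransInvariants G)

/-- The substitution `X i ↦ a i`. -/
def α : MvPolynomial (Fin 3) F →ₐ[F] MvPolynomial (Fin 3) F := aeval I.a

theorem α_X (i : Fin 3) : I.α (X i) = I.a i := aeval_X _ _

theorem α_X_zero : I.α (X 0) = X 0 := by rw [α_X, a_zero]

theorem killZero_α (q : MvPolynomial (Fin 3) F) : killZero (I.α q) = I.α (killZero q) := by
  have h : killZero.comp I.α = I.α.comp killZero := by
    refine MvPolynomial.algHom_ext fun i => ?_
    rw [AlgHom.comp_apply, AlgHom.comp_apply, α_X]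
    fin_cases i
    · simp [killZero, I.a_zero]
    · simpa [killZero, I.α_X] using I.killZero_a_one
    · simpa [killZero, I.α_X] using I.killZero_a_two
  exact AlgHom.congr_fun h q

theorem α_rename (q : MvPolynomial (Fin 2) F) :
    I.α (rename Fin.succ q) = aeval ![I.a 1, I.a 2] q := by
  rw [α, aeval_rename]
  congr 2
  funext i
  fin_cases i <;> rfl

theorem killZero_eq_rename (q : MvPolynomial (Fin 3) F) :
    killZero q = rename Fin.succ (aeval ![0, X 0, X 1] q : MvPolynomial (Fin 2) F) := by
  have h : killZero = (rename Fin.succ).comp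
      (aeval ![0, X 0, X 1] : MvPolynomial (Fin 3) F →ₐ[F] MvPolynomial (Fin 2) F) := by
    refine MvPolynomial.algHom_ext fun i => ?_
    fin_cases i <;> simp [killZero]
  exact AlgHom.congr_fun h q

theorem α_injective : Function.Injective I.α := by
  rw [injective_iff_map_eq_zero]
  intro q
  induction q using killZero_induction with
  | zero => exact fun _ => rfl
  | step f f' hf ih =>
    intro h
    have h₁ : I.α (killZero f) = 0 := by rw [← killZero_α, h, map_zero]
    have h₂ : killZero f = 0 := by
      rw [killZero_eq_rename, α_rename] at h₁
      rw [killZero_eq_rename, I.indep _ h₁, map_zero]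
    rw [h₂, zero_add] at hf
    rw [hf, map_mul, α_X_zero, mul_eq_zero, or_iff_right (X_ne_zero 0)] at h
    rw [hf, ih h, mul_zero]

theorem polyAct_α {τ : Matrix.SpecialLinearGroup (Fin 3) F} (hτ : τ ∈ transSubgroup G)
    (q : MvPolynomial (Fin 3) F) : polyAct (τ : Matrix (Fin 3) (Fin 3) F) (I.α q) = I.α q := by
  have h : (polyAct (τ : Matrix (Fin 3) (Fin 3) F)).comp I.α = I.α :=
    MvPolynomial.algHom_ext fun i => by rw [AlgHom.comp_apply, α_X, I.polyAct_a τ hτ]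
  exact AlgHom.congr_fun h q

theorem exists_α_eq {f : MvPolynomial (Fin 3) F} (hf : f ∈ invariantRing (transSubgroup G)) :
    ∃ q, I.α q = f := by
  induction f using killZero_induction with
  | zero => exact ⟨0, map_zero _⟩
  | step f f' hff' ih =>
    rw [mem_invariantRing] at hf
    have hk : ∀ τ ∈ transSubgroup G,
        polyAct (τ : Matrix (Fin 3) (Fin 3) F) (killZero f) = killZero f := fun τ hτ => by
      rw [← (I.isBlock τ (transSubgroup_le G hτ)).killZero_polyAct, hf τ hτ]
    obtain ⟨q, hq⟩ := I.gen (killZero f) (mem_invariantRing.2 hk)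
      (killZero_eq_self (killZero_mem_supported f))
    obtain ⟨q', hq'⟩ := ih <| mem_invariantRing.2 fun τ hτ => by
      have h₁ := hf τ hτ
      rw [hff', map_add, hk τ hτ, map_mul, ← I.a_zero, I.polyAct_a τ hτ, I.a_zero] at h₁
      exact mul_left_cancel₀ (X_ne_zero 0) (add_left_cancel h₁)
    exact ⟨rename Fin.succ q + X 0 * q', by rw [map_add, map_mul, α_X_zero, α_rename, hq, hq', ← hff']⟩

theorem exists_α_eq_iff {f : MvPolynomial (Fin 3) F} :
    (∃ q, I.α q = f) ↔ f ∈ invariantRing (transSubgroup G) :=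
  ⟨fun ⟨_, hq⟩ => hq ▸ mem_invariantRing.2 fun _ hτ => I.polyAct_α hτ _, I.exists_α_eq⟩

theorem polyAct_mem_invariantRing {g : Matrix.SpecialLinearGroup (Fin 3) F} (hg : g ∈ G)
    {f : MvPolynomial (Fin 3) F} (hf : f ∈ invariantRing (transSubgroup G)) :
    polyAct (g : Matrix (Fin 3) (Fin 3) F) f ∈ invariantRing (transSubgroup G) := by
  rw [mem_invariantRing] at hf ⊢
  intro τ hτ
  rw [← polyAct_mul, ← Matrix.SpecialLinearGroup.coe_mul,
    show g * τ = g * τ * g⁻¹ * g by simp, Matrix.SpecialLinearGroup.coe_mul, polyAct_mul,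
    hf _ (conj_mem_transSubgroup hg hτ)]

end TransInvariants

end

section

variable {F : Type u} [Field F]

/-- The group of automorphisms of the polynomial ring induced by `G` through the
embedding `ι`. -/
def imageGroup (G : Subgroup (Matrix.SpecialLinearGroup (Fin 3) F))
    (ι : MvPolynomial (Fin 3) F →ₐ[F] MvPolynomial (Fin 3) F) :
    Subgroup (MvPolynomial (Fin 3) F ≃ₐ[F] MvPolynomial (Fin 3) F) where
  carrier := {σ | ∃ g ∈ G, ∀ b, ι (σ b) = polyAct (g : Matrix (Fin 3) (Fin 3) F) (ι b)}
  mul_mem' := by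
    rintro σ τ ⟨g, hg, hσ⟩ ⟨h, hh, hτ⟩
    refine ⟨h * g, G.mul_mem hh hg, fun b => ?_⟩
    rw [AlgEquiv.mul_apply, hσ, hτ, Matrix.SpecialLinearGroup.coe_mul, polyAct_mul]
  one_mem' := ⟨1, G.one_mem, fun b => by
    rw [Matrix.SpecialLinearGroup.coe_one, polyAct_one, AlgEquiv.one_apply]⟩
  inv_mem' := by
    rintro σ ⟨g, hg, hσ⟩
    refine ⟨g⁻¹, G.inv_mem hg, fun b => ?_⟩
    obtain ⟨c, rfl⟩ := σ.surjective b
    rw [hσ, polyAct_inv_polyAct]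
    exact congrArg ι (σ.symm_apply_apply c)

variable {G : Subgroup (Matrix.SpecialLinearGroup (Fin 3) F)}
  {ι : MvPolynomial (Fin 3) F →ₐ[F] MvPolynomial (Fin 3) F}

theorem finite_imageGroup [Finite G] (hι : Function.Injective ι) : Finite (imageGroup G ι) := by
  choose f hf using fun σ : imageGroup G ι => σ.2
  refine Finite.of_injective (fun σ => (⟨f σ, (hf σ).1⟩ : G)) fun σ τ h => ?_
  have h₁ : f σ = f τ := congrArg Subtype.val h
  refine Subtype.ext (AlgEquiv.ext fun b => hι ?_)
  rw [(hf σ).2, (hf τ).2, h₁]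

theorem exists_imageGroup (hι : Function.Injective ι)
    (hG : ∀ g ∈ G, ∀ b, ∃ q, ι q = polyAct (g : Matrix (Fin 3) (Fin 3) F) (ι b))
    {g : Matrix.SpecialLinearGroup (Fin 3) F} (hg : g ∈ G) :
    ∃ σ : imageGroup G ι, ∀ b, ι ((σ : MvPolynomial (Fin 3) F ≃ₐ[F] MvPolynomial (Fin 3) F) b) =
      polyAct (g : Matrix (Fin 3) (Fin 3) F) (ι b) := by
  have key : ∀ g ∈ G, ∃ φ : MvPolynomial (Fin 3) F →ₐ[F] MvPolynomial (Fin 3) F,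
      ∀ b, ι (φ b) = polyAct (g : Matrix (Fin 3) (Fin 3) F) (ι b) := by
    intro g hg
    choose q hq using fun i => hG g hg (X i)
    have h : ι.comp (aeval q) = (polyAct (g : Matrix (Fin 3) (Fin 3) F)).comp ι :=
      MvPolynomial.algHom_ext fun i => by
        rw [AlgHom.comp_apply, AlgHom.comp_apply, aeval_X, hq]
    exact ⟨aeval q, AlgHom.congr_fun h⟩
  obtain ⟨φ, hφ⟩ := key g hg
  obtain ⟨ψ, hψ⟩ := key g⁻¹ (G.inv_mem hg)
  refine ⟨⟨AlgEquiv.ofAlgHom φ ψ ?_ ?_, g, hg, hφ⟩, hφ⟩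
  · refine AlgHom.ext fun b => hι ?_
    rw [AlgHom.comp_apply, hφ, hψ, polyAct_polyAct_inv, AlgHom.id_apply]
  · refine AlgHom.ext fun b => hι ?_
    rw [AlgHom.comp_apply, hψ, hφ, polyAct_inv_polyAct, AlgHom.id_apply]

theorem imageGroup_pow_apply {σ : MvPolynomial (Fin 3) F ≃ₐ[F] MvPolynomial (Fin 3) F}
    {g : Matrix.SpecialLinearGroup (Fin 3) F}
    (h : ∀ b, ι (σ b) = polyAct (g : Matrix (Fin 3) (Fin 3) F) (ι b)) (n : ℕ)
    (b : MvPolynomial (Fin 3) F) :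
    ι ((σ ^ n) b) = polyAct ((g ^ n : Matrix.SpecialLinearGroup (Fin 3) F) :
      Matrix (Fin 3) (Fin 3) F) (ι b) := by
  induction n generalizing b with
  | zero => rw [pow_zero, pow_zero, Matrix.SpecialLinearGroup.coe_one, polyAct_one,
      AlgEquiv.one_apply]
  | succ n ih =>
    rw [pow_succ, pow_succ', AlgEquiv.mul_apply, ih, h, Matrix.SpecialLinearGroup.coe_mul,
      polyAct_mul]

theorem card_imageGroup_ne_zero {p : ℕ} [Fact p.Prime] [CharP F p] [Finite G]
    (hι : Function.Injective ι) (hG : ∀ g ∈ G, IsBlock (g : Matrix (Fin 3) (Fin 3) F))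
    (hT : ∀ q, ι q ∈ invariantRing (transSubgroup G)) :
    (Nat.card (imageGroup G ι) : F) ≠ 0 := by
  have := finite_imageGroup (G := G) hι
  rw [Ne, CharP.cast_eq_zero_iff F p]
  intro hdvd
  obtain ⟨σ, hσ⟩ := exists_prime_orderOf_dvd_card' p hdvd
  obtain ⟨g, hg, hgσ⟩ := σ.2
  obtain ⟨k, m, hm, hkm⟩ := Nat.exists_eq_pow_mul_and_not_dvd (n := orderOf (⟨g, hg⟩ : G))
    (orderOf_pos _).ne' p (Fact.out : p.Prime).ne_one
  have h₁ : (g ^ m) ^ p ^ k = 1 := by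
    rw [← pow_mul, mul_comm, ← hkm]
    exact congrArg Subtype.val (pow_orderOf_eq_one (⟨g, hg⟩ : G))
  have h₂ := mem_transSubgroup_of_pow_eq_one (p := p) (G.pow_mem hg m) (hG _ (G.pow_mem hg m)) h₁
  have h₃ : σ ^ m = 1 := by
    refine Subtype.ext (AlgEquiv.ext fun b => hι ?_)
    rw [SubgroupClass.coe_pow, imageGroup_pow_apply hgσ, mem_invariantRing.1 (hT b) _ h₂]
    rfl
  rw [← orderOf_dvd_iff_pow_eq_one, hσ] at h₃
  exact hm h₃

end

section

theorem exists_smul_eq_of_eq_on_fixed {Γ R D : Type*} [Group Γ] [Fintype Γ] [CommRing R]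
    [MulSemiringAction Γ R] [CommRing D] [IsDomain D] (φ ψ : R →+* D)
    (h : ∀ r, (∀ γ : Γ, γ • r = r) → φ r = ψ r) (s : R) : ∃ γ : Γ, φ s = ψ (γ • s) := by
  have h₁ : (MulSemiringAction.charpoly Γ s).eval₂ φ (φ s) = 0 := by
    rw [Polynomial.eval₂_at_apply, MulSemiringAction.eval_charpoly, map_zero]
  have h₂ : (MulSemiringAction.charpoly Γ s).map φ = (MulSemiringAction.charpoly Γ s).map ψ :=
    Polynomial.ext fun n => by
      rw [Polynomial.coeff_map, Polynomial.coeff_map]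
      exact h _ fun γ => MulSemiringAction.smul_coeff_charpoly s n γ
  rw [← Polynomial.eval_map, h₂, Polynomial.eval_map, MulSemiringAction.charpoly,
    Polynomial.eval₂_finsetProd, Finset.prod_eq_zero_iff] at h₁
  obtain ⟨γ, -, hγ⟩ := h₁
  rw [Polynomial.eval₂_sub, Polynomial.eval₂_X, Polynomial.eval₂_C, sub_eq_zero] at hγ
  exact ⟨γ, hγ⟩

theorem exists_forall_smul_eq_of_eq_on_fixed {Γ R D : Type*} [Group Γ] [Fintype Γ] [CommRing R]
    [MulSemiringAction Γ R] [CommRing D] [IsDomain D] (φ ψ : R →+* D)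
    (h : ∀ r, (∀ γ : Γ, γ • r = r) → φ r = ψ r) {n : ℕ} (x : Fin n → R) :
    ∃ γ : Γ, ∀ i, φ (x i) = ψ (γ • x i) := by
  obtain ⟨γ, hγ⟩ := exists_smul_eq_of_eq_on_fixed (Γ := Γ) (Polynomial.mapRingHom φ)
    (Polynomial.mapRingHom ψ) (fun r hr => by
      ext m
      rw [Polynomial.coe_mapRingHom, Polynomial.coe_mapRingHom, Polynomial.coeff_map,
        Polynomial.coeff_map]
      exact h _ fun γ => by rw [← Polynomial.coeff_smul, hr γ])
    (∑ i : Fin n, Polynomial.monomial (i : ℕ) (x i))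
  refine ⟨γ, fun i => ?_⟩
  have h₁ := congrArg (fun q => Polynomial.coeff q (i : ℕ)) hγ
  simpa [Polynomial.coeff_monomial, Polynomial.finsetSum_coeff, Fin.val_inj, Finset.smul_sum, apply_ite ψ]
    using h₁

variable {F : Type u} [Field F]

theorem mul_self_eq_zero_of_dvd {k : Matrix.SpecialLinearGroup (Fin 3) F}
    {l : MvPolynomial (Fin 3) F} (hl : Prime l)
    (h : ∀ i, l ∣ polyAct (k : Matrix (Fin 3) (Fin 3) F) (X i) - X i) :
    ((k : Matrix (Fin 3) (Fin 3) F) - 1) * ((k : Matrix (Fin 3) (Fin 3) F) - 1) = 0 := by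
  choose q hq using h
  have hdeg : 0 < l.totalDegree := by
    rw [Nat.pos_iff_ne_zero]
    intro h₀
    rw [totalDegree_eq_zero_iff_eq_C] at h₀
    refine hl.not_isUnit ?_
    rw [h₀]
    refine IsUnit.map C (isUnit_iff_ne_zero.2 fun h₁ => hl.ne_zero ?_)
    rw [h₀, h₁, map_zero]
  have hconst : ∀ i, ∃ c, q i = C c := by
    intro i
    by_cases h₀ : q i = 0
    · exact ⟨0, by rw [h₀, map_zero]⟩
    refine ⟨_, totalDegree_eq_zero_iff_eq_C.1 ?_⟩
    have h₁ : (l * q i).totalDegree ≤ 1 := by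
      rw [← hq i]
      refine IsHomogeneous.totalDegree_le ?_
      exact (polyAct_isHomogeneous _ (isHomogeneous_X F i)).sub (isHomogeneous_X F i)
    rw [totalDegree_mul_of_isDomain hl.ne_zero h₀] at h₁
    omega
  choose c hc using hconst
  have key : ∀ i j, ((k : Matrix (Fin 3) (Fin 3) F) - 1) i j =
      c i * coeff (Finsupp.single j 1) l := by
    intro i j
    have h₁ := congrArg (coeff (Finsupp.single j 1)) (hq i)
    rw [hc, mul_comm, coeff_C_mul, polyAct_X, coeff_sub, coeff_sum] at h₁
    rw [← h₁]
    simp [coeff_X, Matrix.one_apply, Finsupp.single_left_inj]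
  have hdet := k.det_coe
  rw [Matrix.det_fin_three] at hdet
  generalize (k : Matrix (Fin 3) (Fin 3) F) = M at key hdet ⊢
  have hM : ∀ i j, M i j = (1 : Matrix (Fin 3) (Fin 3) F) i j + c i * coeff (Finsupp.single j 1) l :=
    fun i j => by rw [← key]; simp
  have htr : ∑ i, c i * coeff (Finsupp.single i 1) l = 0 := by
    simp only [hM] at hdet
    simp [Fin.sum_univ_three] at hdet ⊢
    linear_combination hdet
  ext i j
  rw [Matrix.mul_apply]
  simp only [key]
  simp only [Fin.sum_univ_three, Matrix.zero_apply] at htr ⊢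
  linear_combination c i * coeff (Finsupp.single j 1) l * htr

theorem mem_transSubgroup_of_prime_dvd {G : Subgroup (Matrix.SpecialLinearGroup (Fin 3) F)}
    [Finite G] {k : Matrix.SpecialLinearGroup (Fin 3) F} (hk : k ∈ G)
    {l : MvPolynomial (Fin 3) F} (hl : Prime l)
    (h : ∀ f ∈ invariantRing (transSubgroup G),
      l ∣ polyAct (k : Matrix (Fin 3) (Fin 3) F) f - f) : k ∈ transSubgroup G := by
  let _ : MulSemiringAction (transSubgroup G) (MvPolynomial (Fin 3) F) :=
    { smul := fun τ f =>
        polyAct (((τ⁻¹ : transSubgroup G) : Matrix.SpecialLinearGroup (Fin 3) F) :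
          Matrix (Fin 3) (Fin 3) F) f
      one_smul := fun f => by
        change polyAct _ f = f
        simp [polyAct_one]
      mul_smul := fun σ τ f => by
        change polyAct _ f = polyAct _ (polyAct _ f)
        rw [← polyAct_mul, ← Matrix.SpecialLinearGroup.coe_mul, _root_.mul_inv_rev]
        rfl
      smul_zero := fun τ => map_zero _
      smul_add := fun τ => map_add _
      smul_one := fun τ => map_one _
      smul_mul := fun τ => map_mul _ }
  have hsmul : ∀ (τ : transSubgroup G) (f : MvPolynomial (Fin 3) F), τ • f =
    polyAct (((τ⁻¹ : transSubgroup G) : Matrix.SpecialLinearGroup (Fin 3) F) :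
          Matrix (Fin 3) (Fin 3) F) f := fun _ _ => rfl
  have : Finite (transSubgroup G) :=
    Finite.Set.subset (G : Set (Matrix.SpecialLinearGroup (Fin 3) F)) (transSubgroup_le G)
  have := Fintype.ofFinite (transSubgroup G)
  have : (Ideal.span {l}).IsPrime := (Ideal.span_singleton_prime hl.ne_zero).2 hl
  obtain ⟨τ, hτ⟩ := exists_forall_smul_eq_of_eq_on_fixed (Γ := transSubgroup G)
    ((Ideal.Quotient.mk (Ideal.span {l})).comp
      (polyAct (k : Matrix (Fin 3) (Fin 3) F)).toRingHom) (Ideal.Quotient.mk (Ideal.span {l}))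
    (fun r hr => by
      rw [← sub_eq_zero, RingHom.comp_apply, ← map_sub, Ideal.Quotient.eq_zero_iff_mem,
        Ideal.mem_span_singleton]
      refine h r (mem_invariantRing.2 fun τ hτ => ?_)
      have := hr ⟨τ⁻¹, inv_mem hτ⟩
      rw [hsmul] at this
      simpa using this) (fun i : Fin 3 => (X i : MvPolynomial (Fin 3) F))
  set t : Matrix.SpecialLinearGroup (Fin 3) F := τ.1
  have ht : t ∈ transSubgroup G := τ.2
  have hdvd : ∀ i, polyAct (t : Matrix (Fin 3) (Fin 3) F) l ∣
      polyAct ((k * t : Matrix.SpecialLinearGroup (Fin 3) F) : Matrix (Fin 3) (Fin 3) F) (X i)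
        - X i := by
    intro i
    have h₁ := hτ i
    rw [← sub_eq_zero, RingHom.comp_apply, ← map_sub, Ideal.Quotient.eq_zero_iff_mem,
      Ideal.mem_span_singleton, hsmul] at h₁
    have h₂ := map_dvd (polyAct (t : Matrix (Fin 3) (Fin 3) F)) h₁
    rw [map_sub, InvMemClass.coe_inv, polyAct_polyAct_inv] at h₂
    rw [Matrix.SpecialLinearGroup.coe_mul, polyAct_mul]
    exact h₂
  have hprime : Prime (polyAct (t : Matrix (Fin 3) (Fin 3) F) l) := by
    let e : MvPolynomial (Fin 3) F ≃* MvPolynomial (Fin 3) F :=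
      { toFun := polyAct (t : Matrix (Fin 3) (Fin 3) F)
        invFun := polyAct ((t⁻¹ : Matrix.SpecialLinearGroup (Fin 3) F) : Matrix (Fin 3) (Fin 3) F)
        left_inv := polyAct_inv_polyAct t
        right_inv := polyAct_polyAct_inv t
        map_mul' := map_mul _ }
    exact (MulEquiv.prime_iff e).2 hl
  have h₃ := mem_transSubgroup_of_mul_self_eq_zero
    (G.mul_mem hk (transSubgroup_le G ht)) (mul_self_eq_zero_of_dvd hprime hdvd)
  simpa using mul_mem h₃ (inv_mem ht)

theorem imageGroup_eq_one_of_prime_dvd {G : Subgroup (Matrix.SpecialLinearGroup (Fin 3) F)}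
    [Finite G] {ι : MvPolynomial (Fin 3) F →ₐ[F] MvPolynomial (Fin 3) F}
    (hι : Function.Injective ι)
    (hT : ∀ f, (∃ q, ι q = f) ↔ f ∈ invariantRing (transSubgroup G))
    {σ : MvPolynomial (Fin 3) F ≃ₐ[F] MvPolynomial (Fin 3) F} (hσ : σ ∈ imageGroup G ι)
    {π : MvPolynomial (Fin 3) F} (hπ : Prime π) (h : ∀ b, π ∣ σ b - b) : σ = 1 := by
  obtain ⟨k, hk, hkσ⟩ := hσ
  have h₀ : ι π ≠ 0 := fun h₀ => hπ.ne_zero (hι (by rw [h₀, map_zero]))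
  have h₁ : ¬ IsUnit (ι π) := by
    intro hu
    obtain ⟨c, hc⟩ : ∃ c, ι π = C c := by
      obtain ⟨h₁, h₂⟩ := isUnit_iff_totalDegree_of_isReduced.1 hu
      exact ⟨_, totalDegree_eq_zero_iff_eq_C.1 h₂⟩
    have h₂ : π = C c := hι (by rw [hc, ← MvPolynomial.algebraMap_eq, AlgHom.commutes])
    refine hπ.not_isUnit ?_
    rw [h₂]
    refine IsUnit.map C (isUnit_iff_ne_zero.2 fun h₁ => hπ.ne_zero ?_)
    rw [h₂, h₁, map_zero]
  obtain ⟨l, hl, hlπ⟩ := WfDvdMonoid.exists_irreducible_factor h₁ h₀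
  have hkT := mem_transSubgroup_of_prime_dvd hk hl.prime fun f hf => by
    obtain ⟨q, rfl⟩ := (hT f).2 hf
    rw [← hkσ, ← map_sub]
    exact hlπ.trans (map_dvd ι (h q))
  refine AlgEquiv.ext fun b => hι ?_
  rw [hkσ, mem_invariantRing.1 ((hT _).1 ⟨b, rfl⟩) k hkT, AlgEquiv.one_apply]

end

section

theorem IsNoetherianRing.injective_of_surjective {R : Type*} [CommRing R] [IsNoetherianRing R]
    (f : R →+* R) (hf : Function.Surjective f) : Function.Injective f := by
  have hmono : Monotone fun n : ℕ => RingHom.ker (f ^ n) := by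
    refine monotone_nat_of_le_succ fun n x hx => ?_
    rw [RingHom.mem_ker] at hx ⊢
    rw [pow_succ', RingHom.mul_def, RingHom.comp_apply, hx, map_zero]
  obtain ⟨n, hn⟩ := monotone_stabilizes_iff_noetherian.2 ‹_› ⟨_, hmono⟩
  rw [injective_iff_map_eq_zero]
  intro x hx
  obtain ⟨y, rfl⟩ : ∃ y, (f ^ n) y = x := by
    rw [RingHom.coe_pow]
    exact hf.iterate n x
  have h₁ : y ∈ RingHom.ker (f ^ (n + 1)) := by
    rw [RingHom.mem_ker, pow_succ', RingHom.mul_def, RingHom.comp_apply, hx]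
  have h₂ := hn (n + 1) (Nat.le_succ n)
  simp only [OrderHom.coe_mk] at h₂
  rw [← h₂] at h₁
  exact h₁

variable {F : Type u} [Field F]

theorem coeff_single_one_mul {σ : Type*} (p q : MvPolynomial σ F) (k : σ) :
    coeff (Finsupp.single k 1) (p * q) =
      coeff (Finsupp.single k 1) p * constantCoeff q +
        constantCoeff p * coeff (Finsupp.single k 1) q := by
  classical
  rw [coeff_mul, Finsupp.antidiagonal_single, Finset.sum_map]
  rw [show Finset.HasAntidiagonal.antidiagonal (1 : ℕ) = ({(0, 1), (1, 0)} : Finset (ℕ × ℕ)) from rfl]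
  rw [Finset.sum_insert (by simp), Finset.sum_singleton]
  simp [constantCoeff_eq, add_comm]

theorem coeff_single_one_aeval {σ τ : Type*} [Fintype σ] (γ : σ → MvPolynomial τ F)
    (hγ : ∀ j, constantCoeff (γ j) = 0) (q : MvPolynomial σ F) (k : τ) :
    coeff (Finsupp.single k 1) (aeval γ q) =
      ∑ j, coeff (Finsupp.single j 1) q * coeff (Finsupp.single k 1) (γ j) := by
  classical
  have hconst : ∀ q : MvPolynomial σ F, constantCoeff (aeval γ q) = constantCoeff q := by
    intro q
    induction q using MvPolynomial.induction_on with
    | C a => simp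
    | add p q hp hq => rw [map_add, map_add, map_add, hp, hq]
    | mul_X p i hp => rw [map_mul, map_mul, map_mul, aeval_X, hγ, constantCoeff_X, mul_zero, mul_zero]
  induction q using MvPolynomial.induction_on with
  | C a =>
    rw [← MvPolynomial.algebraMap_eq, AlgHom.commutes, MvPolynomial.algebraMap_eq,
      MvPolynomial.algebraMap_eq, coeff_C, if_neg (by simp [eq_comm])]
    exact (Finset.sum_eq_zero fun j _ => by
      rw [coeff_C, if_neg (by simp [eq_comm]), zero_mul]).symm
  | add p q hp hq =>
    rw [map_add, coeff_add, hp, hq, ← Finset.sum_add_distrib]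
    exact Finset.sum_congr rfl fun j _ => by rw [coeff_add, add_mul]
  | mul_X p i hp =>
    rw [map_mul, coeff_single_one_mul, aeval_X, hγ, mul_zero, zero_add, hconst]
    simp only [coeff_single_one_mul, constantCoeff_X, mul_zero, zero_add]
    rw [Finset.sum_eq_single i]
    · simp
    · intro j _ hj
      rw [coeff_X, if_neg, mul_zero, zero_mul]
      simpa [Finsupp.single_left_inj] using hj.symm
    · simp

theorem isWeightedHomogeneous_constantCoeff {σ : Type*} {w : σ → ℕ} {q : MvPolynomial σ F} {n : ℕ}
    (hq : IsWeightedHomogeneous w q n) (hn : 0 < n) : constantCoeff q = 0 := by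
  rw [constantCoeff_eq]
  refine hq.coeff_eq_zero _ ?_
  simpa using hn.ne

/-- The matrix of linear coefficients of an automorphism of a polynomial ring. -/
def linCoeff (σ : MvPolynomial (Fin 3) F ≃ₐ[F] MvPolynomial (Fin 3) F) : Matrix (Fin 3) (Fin 3) F :=
  Matrix.of fun i j => coeff (Finsupp.single j 1) (σ (X i))

namespace TransInvariants

variable {G : Subgroup (Matrix.SpecialLinearGroup (Fin 3) F)} (I : TransInvariants G)

theorem isHomogeneous_α {q : MvPolynomial (Fin 3) F} {n : ℕ}
    (hq : IsWeightedHomogeneous I.d q n) : (I.α q).IsHomogeneous n := by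
  rw [α, aeval_def, eval₂_eq]
  refine IsHomogeneous.sum _ _ _ fun m hm => ?_
  have h₁ : (∏ i ∈ m.support, I.a i ^ m i).IsHomogeneous (∑ i ∈ m.support, I.d i * m i) :=
    IsHomogeneous.prod _ _ _ fun i _ => (I.hom i).pow (m i)
  have h₂ : ∑ i ∈ m.support, I.d i * m i = n := by
    rw [← hq (mem_support_iff.1 hm), Finsupp.weight_apply, Finsupp.sum]
    exact Finset.sum_congr rfl fun i _ => by rw [smul_eq_mul, mul_comm]
  rw [h₂] at h₁
  simpa using (isHomogeneous_C (Fin 3) (coeff m q)).mul h₁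

theorem isWeightedHomogeneous_of_α {q : MvPolynomial (Fin 3) F} {n : ℕ}
    (hq : (I.α q).IsHomogeneous n) : IsWeightedHomogeneous I.d q n := by
  classical
  have key : ∀ m, homogeneousComponent m (I.α q) = I.α (weightedHomogeneousComponent I.d m q) := by
    intro m
    have h₁ : q = ∑ k ∈ Finset.range (weightedTotalDegree I.d q + m + 1),
        weightedHomogeneousComponent I.d k q := by
      ext c
      rw [coeff_sum]
      simp only [coeff_weightedHomogeneousComponent]
      rw [Finset.sum_ite_eq]
      split_ifs with h
      · rfl
      · by_contra h₀
        have := le_weightedTotalDegree I.d (mem_support_iff.2 h₀)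
        simp at h
        omega
    conv_lhs => rw [h₁, map_sum, map_sum]
    rw [Finset.sum_eq_single m]
    · rw [homogeneousComponent_of_mem (I.isHomogeneous_α
        (weightedHomogeneousComponent_isWeightedHomogeneous m q)), if_pos rfl]
    · intro k _ hk
      rw [homogeneousComponent_of_mem (I.isHomogeneous_α
        (weightedHomogeneousComponent_isWeightedHomogeneous k q)), if_neg hk.symm]
    · intro h
      simp at h
  intro c hc
  by_contra hne
  have h₁ := key (Finsupp.weight I.d c)
  rw [homogeneousComponent_of_mem hq, if_neg hne, eq_comm] at h₁
  have h₂ : weightedHomogeneousComponent I.d (Finsupp.weight I.d c) q = 0 :=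
    I.α_injective (by rw [h₁, map_zero])
  have h₃ := congrArg (coeff c) h₂
  rw [coeff_weightedHomogeneousComponent, if_pos rfl] at h₃
  exact hc h₃

variable {σ τ : MvPolynomial (Fin 3) F ≃ₐ[F] MvPolynomial (Fin 3) F}

theorem isWeightedHomogeneous_imageGroup (hσ : σ ∈ imageGroup G I.α) (i : Fin 3) :
    IsWeightedHomogeneous I.d (σ (X i)) (I.d i) := by
  obtain ⟨g, -, hg⟩ := hσ
  refine I.isWeightedHomogeneous_of_α ?_
  rw [hg, α_X]
  exact polyAct_isHomogeneous _ (I.hom i)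

theorem linCoeff_mul (hσ : σ ∈ imageGroup G I.α) :
    linCoeff (σ * τ) = linCoeff τ * linCoeff σ := by
  ext i k
  have h₀ : (σ : MvPolynomial (Fin 3) F →ₐ[F] MvPolynomial (Fin 3) F) =
      aeval (fun j => σ (X j)) :=
    MvPolynomial.algHom_ext fun i => by rw [aeval_X]; rfl
  have h₁ : ∀ q, σ q = aeval (fun j => σ (X j)) q := fun q => by
    rw [← h₀]
    rfl
  rw [linCoeff, Matrix.of_apply, AlgEquiv.mul_apply, h₁, coeff_single_one_aeval, Matrix.mul_apply]
  · rfl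
  · exact fun j => isWeightedHomogeneous_constantCoeff
      (I.isWeightedHomogeneous_imageGroup hσ j) (I.d_pos j)

theorem linCoeff_one : linCoeff (1 : MvPolynomial (Fin 3) F ≃ₐ[F] MvPolynomial (Fin 3) F) = 1 := by
  ext i k
  rw [linCoeff, Matrix.of_apply, AlgEquiv.one_apply, coeff_X, Matrix.one_apply]
  simp [Finsupp.single_left_inj]

theorem linCoeff_mul_inv (hσ : σ ∈ imageGroup G I.α) : linCoeff σ⁻¹ * linCoeff σ = 1 := by
  rw [← I.linCoeff_mul hσ, mul_inv_cancel, linCoeff_one]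

theorem d_eq_of_linCoeff_ne_zero (hσ : σ ∈ imageGroup G I.α) {i j : Fin 3}
    (h : linCoeff σ i j ≠ 0) : I.d j = I.d i := by
  have := I.isWeightedHomogeneous_imageGroup hσ i h
  rwa [Finsupp.weight_single, one_smul] at this

theorem imageGroup_X_zero {g : Matrix.SpecialLinearGroup (Fin 3) F} (hgG : g ∈ G)
    (hg : ∀ b, I.α (σ b) = polyAct (g : Matrix (Fin 3) (Fin 3) F) (I.α b)) :
    σ (X 0) = C ((g : Matrix (Fin 3) (Fin 3) F) 0 0) * X 0 := by
  refine I.α_injective ?_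
  rw [hg, α_X_zero, (I.isBlock g hgG).polyAct_X_zero, ← MvPolynomial.smul_eq_C_mul, map_smul,
    α_X_zero]

theorem killZero_imageGroup_X (hσ : σ ∈ imageGroup G I.α) {i : Fin 3} (hi : i ≠ 0) :
    killZero (σ (X i)) = σ (X i) := by
  obtain ⟨g, hgG, hg⟩ := hσ
  refine I.α_injective ?_
  rw [← I.killZero_α, hg, α_X, (I.isBlock g hgG).killZero_polyAct]
  congr 1
  fin_cases i
  · exact absurd rfl hi
  · exact I.killZero_a_one
  · exact I.killZero_a_two

theorem coeff_killZero (q : MvPolynomial (Fin 3) F) :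
    coeff (Finsupp.single 0 1) (killZero q) = 0 := by
  rw [killZero, coeff_single_one_aeval]
  · simp [Fin.sum_univ_three, coeff_X, Finsupp.single_left_inj]
  · intro j
    fin_cases j <;> simp

theorem isBlock_linCoeff (hσ : σ ∈ imageGroup G I.α) : IsBlock (linCoeff σ) := by
  obtain ⟨g, hgG, hg⟩ := id hσ
  have h₀ := I.imageGroup_X_zero hgG hg
  constructor
  · rw [linCoeff, Matrix.of_apply, h₀]
    simp [coeff_C_mul, coeff_X, Finsupp.single_left_inj]
  · rw [linCoeff, Matrix.of_apply, h₀]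
    simp [coeff_C_mul, coeff_X, Finsupp.single_left_inj]
  · rw [linCoeff, Matrix.of_apply, ← I.killZero_imageGroup_X hσ (by decide), coeff_killZero]
  · rw [linCoeff, Matrix.of_apply, ← I.killZero_imageGroup_X hσ (by decide), coeff_killZero]

theorem linCoeff_zero_zero {g : Matrix.SpecialLinearGroup (Fin 3) F} (hgG : g ∈ G)
    (hg : ∀ b, I.α (σ b) = polyAct (g : Matrix (Fin 3) (Fin 3) F) (I.α b)) :
    linCoeff σ 0 0 = (g : Matrix (Fin 3) (Fin 3) F) 0 0 := by
  rw [linCoeff, Matrix.of_apply, I.imageGroup_X_zero hgG hg]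
  simp [coeff_C_mul]

end TransInvariants

end

section

variable {F : Type u} [Field F]

theorem sum_C_mul_sum_eq {Γ ν τ : Type*} [Fintype Γ] [Fintype ν] (c : F) (L : Matrix ν ν F)
    (N : Γ → Matrix ν ν F) (x : Γ → ν → MvPolynomial τ F) (i : ν) :
    ∑ k, C (L i k) * (C c * ∑ σ, ∑ j, C (N σ k j) * x σ j) =
      C c * ∑ σ, ∑ j, C ((L * N σ) i j) * x σ j := by
  simp only [mul_left_comm (C (L i _)) (C c) _]
  rw [← Finset.mul_sum]
  congr 1
  simp only [Finset.mul_sum]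
  rw [Finset.sum_comm]
  refine Finset.sum_congr rfl fun σ _ => ?_
  rw [Finset.sum_comm]
  refine Finset.sum_congr rfl fun j _ => ?_
  rw [Matrix.mul_apply, map_sum, Finset.sum_mul]
  refine Finset.sum_congr rfl fun k _ => ?_
  rw [map_mul, mul_assoc]

namespace TransInvariants

variable {G : Subgroup (Matrix.SpecialLinearGroup (Fin 3) F)} (I : TransInvariants G)

section average

variable [Fintype (imageGroup G I.α)]

/-- Averaging over the image group produces generators on which the group acts linearly. -/
def β (i : Fin 3) : MvPolynomial (Fin 3) F :=
  C (Fintype.card (imageGroup G I.α) : F)⁻¹ *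
    ∑ σ : imageGroup G I.α, ∑ j, C (linCoeff σ.1⁻¹ i j) * σ.1 (X j)

theorem imageGroup_β (ρ : imageGroup G I.α) (i : Fin 3) :
    ρ.1 (I.β i) = ∑ k, C (linCoeff ρ.1 i k) * I.β k := by
  have hC : ∀ c : F, ρ.1 (C c) = C c := fun c => ρ.1.commutes c
  calc ρ.1 (I.β i) = C (Fintype.card (imageGroup G I.α) : F)⁻¹ *
        ∑ σ : imageGroup G I.α, ∑ j, C (linCoeff σ.1⁻¹ i j) * (ρ * σ).1 (X j) := by
        simp only [β, map_mul, map_sum, hC]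
        rfl
    _ = C (Fintype.card (imageGroup G I.α) : F)⁻¹ *
        ∑ σ : imageGroup G I.α, ∑ j, C (linCoeff (ρ⁻¹ * σ).1⁻¹ i j) * σ.1 (X j) := by
        congr 1
        refine Fintype.sum_equiv (Equiv.mulLeft ρ) _ _ fun σ => ?_
        simp
    _ = ∑ k, C (linCoeff ρ.1 i k) * I.β k := by
        rw [show (fun k => C (linCoeff ρ.1 i k) * I.β k) = fun k => C (linCoeff ρ.1 i k) *
          (C (Fintype.card (imageGroup G I.α) : F)⁻¹ *
            ∑ σ : imageGroup G I.α, ∑ j, C (linCoeff σ.1⁻¹ k j) * σ.1 (X j)) from rfl,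
          sum_C_mul_sum_eq]
        refine congrArg _ (Finset.sum_congr rfl fun σ _ => Finset.sum_congr rfl fun j _ => ?_)
        rw [← I.linCoeff_mul (inv_mem σ.2)]
        have h : (ρ⁻¹ * σ).1⁻¹ = σ.1⁻¹ * ρ.1 := by simp
        rw [h]

theorem isWeightedHomogeneous_β (i : Fin 3) : IsWeightedHomogeneous I.d (I.β i) (I.d i) := by
  refine (IsWeightedHomogeneous.sum _ _ _ fun σ _ => IsWeightedHomogeneous.sum _ _ _
    fun j _ => ?_).C_mul _
  by_cases h : linCoeff σ.1⁻¹ i j = 0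
  · rw [h, map_zero, zero_mul]
    exact isWeightedHomogeneous_zero _ _ _
  · rw [← I.d_eq_of_linCoeff_ne_zero (inv_mem σ.2) h]
    exact (I.isWeightedHomogeneous_imageGroup σ.2 j).C_mul _

theorem coeff_β (hcard : (Fintype.card (imageGroup G I.α) : F) ≠ 0) (i k : Fin 3) :
    coeff (Finsupp.single k 1) (I.β i) = if i = k then 1 else 0 := by
  have h : ∀ σ : imageGroup G I.α,
      ∑ j, linCoeff σ.1⁻¹ i j * coeff (Finsupp.single k 1) (σ.1 (X j)) =
        (1 : Matrix (Fin 3) (Fin 3) F) i k := fun σ => by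
    rw [← I.linCoeff_mul_inv σ.2, Matrix.mul_apply]
    rfl
  simp only [β, coeff_C_mul, coeff_sum, h]
  rw [Finset.sum_const, Finset.card_univ, nsmul_eq_mul, inv_mul_cancel_left₀ hcard,
    Matrix.one_apply]

theorem d_lt_of_mem_support (hcard : (Fintype.card (imageGroup G I.α) : F) ≠ 0) {i : Fin 3}
    {m : Fin 3 →₀ ℕ} (hm : m ∈ (X i - I.β i).support) {j : Fin 3} (hj : j ∈ m.support) :
    I.d j < I.d i := by
  have hw : IsWeightedHomogeneous I.d (X i - I.β i) (I.d i) :=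
    (isWeightedHomogeneous_X F I.d i).sub (I.isWeightedHomogeneous_β i)
  have h₁ := hw (mem_support_iff.1 hm)
  have hle : Finsupp.single j 1 ≤ m := by
    rw [Finsupp.single_le_iff]
    exact Nat.one_le_iff_ne_zero.2 (Finsupp.mem_support_iff.1 hj)
  obtain ⟨m', rfl⟩ := exists_add_of_le hle
  rw [map_add, Finsupp.weight_single, one_smul] at h₁
  have h₂ : m' ≠ 0 := by
    rintro rfl
    rw [mem_support_iff, add_zero, coeff_sub, I.coeff_β hcard, coeff_X] at hm
    exact hm (by simp [Finsupp.single_left_inj])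
  have h₃ : Finsupp.weight I.d m' ≠ 0 := by
    obtain ⟨k, hk⟩ := Finsupp.ne_iff.1 h₂
    have := Finsupp.le_weight I.d (s := k) (I.d_pos k).ne' m'
    have hk' : m' k ≠ 0 := hk
    omega
  omega

theorem X_mem_range (hcard : (Fintype.card (imageGroup G I.α) : F) ≠ 0) (i : Fin 3) :
    X i ∈ (aeval I.β : MvPolynomial (Fin 3) F →ₐ[F] MvPolynomial (Fin 3) F).range := by
  induction hn : I.d i using Nat.strong_induction_on generalizing i with
  | _ n ih =>
    have h₁ : X i - I.β i ∈
        (aeval I.β : MvPolynomial (Fin 3) F →ₐ[F] MvPolynomial (Fin 3) F).range := by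
      rw [MvPolynomial.as_sum (X i - I.β i)]
      refine sum_mem fun m hm => ?_
      rw [monomial_eq]
      refine mul_mem (Subalgebra.algebraMap_mem _ _) (prod_mem fun j hj => pow_mem ?_ _)
      exact ih _ (hn ▸ I.d_lt_of_mem_support hcard hm hj) j rfl
    have h₂ := add_mem h₁ (⟨X i, aeval_X _ _⟩ : I.β i ∈
      (aeval I.β : MvPolynomial (Fin 3) F →ₐ[F] MvPolynomial (Fin 3) F).range)
    rwa [sub_add_cancel] at h₂

theorem aeval_β_surjective (hcard : (Fintype.card (imageGroup G I.α) : F) ≠ 0) :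
    Function.Surjective (aeval I.β : MvPolynomial (Fin 3) F →ₐ[F] MvPolynomial (Fin 3) F) := by
  intro q
  rw [← AlgHom.mem_range]
  have h : Algebra.adjoin F (Set.range X) ≤
      (aeval I.β : MvPolynomial (Fin 3) F →ₐ[F] MvPolynomial (Fin 3) F).range :=
    Algebra.adjoin_le (by rintro _ ⟨i, rfl⟩; exact I.X_mem_range hcard i)
  rw [adjoin_range_X] at h
  exact h trivial

theorem aeval_β_injective (hcard : (Fintype.card (imageGroup G I.α) : F) ≠ 0) :
    Function.Injective (aeval I.β : MvPolynomial (Fin 3) F →ₐ[F] MvPolynomial (Fin 3) F) :=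
  IsNoetherianRing.injective_of_surjective
    (aeval I.β : MvPolynomial (Fin 3) F →ₐ[F] MvPolynomial (Fin 3) F).toRingHom
    (I.aeval_β_surjective hcard)

/-- The embedding of the polynomial ring onto the `T(G)`-invariants for which the image group acts
linearly. -/
def ι : MvPolynomial (Fin 3) F →ₐ[F] MvPolynomial (Fin 3) F := I.α.comp (aeval I.β)

theorem ι_injective (hcard : (Fintype.card (imageGroup G I.α) : F) ≠ 0) :
    Function.Injective I.ι := I.α_injective.comp (I.aeval_β_injective hcard)

theorem exists_ι_eq_iff (hcard : (Fintype.card (imageGroup G I.α) : F) ≠ 0)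
    {f : MvPolynomial (Fin 3) F} :
    (∃ q, I.ι q = f) ↔ f ∈ invariantRing (transSubgroup G) := by
  rw [← I.exists_α_eq_iff]
  constructor
  · rintro ⟨q, rfl⟩
    exact ⟨_, rfl⟩
  · rintro ⟨q, rfl⟩
    obtain ⟨q, rfl⟩ := I.aeval_β_surjective hcard q
    exact ⟨q, rfl⟩

theorem imageGroup_ι_X (hcard : (Fintype.card (imageGroup G I.α) : F) ≠ 0)
    {g : Matrix.SpecialLinearGroup (Fin 3) F}
    {σ τ : MvPolynomial (Fin 3) F ≃ₐ[F] MvPolynomial (Fin 3) F} (hgG : g ∈ G)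
    (hσ : ∀ b, I.α (σ b) = polyAct (g : Matrix (Fin 3) (Fin 3) F) (I.α b))
    (hτ : ∀ b, I.ι (τ b) = polyAct (g : Matrix (Fin 3) (Fin 3) F) (I.ι b)) (i : Fin 3) :
    τ (X i) = ∑ j, C (linCoeff σ i j) * X j := by
  refine I.aeval_β_injective hcard (I.α_injective ?_)
  have h₁ := hτ (X i)
  rw [ι, AlgHom.comp_apply, AlgHom.comp_apply, aeval_X, ← hσ,
    I.imageGroup_β ⟨σ, g, hgG, hσ⟩] at h₁
  rw [h₁]
  simp only [map_sum, map_mul, aeval_X, aeval_C, MvPolynomial.algebraMap_eq]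

end average

end TransInvariants

end

section

variable {F : Type u} [Field F]

/-- If `ι` embeds the polynomial ring onto the `T(G)`-invariants, then the invariant ring of `G` is
the ring of fixed points of the image group. -/
def fixedEquivInvariantRing {G : Subgroup (Matrix.SpecialLinearGroup (Fin 3) F)}
    {ι : MvPolynomial (Fin 3) F →ₐ[F] MvPolynomial (Fin 3) F} (hι : Function.Injective ι)
    (hT : ∀ f, (∃ q, ι q = f) ↔ f ∈ invariantRing (transSubgroup G)) :
    PolyFix F (imageGroup G ι) ≃+* invariantRing G := by
  have hG : ∀ g ∈ G, ∀ b, ∃ q, ι q = polyAct (g : Matrix (Fin 3) (Fin 3) F) (ι b) :=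
    fun g hg b => (hT _).2 (TransInvariants.polyAct_mem_invariantRing hg ((hT _).1 ⟨b, rfl⟩))
  have h₁ : ∀ q : PolyFix F (imageGroup G ι), ι q.1 ∈ invariantRing G := by
    intro q
    rw [mem_invariantRing]
    intro g hg
    obtain ⟨σ, hσ⟩ := exists_imageGroup hι hG hg
    rw [← hσ]
    exact congrArg ι (q.2 σ)
  refine RingEquiv.ofBijective
    ((ι.toRingHom.comp (PolyFix F (imageGroup G ι)).val.toRingHom).codRestrict
      (invariantRing G) h₁) ⟨fun q r h => ?_, fun f => ?_⟩
  · exact Subtype.ext (hι (congrArg Subtype.val h))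
  · obtain ⟨q, hq⟩ := (hT f.1).2 (by
      rw [mem_invariantRing]
      exact fun g hg => mem_invariantRing.1 f.2 g (transSubgroup_le G hg))
    refine ⟨⟨q, fun σ => hι ?_⟩, Subtype.ext hq⟩
    obtain ⟨g, hg, hσ⟩ := σ.2
    refine (hσ q).trans ?_
    rw [hq]
    exact mem_invariantRing.1 f.2 g hg

namespace TransInvariants

variable {G : Subgroup (Matrix.SpecialLinearGroup (Fin 3) F)} (I : TransInvariants G)

theorem exists_imageGroup_α {g : Matrix.SpecialLinearGroup (Fin 3) F} (hg : g ∈ G) :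
    ∃ σ : imageGroup G I.α, ∀ b, I.α (σ.1 b) = polyAct (g : Matrix (Fin 3) (Fin 3) F) (I.α b) :=
  exists_imageGroup I.α_injective (fun _ hg b => I.exists_α_eq_iff.2
    (polyAct_mem_invariantRing hg (I.exists_α_eq_iff.1 ⟨b, rfl⟩))) hg

theorem isGorensteinRing_iff {p : ℕ} [Fact p.Prime] [CharP F p] [Finite G] :
    IsGorensteinRing (invariantRing G) ↔ ∀ g ∈ G, ∀ σ : imageGroup G I.α,
      (∀ b, I.α (σ.1 b) = polyAct (g : Matrix (Fin 3) (Fin 3) F) (I.α b)) →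
        (g : Matrix (Fin 3) (Fin 3) F) 0 0 *
          ((linCoeff σ.1).submatrix Fin.succ Fin.succ : Matrix (Fin 2) (Fin 2) F).det = 1 := by
  have := finite_imageGroup (G := G) I.α_injective
  have : Fintype (imageGroup G I.α) := Fintype.ofFinite _
  have hcard : (Fintype.card (imageGroup G I.α) : F) ≠ 0 := by
    rw [← Nat.card_eq_fintype_card]
    exact card_imageGroup_ne_zero (p := p) I.α_injective I.isBlock
      fun q => I.exists_α_eq_iff.1 ⟨q, rfl⟩
  have hι := I.ι_injective hcard
  have hT : ∀ f, (∃ q, I.ι q = f) ↔ f ∈ invariantRing (transSubgroup G) :=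
    fun _ => I.exists_ι_eq_iff hcard
  have := finite_imageGroup (G := G) hι
  have : Fintype (imageGroup G I.ι) := Fintype.ofFinite _
  have hcard' : (Fintype.card (imageGroup G I.ι) : F) ≠ 0 := by
    rw [← Nat.card_eq_fintype_card]
    exact card_imageGroup_ne_zero (p := p) hι I.isBlock fun q => (hT _).1 ⟨q, rfl⟩
  choose γ hγG hγ using fun τ : imageGroup G I.ι => τ.2
  choose s hs using fun τ => I.exists_imageGroup_α (hγG τ)
  have hX : ∀ τ i, τ.1 (X i) = ∑ j, C (linCoeff (s τ).1 i j) * X j := fun τ i =>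
    I.imageGroup_ι_X hcard (hγG τ) (hs τ) (hγ τ) i
  have hB : ∀ τ, IsBlock (linCoeff (s τ).1) := fun τ => I.isBlock_linCoeff (s τ).2
  let A : PlaneAction F (imageGroup G I.ι) :=
    { χ := fun τ => linCoeff (s τ).1 0 0
      c := fun τ => (linCoeff (s τ).1).submatrix Fin.succ Fin.succ
      smul_X_zero := fun τ => by
        refine (hX τ 0).trans ?_
        rw [Fin.sum_univ_three, (hB τ).zero_one, (hB τ).zero_two]
        simp
      smul_X_one := fun τ => by
        refine (hX τ 1).trans ?_
        rw [Fin.sum_univ_three, (hB τ).one_zero]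
        simp
      smul_X_two := fun τ => by
        refine (hX τ 2).trans ?_
        rw [Fin.sum_univ_three, (hB τ).two_zero]
        simp }
  have key : IsGorensteinRing (invariantRing G) ↔ IsGorensteinRing (PolyFix F (imageGroup G I.ι)) :=
    ⟨IsGorensteinRing.of_ringEquiv (fixedEquivInvariantRing hι hT).symm,
      IsGorensteinRing.of_ringEquiv (fixedEquivInvariantRing hι hT)⟩
  rw [key, A.isGorensteinRing_iff hcard' fun τ π hπ h => Subtype.ext
    (imageGroup_eq_one_of_prime_dvd hι hT τ.2 hπ h)]
  constructor
  · intro h g hg σ hσ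
    obtain ⟨τ, hτ⟩ := exists_imageGroup hι (fun g hg b => (hT _).2
      (polyAct_mem_invariantRing hg ((hT _).1 ⟨b, rfl⟩))) hg
    have h₁ : linCoeff (s τ).1 = linCoeff σ.1 := by
      ext i j
      have h₂ := (hX τ i).symm.trans (I.imageGroup_ι_X hcard hg hσ hτ i)
      have h₃ := congrArg (coeff (Finsupp.single j 1)) h₂
      simpa [coeff_sum, coeff_C_mul, coeff_X, Finsupp.single_left_inj] using h₃
    have h₂ := h τ
    simp only [A, h₁] at h₂
    rwa [I.linCoeff_zero_zero hg hσ] at h₂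
  · intro h τ
    have := h (γ τ) (hγG τ) (s τ) (hs τ)
    rwa [← I.linCoeff_zero_zero (hγG τ) (hs τ)] at this

end TransInvariants

end

section

variable {F : Type u} [Field F]

theorem exists_eq_linear_add_quadratic (q : MvPolynomial (Fin 2) F) :
    ∃ (k l₀ l₁ : F) (r s t : MvPolynomial (Fin 2) F), q = C k + C l₀ * X 0 + C l₁ * X 1 +
      (r * (X 0 * X 0) + s * (X 0 * X 1) + t * (X 1 * X 1)) := by
  induction q using MvPolynomial.induction_on with
  | C a => exact ⟨a, 0, 0, 0, 0, 0, by simp⟩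
  | add p q hp hq =>
    obtain ⟨k, l₀, l₁, r, s, t, hp⟩ := hp
    obtain ⟨k', l₀', l₁', r', s', t', hq⟩ := hq
    refine ⟨k + k', l₀ + l₀', l₁ + l₁', r + r', s + s', t + t', ?_⟩
    rw [hp, hq]
    simp only [map_add]
    ring
  | mul_X p i hp =>
    obtain ⟨k, l₀, l₁, r, s, t, hp⟩ := hp
    fin_cases i
    · refine ⟨0, k, 0, C l₀ + r * X 0, C l₁ + s * X 0, t * X 0, ?_⟩
      rw [hp]
      simp only [map_zero, Fin.zero_eta]
      ring
    · refine ⟨0, 0, k, r * X 1, C l₀ + s * X 1, C l₁ + t * X 1, ?_⟩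
      rw [hp]
      simp only [map_zero, Fin.mk_one]
      ring

theorem coeff_single_one_quadratic {σ : Type*} (r s t : MvPolynomial σ F) (i j k : σ) :
    coeff (Finsupp.single k 1) (r * (X i * X i) + s * (X i * X j) + t * (X j * X j)) = 0 := by
  simp [coeff_single_one_mul]

theorem constantCoeff_quadratic {σ : Type*} (r s t : MvPolynomial σ F) (i j : σ) :
    constantCoeff (r * (X i * X i) + s * (X i * X j) + t * (X j * X j)) = 0 := by
  simp

namespace TransInvariants

variable {G : Subgroup (Matrix.SpecialLinearGroup (Fin 3) F)} (I : TransInvariants G)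

theorem mem_adjoin_iff {f : MvPolynomial (Fin 3) F} :
    f ∈ Algebra.adjoin F {I.a 1, I.a 2} ↔ ∃ q : MvPolynomial (Fin 2) F,
      I.α (rename Fin.succ q) = f := by
  have h : ({I.a 1, I.a 2} : Set (MvPolynomial (Fin 3) F)) = Set.range ![I.a 1, I.a 2] := by
    rw [Matrix.range_cons, Matrix.range_cons, Matrix.range_empty, Set.union_empty]
    rfl
  rw [h, Algebra.adjoin_range_eq_range_aeval]
  simp only [α_rename]
  rfl

theorem exists_quadratic_iff {g : Matrix.SpecialLinearGroup (Fin 3) F} (hg : g ∈ G)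
    {σ : MvPolynomial (Fin 3) F ≃ₐ[F] MvPolynomial (Fin 3) F}
    (hσ : ∀ b, I.α (σ b) = polyAct (g : Matrix (Fin 3) (Fin 3) F) (I.α b)) {i : Fin 3}
    (hi : i ≠ 0) (x y : F) :
    (∃ r s t : MvPolynomial (Fin 3) F, r ∈ Algebra.adjoin F {I.a 1, I.a 2} ∧
      s ∈ Algebra.adjoin F {I.a 1, I.a 2} ∧ t ∈ Algebra.adjoin F {I.a 1, I.a 2} ∧
      polyAct (g : Matrix (Fin 3) (Fin 3) F) (I.a i) - (x • I.a 1 + y • I.a 2) =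
        r * (I.a 1 * I.a 1) + s * (I.a 1 * I.a 2) + t * (I.a 2 * I.a 2)) ↔
      x = linCoeff σ i 1 ∧ y = linCoeff σ i 2 := by
  have hσG : σ ∈ imageGroup G I.α := ⟨g, hg, hσ⟩
  have hact : polyAct (g : Matrix (Fin 3) (Fin 3) F) (I.a i) = I.α (σ (X i)) := by
    rw [hσ, α_X]
  constructor
  · rintro ⟨r, s, t, hr, hs, ht, h⟩
    obtain ⟨r, rfl⟩ := I.mem_adjoin_iff.1 hr
    obtain ⟨s, rfl⟩ := I.mem_adjoin_iff.1 hs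
    obtain ⟨t, rfl⟩ := I.mem_adjoin_iff.1 ht
    rw [hact] at h
    simp only [← I.α_X, ← map_mul, ← map_add, ← map_sub, ← map_smul] at h
    have h' := I.α_injective h
    have key : ∀ k, coeff (Finsupp.single k 1) (σ (X i)) =
        coeff (Finsupp.single k 1) (x • X 1 + y • X 2 : MvPolynomial (Fin 3) F) := fun k => by
      have := congrArg (coeff (Finsupp.single k 1)) h'
      rwa [coeff_single_one_quadratic, coeff_sub, sub_eq_zero] at this
    constructor
    · rw [linCoeff, Matrix.of_apply, key]
      simp [coeff_X, Finsupp.single_left_inj]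
    · rw [linCoeff, Matrix.of_apply, key]
      simp [coeff_X, Finsupp.single_left_inj]
  · rintro ⟨rfl, rfl⟩
    obtain ⟨k, l₀, l₁, r, s, t, hq⟩ :=
      exists_eq_linear_add_quadratic (aeval ![0, X 0, X 1] (σ (X i)) : MvPolynomial (Fin 2) F)
    have h := killZero_eq_rename (σ (X i))
    rw [I.killZero_imageGroup_X hσG hi, hq] at h
    simp only [map_add, map_mul, rename_X, rename_C, Fin.succ_zero_eq_one, Fin.succ_one_eq_two] at h
    have hk : k = 0 := by
      have := congrArg constantCoeff h
      rw [map_add, constantCoeff_quadratic, isWeightedHomogeneous_constantCoeff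
        (I.isWeightedHomogeneous_imageGroup hσG i) (I.d_pos i)] at this
      simpa using this.symm
    have h₁ : linCoeff σ i 1 = l₀ := by
      rw [linCoeff, Matrix.of_apply, h, hk, map_zero, coeff_add, coeff_single_one_quadratic]
      simp [coeff_X, coeff_C_mul, Finsupp.single_left_inj]
    have h₂ : linCoeff σ i 2 = l₁ := by
      rw [linCoeff, Matrix.of_apply, h, hk, map_zero, coeff_add, coeff_single_one_quadratic]
      simp [coeff_X, coeff_C_mul, Finsupp.single_left_inj]
    refine ⟨_, _, _, I.mem_adjoin_iff.2 ⟨r, rfl⟩, I.mem_adjoin_iff.2 ⟨s, rfl⟩,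
      I.mem_adjoin_iff.2 ⟨t, rfl⟩, ?_⟩
    rw [hact, h, h₁, h₂, hk]
    simp only [← I.α_X, ← map_mul, ← map_add, ← map_sub, ← map_smul]
    congr 1
    rw [MvPolynomial.smul_eq_C_mul, MvPolynomial.smul_eq_C_mul, map_zero]
    ring

theorem isGorensteinRing_iff_det {p : ℕ} [Fact p.Prime] [CharP F p] [Finite G] :
    IsGorensteinRing (invariantRing G) ↔
      ∀ g ∈ G, ∃ c : Matrix (Fin 2) (Fin 2) F,
        (∃ r s t : MvPolynomial (Fin 3) F, r ∈ Algebra.adjoin F {I.a 1, I.a 2} ∧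
          s ∈ Algebra.adjoin F {I.a 1, I.a 2} ∧ t ∈ Algebra.adjoin F {I.a 1, I.a 2} ∧
          polyAct (g : Matrix (Fin 3) (Fin 3) F) (I.a 1) - (c 0 0 • I.a 1 + c 0 1 • I.a 2) =
            r * (I.a 1 * I.a 1) + s * (I.a 1 * I.a 2) + t * (I.a 2 * I.a 2)) ∧
        (∃ r s t : MvPolynomial (Fin 3) F, r ∈ Algebra.adjoin F {I.a 1, I.a 2} ∧
          s ∈ Algebra.adjoin F {I.a 1, I.a 2} ∧ t ∈ Algebra.adjoin F {I.a 1, I.a 2} ∧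
          polyAct (g : Matrix (Fin 3) (Fin 3) F) (I.a 2) - (c 1 0 • I.a 1 + c 1 1 • I.a 2) =
            r * (I.a 1 * I.a 1) + s * (I.a 1 * I.a 2) + t * (I.a 2 * I.a 2)) ∧
        c.det = (subW g).det := by
  rw [I.isGorensteinRing_iff (p := p)]
  have hdet : ∀ g ∈ G, (g : Matrix (Fin 3) (Fin 3) F) 0 0 * (subW g).det = 1 := fun g hg => by
    rw [subW, ← (I.isBlock g hg).det, g.det_coe]
  have hc : ∀ g ∈ G, ∀ x : F, (g : Matrix (Fin 3) (Fin 3) F) 0 0 * x = 1 ↔ x = (subW g).det := by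
    intro g hg x
    have := mul_right_inj' (left_ne_zero_of_mul_eq_one (hdet g hg)) (b := x) (c := (subW g).det)
    rwa [hdet g hg] at this
  constructor
  · intro h g hg
    obtain ⟨σ, hσ⟩ := I.exists_imageGroup_α hg
    exact ⟨(linCoeff σ.1).submatrix Fin.succ Fin.succ,
      (I.exists_quadratic_iff hg hσ (by decide) _ _).2 ⟨rfl, rfl⟩,
      (I.exists_quadratic_iff hg hσ (by decide) _ _).2 ⟨rfl, rfl⟩, (hc g hg _).1 (h g hg σ hσ)⟩
  · intro h g hg σ hσ
    obtain ⟨c, h₁, h₂, h₃⟩ := h g hg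
    obtain ⟨h₀₀, h₀₁⟩ := (I.exists_quadratic_iff hg hσ (by decide) _ _).1 h₁
    obtain ⟨h₁₀, h₁₁⟩ := (I.exists_quadratic_iff hg hσ (by decide) _ _).1 h₂
    rw [hc g hg, ← h₃, det_fin_two, det_fin_two, h₀₀, h₀₁, h₁₀, h₁₁]
    rfl

end TransInvariants

end

/-- Chapter A criterion: with `V = F·e₀ ⊕ W`, `W = span {e 1, e 2}`, and
`S(W)^{T(G)} = F[a₁, a₂]` a polynomial ring with homogeneous maximal ideal `m = (a₁, a₂)`,
the ring `S(V)^G` is Gorenstein iff `det (g|W) = det (g|m/m²)` for every `g ∈ G`. -/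
theorem stmt3 (p : ℕ) [Fact p.Prime] (F : Type u) [Field F] [CharP F p]
    (G : Subgroup (Matrix.SpecialLinearGroup (Fin 3) F)) [Finite G]
    (hblock : ∀ g ∈ G, (g : Matrix (Fin 3) (Fin 3) F) 0 1 = 0 ∧
      (g : Matrix (Fin 3) (Fin 3) F) 0 2 = 0 ∧ (g : Matrix (Fin 3) (Fin 3) F) 1 0 = 0 ∧
      (g : Matrix (Fin 3) (Fin 3) F) 2 0 = 0)
    (a₁ a₂ : MvPolynomial (Fin 3) F) (d₁ d₂ : ℕ) (hd₁ : 0 < d₁) (hd₂ : 0 < d₂)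
    (ha₁W : a₁ ∈ MvPolynomial.supported F ({1, 2} : Set (Fin 3)))
    (ha₂W : a₂ ∈ MvPolynomial.supported F ({1, 2} : Set (Fin 3)))
    (hhom₁ : a₁.IsHomogeneous d₁) (hhom₂ : a₂.IsHomogeneous d₂)
    (hinv : ∀ τ ∈ transSubgroup G, polyAct (τ : Matrix (Fin 3) (Fin 3) F) a₁ = a₁ ∧
      polyAct (τ : Matrix (Fin 3) (Fin 3) F) a₂ = a₂)
    (hindep : AlgebraicIndependent F ![a₁, a₂])
    (hgen : invariantRing (transSubgroup G) ⊓ MvPolynomial.supported F ({1, 2} : Set (Fin 3)) =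
      Algebra.adjoin F {a₁, a₂}) :
    IsGorensteinRing ↥(invariantRing G) ↔
      ∀ g ∈ G, ∃ c : Matrix (Fin 2) (Fin 2) F,
        (∃ r s t : MvPolynomial (Fin 3) F, r ∈ Algebra.adjoin F {a₁, a₂} ∧
          s ∈ Algebra.adjoin F {a₁, a₂} ∧ t ∈ Algebra.adjoin F {a₁, a₂} ∧
          polyAct (g : Matrix (Fin 3) (Fin 3) F) a₁ - (c 0 0 • a₁ + c 0 1 • a₂) =
            r * (a₁ * a₁) + s * (a₁ * a₂) + t * (a₂ * a₂)) ∧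
        (∃ r s t : MvPolynomial (Fin 3) F, r ∈ Algebra.adjoin F {a₁, a₂} ∧
          s ∈ Algebra.adjoin F {a₁, a₂} ∧ t ∈ Algebra.adjoin F {a₁, a₂} ∧
          polyAct (g : Matrix (Fin 3) (Fin 3) F) a₂ - (c 1 0 • a₁ + c 1 1 • a₂) =
            r * (a₁ * a₁) + s * (a₁ * a₂) + t * (a₂ * a₂)) ∧
        c.det = (subW g).det := by
  let I : TransInvariants G :=
    { a := ![X 0, a₁, a₂]
      d := ![1, d₁, d₂]
      isBlock := fun g hg =>
        ⟨(hblock g hg).1, (hblock g hg).2.1, (hblock g hg).2.2.1, (hblock g hg).2.2.2⟩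
      a_zero := rfl
      d_pos := by
        intro i
        fin_cases i
        exacts [one_pos, hd₁, hd₂]
      hom := by
        intro i
        fin_cases i
        exacts [isHomogeneous_X F 0, hhom₁, hhom₂]
      killZero_a_one := killZero_eq_self ha₁W
      killZero_a_two := killZero_eq_self ha₂W
      polyAct_a := by
        have hG : ∀ g ∈ G, IsBlock (g : Matrix (Fin 3) (Fin 3) F) := fun g hg =>
          ⟨(hblock g hg).1, (hblock g hg).2.1, (hblock g hg).2.2.1, (hblock g hg).2.2.2⟩
        intro τ hτ i
        fin_cases i
        · refine (hG τ (transSubgroup_le G hτ)).polyAct_X_zero.trans ?_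
          rw [transSubgroup_apply_zero_zero hG hτ, one_smul]
          rfl
        · exact (hinv τ hτ).1
        · exact (hinv τ hτ).2
      indep := fun q hq => hindep (hq.trans (map_zero _).symm)
      gen := by
        intro f hf hf'
        have h₁ : f ∈ invariantRing (transSubgroup G) ⊓
            MvPolynomial.supported F ({1, 2} : Set (Fin 3)) :=
          ⟨hf, hf' ▸ killZero_mem_supported f⟩
        have h : ({a₁, a₂} : Set (MvPolynomial (Fin 3) F)) = Set.range ![a₁, a₂] := by
          rw [Matrix.range_cons, Matrix.range_cons, Matrix.range_empty, Set.union_empty]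
          rfl
        rw [hgen, h, Algebra.adjoin_range_eq_range_aeval] at h₁
        exact h₁ }
  exact I.isGorensteinRing_iff_det (p := p)

end
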